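/- arXiv:2304.12065 — 2 statements merged into one kernel-verified Lean document; each statement's English description precedes it below -/
import Mathlib

section
/- Let $2 \leq r \leq n$ be integers. Then for every $k \in \{1,\dots,r\}$ and all convex bodies $A, B_1,\dots,B_r$ in $\mathbb{R}^n$: $|A|^{r-1} V(B_1,\dots,B_r, A[n-r]) \leq 2^{k(k-1)/2} \frac{n^{r-k}}{(r-k)!} \prod_{i=1}^r V(B_i, A[n-1])$. In particular, taking $k=1$, $|A|^{r-1} V(B_1,\dots,B_r,A[n-r]) \leq \frac{n^{r-1}}{(r-1)!} \prod_{i=1}^r V(B_i,A[n-1])$. -/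
open scoped Pointwise
open MeasureTheory

/-- A convex body in `ℝⁿ`: a compact convex set with nonempty interior. -/
def IsConvexBody {n : ℕ} (K : Set (EuclideanSpace ℝ (Fin n))) : Prop :=
  Convex ℝ K ∧ IsCompact K ∧ (interior K).Nonempty

/-- The mixed volume of `n` convex bodies in `ℝⁿ`, via the
inclusion-exclusion (polarization) formula for Minkowski sums. -/
noncomputable def mixedVolume {n : ℕ} (K : Fin n → Set (EuclideanSpace ℝ (Fin n))) : ℝ :=
  ((n.factorial : ℝ))⁻¹ *
    ∑ S : Finset (Fin n), (-1 : ℝ) ^ (n + S.card) * (volume (∑ i ∈ S, K i)).toReal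



/-- the function `n^n / n!` -/
noncomputable def gfun (n : ℕ) : ℝ := (n : ℝ) ^ n / (n.factorial : ℝ)

lemma gfun_pos (n : ℕ) : 0 < gfun n := by
  unfold gfun
  rcases Nat.eq_zero_or_pos n with h | h
  · subst h; norm_num
  · have : (0 : ℝ) < n := by exact_mod_cast h
    positivity

lemma gfun_succ (n : ℕ) (hn : 0 < n) : gfun (n + 1) = (1 + 1 / (n : ℝ)) ^ n * gfun n := by
  unfold gfun
  have h0 : (0 : ℝ) < n := by exact_mod_cast hn
  have h1 : (n.factorial : ℝ) ≠ 0 := by positivity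
  rw [Nat.factorial_succ]
  push_cast
  have : (1 + 1 / (n : ℝ)) = ((n : ℝ) + 1) / n := by field_simp
  rw [this, div_pow]
  field_simp
  ring

lemma one_add_inv_pow_le_exp (N : ℕ) (hN : 0 < N) : (1 + 1 / (N : ℝ)) ^ N ≤ Real.exp 1 := by
  have h0 : (0 : ℝ) < N := by exact_mod_cast hN
  have := Real.add_one_le_exp (1 / (N : ℝ))
  calc (1 + 1 / (N : ℝ)) ^ N ≤ (Real.exp (1 / (N : ℝ))) ^ N := by
        apply pow_le_pow_left₀ (by positivity); linarith
    _ = Real.exp 1 := by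
        rw [← Real.exp_nat_mul]; congr 1; field_simp

lemma gfun_ratio_sq (N k : ℕ) (hN : 0 < N) : (gfun (N + k)) ^ 2 ≤ 8 ^ k * (gfun N) ^ 2 := by
  induction k with
  | zero => simp
  | succ k ih =>
    have h1 := gfun_succ (N + k) (by omega)
    have h2 := one_add_inv_pow_le_exp (N + k) (by omega)
    have h3 : Real.exp 1 < 2.7182818286 := Real.exp_one_lt_d9
    have h4 : (0 : ℝ) ≤ (1 + 1 / ((N + k : ℕ) : ℝ)) ^ (N + k) := by positivity
    rw [← add_assoc, h1, mul_pow, pow_succ]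
    have h5 : ((1 + 1 / ((N + k : ℕ) : ℝ)) ^ (N + k)) ^ 2 ≤ 8 := by nlinarith
    calc _ ≤ 8 * (8 ^ k * (gfun N) ^ 2) := by
          apply mul_le_mul h5 ih (by positivity) (by norm_num)
      _ = _ := by ring

lemma gfun_ratio_le (m s : ℕ) (hm : 0 < m) :
    gfun (m + s) ≤ gfun m * (((m + s : ℕ) : ℝ) ^ s / (s.factorial : ℝ)) := by
  have key : ∀ s : ℕ, ((m + s : ℕ) : ℝ) ^ m * (m.factorial : ℝ) * (s.factorial : ℝ)
      ≤ ((m + s).factorial : ℝ) * (m : ℝ) ^ m := by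
    intro s
    induction s with
    | zero => simp [mul_comm]
    | succ s ih =>
      have hpos : (0 : ℝ) < (m : ℝ) + s := by positivity
      have hb := one_add_mul_le_pow (a := -(1 / ((m : ℝ) + s + 1))) (by
        have : 1 / ((m : ℝ) + s + 1) ≤ 1 := by
          rw [div_le_one (by positivity)]; linarith
        linarith) m
      have e1 : 1 + -(1 / ((m : ℝ) + s + 1)) = ((m : ℝ) + s) / (m + s + 1) := by field_simp; ring
      have e2 : 1 + (m : ℝ) * -(1 / ((m : ℝ) + s + 1)) = ((s : ℝ) + 1) / (m + s + 1) := by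
        field_simp; ring
      rw [e1, e2, div_pow, div_le_div_iff₀ (by positivity) (by positivity)] at hb
      -- hb : (s+1) * (m+s+1)^m ≤ (m+s)^m * (m+s+1)
      rw [← add_assoc, Nat.factorial_succ, Nat.factorial_succ]
      push_cast at ih ⊢
      have hf : (0 : ℝ) ≤ (m.factorial : ℝ) * (s.factorial : ℝ) := by positivity
      calc ((m : ℝ) + s + 1) ^ m * m.factorial * ((s + 1) * s.factorial)
          = ((s : ℝ) + 1) * (m + s + 1) ^ m * (m.factorial * s.factorial) := by ring
        _ ≤ (((m : ℝ) + s) ^ m * (m + s + 1)) * (m.factorial * s.factorial) := by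
            apply mul_le_mul_of_nonneg_right hb hf
        _ = ((m : ℝ) + s + 1) * (((m : ℝ) + s) ^ m * m.factorial * s.factorial) := by ring
        _ ≤ ((m : ℝ) + s + 1) * (((m + s).factorial : ℝ) * (m : ℝ) ^ m) := by
            apply mul_le_mul_of_nonneg_left ih (by positivity)
        _ = _ := by ring
  have h := key s
  unfold gfun
  rw [div_mul_div_comm, div_le_div_iff₀ (by positivity) (by positivity), pow_add]
  have : (0 : ℝ) ≤ ((m + s : ℕ) : ℝ) ^ s := by positivity
  calc _ = ((m + s : ℕ) : ℝ) ^ s * (((m + s : ℕ) : ℝ) ^ m * (m.factorial : ℝ) * (s.factorial : ℝ)) := by ring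
    _ ≤ ((m + s : ℕ) : ℝ) ^ s * (((m + s).factorial : ℝ) * (m : ℝ) ^ m) := by
        apply mul_le_mul_of_nonneg_left h this
    _ = _ := by ring

/-- the constant -/
noncomputable def Bc (n r k : ℕ) : ℝ :=
  (2 : ℝ) ^ (k * (k - 1) / 2) * (n : ℝ) ^ (r - k) / ((r - k).factorial : ℝ)

lemma E_le_Bc_large (m r k : ℕ) (hm : 1 ≤ m) (hk : 4 ≤ k) (hkr : k ≤ r) :
    gfun (m + r) ≤ gfun m * Bc (m + r) r k := by
  obtain ⟨s, rfl⟩ : ∃ s, r = s + k := ⟨r - k, by omega⟩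
  have h1 := gfun_ratio_le m s hm
  have h2 := gfun_ratio_sq (m + s) k (by omega)
  have e : (8 : ℝ) ^ k ≤ (2 ^ (k * (k - 1) / 2)) ^ 2 := by
    rw [show (8 : ℝ) = 2 ^ 3 by norm_num, ← pow_mul, ← pow_mul]
    apply pow_le_pow_right₀ (by norm_num)
    have h2 : 2 ∣ k * (k - 1) := (Nat.even_mul_pred_self k).two_dvd
    rw [Nat.div_mul_cancel h2, mul_comm 3 k]
    exact Nat.mul_le_mul_left _ (by omega)
  have h3 : gfun (m + s + k) ≤ 2 ^ (k * (k - 1) / 2) * gfun (m + s) := by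
    have hp1 := gfun_pos (m + s)
    have hp2 := gfun_pos (m + s + k)
    refine (pow_le_pow_iff_left₀ hp2.le (by positivity) (two_ne_zero)).1 ?_
    rw [mul_pow]
    refine h2.trans ?_
    apply mul_le_mul_of_nonneg_right e (by positivity)
  unfold Bc
  rw [← add_assoc, Nat.add_sub_cancel]
  have hg := gfun_pos m
  calc gfun (m + s + k) ≤ 2 ^ (k * (k - 1) / 2) * gfun (m + s) := h3
    _ ≤ 2 ^ (k * (k - 1) / 2) * (gfun m * (((m + s : ℕ) : ℝ) ^ s / (s.factorial : ℝ))) := by gcongr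
    _ ≤ 2 ^ (k * (k - 1) / 2) * (gfun m * (((m + s + k : ℕ) : ℝ) ^ s / (s.factorial : ℝ))) := by
        have hle : ((m + s : ℕ) : ℝ) ≤ ((m + s + k : ℕ) : ℝ) := by
          exact_mod_cast Nat.le_add_right _ _
        have := pow_le_pow_left₀ (by positivity) hle s
        gcongr ?_ * (?_ * (?_ / ?_))
    _ = _ := by ring

lemma step_ineq (m r k : ℕ) (hm : 2 ≤ m) (hr : 4 ≤ r) (hk : k ≤ 3) :
    (1 + 1 / ((m + r : ℕ) : ℝ)) ^ (m + k) ≤ (1 + 1 / (m : ℝ)) ^ m := by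
  have hm0 : (0 : ℝ) < m := by positivity
  have h1 : (1 + 1 / ((m + r : ℕ) : ℝ)) ^ (m + k) ≤ (1 + 1 / ((m : ℝ) + 4)) ^ (m + 3) := by
    have hr' : (4 : ℝ) ≤ r := by exact_mod_cast hr
    have ha : (1 : ℝ) + 1 / ((m + r : ℕ) : ℝ) ≤ 1 + 1 / ((m : ℝ) + 4) := by
      push_cast; gcongr
    calc _ ≤ (1 + 1 / ((m : ℝ) + 4)) ^ (m + k) := by gcongr
      _ ≤ _ := by
        apply pow_le_pow_right₀
        · have : (0 : ℝ) < 1 / ((m : ℝ) + 4) := by positivity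
          linarith
        · omega
  refine h1.trans ?_
  rcases Nat.lt_or_ge m 3 with h | h
  · have : m = 2 := by omega
    subst this; norm_num
  have hm3 : (3 : ℝ) ≤ m := by exact_mod_cast h
  rw [← Real.log_le_log_iff (by positivity) (by positivity), Real.log_pow, Real.log_pow]
  have u : Real.log (1 + 1 / ((m : ℝ) + 4)) ≤ 1 / ((m : ℝ) + 4) := by
    have := Real.log_le_sub_one_of_pos (x := 1 + 1 / ((m : ℝ) + 4)) (by positivity)
    linarith
  have l := Real.le_log_one_add_of_nonneg (x := 1 / (m : ℝ)) (by positivity)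
  have l2 : 2 * (1 / (m : ℝ)) / (1 / m + 2) = 2 / (2 * m + 1) := by field_simp; ring
  rw [l2] at l
  push_cast
  calc ((m : ℝ) + 3) * Real.log (1 + 1 / ((m : ℝ) + 4)) ≤ (m + 3) * (1 / ((m : ℝ) + 4)) := by gcongr
    _ ≤ m * (2 / (2 * m + 1)) := by
        rw [mul_one_div, mul_div_assoc', div_le_div_iff₀ (by positivity) (by positivity)]
        nlinarith
    _ ≤ _ := by gcongr

lemma E_le_Bc_small (m r k : ℕ) (hm : 2 ≤ m) (hr : 4 ≤ r) (hk1 : 1 ≤ k) (hk : k ≤ 3) :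
    gfun (m + r) ≤ gfun m * Bc (m + r) r k := by
  induction m, hm using Nat.le_induction with
  | base =>
    have hg2 : gfun 2 = 2 := by norm_num [gfun, Nat.factorial]
    rw [hg2]
    obtain ⟨s, rfl⟩ : ∃ s, r = s + 4 := ⟨r - 4, by omega⟩
    unfold gfun Bc
    have hs : (0 : ℝ) ≤ s := by positivity
    have hfac : ((2 + (s + 4)).factorial : ℝ)
        = (s + 6) * (s + 5) * (s + 4) * (s + 3) * (s + 2) * (s + 1) * (s.factorial : ℝ) := by
      rw [show 2 + (s + 4) = s + 6 by ring]
      simp only [Nat.factorial_succ]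
      push_cast; ring
    have hfp : (0 : ℝ) < s.factorial := by positivity
    have hcast : ((2 + (s + 4) : ℕ) : ℝ) = s + 6 := by push_cast; ring
    rw [hfac, hcast]
    interval_cases k
    · have e : s + 4 - 1 = s + 3 := by omega
      have f3 : ((s + 3).factorial : ℝ) = (s + 3) * (s + 2) * (s + 1) * s.factorial := by
        simp only [Nat.factorial_succ]; push_cast; ring
      rw [e, f3, show 2 + (s + 4) = (s + 3) + 3 by ring, pow_add, ← mul_div_assoc, div_le_div_iff₀ (by positivity) (by positivity)]
      norm_num
      have hp : (0 : ℝ) ≤ (s + 6 : ℝ) ^ (s + 3) * (s + 6) * (s.factorial * ((s + 3) * (s + 2) * (s + 1))) := by positivity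
      have h : (s + 6 : ℝ) ^ 2 ≤ 2 * ((s + 5) * (s + 4)) := by nlinarith
      nlinarith [mul_le_mul_of_nonneg_left h hp]
    · have e : s + 4 - 2 = s + 2 := by omega
      have f3 : ((s + 2).factorial : ℝ) = (s + 2) * (s + 1) * s.factorial := by
        simp only [Nat.factorial_succ]; push_cast; ring
      rw [e, f3, show 2 + (s + 4) = (s + 2) + 4 by ring, pow_add, ← mul_div_assoc, div_le_div_iff₀ (by positivity) (by positivity)]
      norm_num
      have hp : (0 : ℝ) ≤ (s + 6 : ℝ) ^ (s + 2) * (s + 6) * (s.factorial * ((s + 2) * (s + 1))) := by positivity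
      have h : (s + 6 : ℝ) ^ 3 ≤ 4 * ((s + 5) * (s + 4) * (s + 3)) := by nlinarith [pow_nonneg hs 2, pow_nonneg hs 3]
      nlinarith [mul_le_mul_of_nonneg_left h hp]
    · have e : s + 4 - 3 = s + 1 := by omega
      have f3 : ((s + 1).factorial : ℝ) = (s + 1) * s.factorial := by
        simp only [Nat.factorial_succ]; push_cast; ring
      rw [e, f3, show 2 + (s + 4) = (s + 1) + 5 by ring, pow_add, ← mul_div_assoc, div_le_div_iff₀ (by positivity) (by positivity)]
      norm_num
      have hp : (0 : ℝ) ≤ (s + 6 : ℝ) ^ (s + 1) * (s + 6) * (s.factorial * ((s + 1))) := by positivity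
      have h : (s + 6 : ℝ) ^ 4 ≤ 16 * ((s + 5) * (s + 4) * (s + 3) * (s + 2)) := by nlinarith [pow_nonneg hs 2, pow_nonneg hs 3, pow_nonneg hs 4]
      nlinarith [mul_le_mul_of_nonneg_left h hp]
  | succ m hm ih =>
    have hg := gfun_pos m
    have hst := step_ineq m r k hm hr hk
    rw [show m + 1 + r = (m + r) + 1 by ring, gfun_succ (m + r) (by omega), gfun_succ m (by omega)]
    have hx : (0 : ℝ) < (1 + 1 / ((m + r : ℕ) : ℝ)) := by positivity
    have hB : Bc (m + r + 1) r k = (1 + 1 / ((m + r : ℕ) : ℝ)) ^ (r - k) * Bc (m + r) r k := by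
      unfold Bc
      have hp : (0 : ℝ) < ((m + r : ℕ) : ℝ) := by
        have : 0 < m + r := by omega
        exact_mod_cast this
      have : ((m + r + 1 : ℕ) : ℝ) = (1 + 1 / ((m + r : ℕ) : ℝ)) * ((m + r : ℕ) : ℝ) := by
        field_simp; push_cast; ring
      rw [this, mul_pow]; ring
    have hBp : 0 < Bc (m + r) r k := by
      unfold Bc
      have : (0 : ℝ) < ((m + r : ℕ) : ℝ) := by
        have : 0 < m + r := by omega
        exact_mod_cast this
      positivity
    rw [hB]
    calc (1 + 1 / ((m + r : ℕ) : ℝ)) ^ (m + r) * gfun (m + r)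
        ≤ (1 + 1 / ((m + r : ℕ) : ℝ)) ^ (m + r) * (gfun m * Bc (m + r) r k) := by gcongr
      _ = (1 + 1 / ((m + r : ℕ) : ℝ)) ^ (m + k) * (1 + 1 / ((m + r : ℕ) : ℝ)) ^ (r - k) * (gfun m * Bc (m + r) r k) := by
          rw [← pow_add]; congr 2; omega
      _ ≤ (1 + 1 / (m : ℝ)) ^ m * (1 + 1 / ((m + r : ℕ) : ℝ)) ^ (r - k) * (gfun m * Bc (m + r) r k) := by gcongr
      _ = _ := by ring



/-- normalized mixed volume sequences: what Brunn-Minkowski yields -/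
structure BMSeq (n : ℕ) (W : ℕ → ℝ) : Prop where
  nonneg : ∀ j, 0 ≤ W j
  zero : W 0 = 1
  one : W 1 = 1
  F1 : ∀ t : ℝ, 0 ≤ t → ∑ j ∈ Finset.range (n + 1), (n.choose j : ℝ) * W j * t ^ j ≤ (1 + t) ^ n
  F2 : ∀ t : ℝ, 0 ≤ t → ∑ j ∈ Finset.range n, ((n - 1).choose j : ℝ) * W (j + 1) * t ^ j
      ≤ ∑ j ∈ Finset.range n, ((n - 1).choose j : ℝ) * W j * t ^ j
  F3 : ∀ t : ℝ, 0 ≤ t →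
      (∑ j ∈ Finset.range (n - 1), ((n - 2).choose j : ℝ) * W j * t ^ j) *
      (∑ j ∈ Finset.range (n - 1), ((n - 2).choose j : ℝ) * W (j + 2) * t ^ j)
      ≤ (∑ j ∈ Finset.range (n - 1), ((n - 2).choose j : ℝ) * W (j + 1) * t ^ j) ^ 2

namespace BMSeq
variable {n : ℕ} {W : ℕ → ℝ}

lemma W2_le (h : BMSeq n W) (hn : 2 ≤ n) : W 2 ≤ 1 := by
  obtain ⟨m, rfl⟩ : ∃ m, n = m + 2 := ⟨n - 2, by omega⟩
  have := h.F3 0 le_rfl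
  simp only [show m + 2 - 1 = m + 1 by omega, Finset.sum_range_succ'] at this
  simpa [h.zero, h.one] using this

lemma term_le (h : BMSeq n W) (r : ℕ) (hr : r ≤ n) (t : ℝ) (ht : 0 ≤ t) :
    (n.choose r : ℝ) * W r * t ^ r ≤ (1 + t) ^ n := by
  refine le_trans ?_ (h.F1 t ht)
  refine Finset.single_le_sum (f := fun j => (n.choose j : ℝ) * W j * t ^ j) (fun j _ => ?_) ?_
  · have := h.nonneg j
    positivity
  · simp; omega

lemma Wn_le (h : BMSeq n W) : W n ≤ 1 := by
  have key : ∀ t : ℝ, 0 < t → W n ≤ (1 + 1 / t) ^ n := by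
    intro t ht
    have := h.term_le n le_rfl t ht.le
    simp at this
    have e : (1 + 1 / t) = (1 + t) / t := by field_simp; ring
    rw [e, div_pow, le_div_iff₀ (by positivity)]
    exact this
  have lim : Filter.Tendsto (fun t : ℝ => (1 + 1 / t) ^ n) Filter.atTop (nhds ((1 + 0) ^ n)) := by
    apply Filter.Tendsto.pow
    apply Filter.Tendsto.add tendsto_const_nhds
    exact (tendsto_inv_atTop_zero (𝕜 := ℝ)).congr (fun x => (one_div x).symm)
  simp only [add_zero, one_pow] at lim
  apply ge_of_tendsto lim
  filter_upwards [Filter.eventually_gt_atTop 0] with t ht using key t ht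

lemma main_F1 (h : BMSeq n W) (m r : ℕ) (hm : 0 < m) (hn : n = m + r) (hr : 0 < r) :
    gfun r * W r * gfun m ≤ gfun n := by
  subst hn
  have hm0 : (0 : ℝ) < m := by exact_mod_cast hm
  have hr0 : (0 : ℝ) < r := by exact_mod_cast hr
  have h1 := h.term_le r (by omega) (r / m) (by positivity)
  have e1 : ((m + r).choose r : ℝ) = ((m + r).factorial : ℝ) / (m.factorial * r.factorial) := by
    rw [Nat.add_choose, Nat.cast_div (Nat.factorial_mul_factorial_dvd_factorial_add m r) (by positivity)]
    push_cast; rfl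
  have e2 : (1 : ℝ) + r / m = ((m + r : ℕ) : ℝ) / m := by push_cast; field_simp
  rw [e1, e2, div_pow, div_pow, pow_add (m : ℝ) m r] at h1
  unfold gfun
  have : (0 : ℝ) < (m : ℝ) ^ m / ((m + r).factorial : ℝ) * (m : ℝ) ^ r := by positivity
  have h2 := mul_le_mul_of_nonneg_left h1 this.le
  have l : ∀ a b : ℝ, a ≤ b → ∀ c d : ℝ, c = a → d = b → c ≤ d := by
    intro a b h c d hc hd; rw [hc, hd]; exact h
  refine l _ _ h2 _ _ ?_ ?_
  · field_simp
  · field_simp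
end BMSeq

lemma Bc_pos (n r k : ℕ) (hn : 0 < n) : 0 < Bc n r k := by
  unfold Bc
  have : (0 : ℝ) < n := by exact_mod_cast hn
  positivity

lemma Bc_succ (n r k : ℕ) (hn : 0 < n) (hk : k + 1 ≤ r) :
    Bc n r (k + 1) * n = Bc n r k * (2 ^ k * ((r : ℝ) - k)) := by
  obtain ⟨s, rfl⟩ : ∃ s, r = s + k + 1 := ⟨r - k - 1, by omega⟩
  unfold Bc
  have e1 : s + k + 1 - (k + 1) = s := by omega
  have e2 : s + k + 1 - k = s + 1 := by omega
  have e3 : (k + 1) * (k + 1 - 1) / 2 = k + k * (k - 1) / 2 := by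
    have h2 : 2 ∣ k * (k - 1) := (Nat.even_mul_pred_self k).two_dvd
    obtain ⟨c, hc⟩ := h2
    rw [hc]
    have : (k + 1) * (k + 1 - 1) = 2 * (k + c) := by
      rw [mul_add, ← hc]
      rcases k with _ | k
      · simp
      · simp; ring
    rw [this]; omega
  rw [e1, e2, e3, Nat.factorial_succ, pow_add, pow_succ]
  push_cast
  have : (0 : ℝ) < s.factorial := by positivity
  have h3 : (s : ℝ) + 1 ≠ 0 := by positivity
  field_simp
  ring

lemma Bc_zero (r : ℕ) : Bc r r 0 = gfun r := by
  simp [Bc, gfun]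

lemma gfun_le_Bc_self (r k : ℕ) (hk : k ≤ r) (hr : 0 < r) : gfun r ≤ Bc r r k := by
  induction k with
  | zero => rw [Bc_zero]
  | succ k ih =>
    refine (ih (by omega)).trans ?_
    have h := Bc_succ r r k hr hk
    have hr0 : (0 : ℝ) < r := by exact_mod_cast hr
    have hp := Bc_pos r r k hr
    have : (r : ℝ) ≤ 2 ^ k * ((r : ℝ) - k) := by
      have h1 : ((k : ℝ) + 1) ≤ 2 ^ k := by exact_mod_cast Nat.lt_two_pow_self (n := k)
      have h2 : ((k : ℝ) + 1) ≤ r := by exact_mod_cast hk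
      have h3 : (0 : ℝ) ≤ k := by positivity
      nlinarith [mul_le_mul_of_nonneg_right h1 (show 0 ≤ (r : ℝ) - k by linarith)]
    have h2 := mul_le_mul_of_nonneg_left this hp.le
    rw [← h] at h2
    exact le_of_mul_le_mul_right h2 hr0

lemma Bc_mono_of (r k : ℕ) (hr : 3 ≤ r) (hk1 : 1 ≤ k) (hk : k ≤ r) : Bc (r + 1) r 1 ≤ Bc (r + 1) r k := by
  induction k, hk1 using Nat.le_induction with
  | base => exact le_rfl
  | succ k hk1 ih =>
    refine (ih (by omega)).trans ?_
    have h := Bc_succ (r + 1) r k (by omega) hk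
    have hp := Bc_pos (r + 1) r k (by omega)
    have hr0 : (0 : ℝ) < ((r + 1 : ℕ) : ℝ) := by positivity
    have : ((r + 1 : ℕ) : ℝ) ≤ 2 ^ k * ((r : ℝ) - k) := by
      have h1 : ((k : ℝ) + 1) ≤ 2 ^ k := by exact_mod_cast Nat.lt_two_pow_self (n := k)
      have h2 : ((k : ℝ) + 1) ≤ r := by exact_mod_cast hk
      have h3 : (1 : ℝ) ≤ k := by exact_mod_cast hk1
      have h4 : (3 : ℝ) ≤ r := by exact_mod_cast hr
      have h5 : 2 * (k : ℝ) ≤ 2 ^ k := by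
        obtain ⟨j, rfl⟩ : ∃ j, k = j + 1 := ⟨k - 1, by omega⟩
        have : ((j : ℝ) + 1) ≤ 2 ^ j := by exact_mod_cast Nat.lt_two_pow_self (n := j)
        rw [pow_succ]; push_cast; linarith
      push_cast
      nlinarith [mul_le_mul_of_nonneg_right h5 (show 0 ≤ (r : ℝ) - k by linarith), mul_nonneg (show 0 ≤ (k : ℝ) - 1 by linarith) (show 0 ≤ (r : ℝ) - k - 1 by linarith)]
    have h2 := mul_le_mul_of_nonneg_left this hp.le
    rw [← h] at h2
    exact le_of_mul_le_mul_right h2 hr0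



namespace BMSeq
variable {n : ℕ} {W : ℕ → ℝ}

lemma case4 (h : BMSeq 4 W) : W 3 ≤ (4 / 3 : ℝ) ^ 2 := by
  have h1 := h.F2 1 (by norm_num)
  have a0 := h.zero
  have a1 := h.one
  have b4 := h.nonneg 4
  norm_num [Finset.sum_range_succ, Nat.choose, a0, a1] at h1 ⊢
  linarith

lemma case5 (h : BMSeq 5 W) : W 4 ≤ (5 / 4 : ℝ) ^ 3 := by
  have h1 := h.F2 (3/2) (by norm_num)
  have a0 := h.zero
  have a1 := h.one
  have a2 := h.W2_le (by norm_num)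
  have b4 := h.nonneg 5
  norm_num [Finset.sum_range_succ, Nat.choose, a0, a1] at h1 ⊢
  linarith

lemma case6 (h : BMSeq 6 W) : W 5 ≤ (6 / 5 : ℝ) ^ 4 := by
  have h1 := h.F2 (17/50) (by norm_num)
  have h2 := h.F2 (37/100) (by norm_num)
  have h3 := h.F2 (217/100) (by norm_num)
  have a0 := h.zero
  have a1 := h.one
  have a2 := h.W2_le (by norm_num)
  have b2 := h.nonneg 2
  have b3 := h.nonneg 3
  have b4 := h.nonneg 4
  have b5 := h.nonneg 5
  have b6 := h.nonneg 6
  norm_num [Finset.sum_range_succ, Nat.choose, a0, a1] at h1 h2 h3 ⊢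
  linarith

lemma case7 (h : BMSeq 7 W) : W 6 ≤ (7 / 6 : ℝ) ^ 5 := by
  have h1 := h.F2 (49/100) (by norm_num)
  have h2 := h.F2 (53/100) (by norm_num)
  have h3 := h.F2 (5/2) (by norm_num)
  have a0 := h.zero
  have a1 := h.one
  have a2 := h.W2_le (by norm_num)
  have b2 := h.nonneg 2
  have b3 := h.nonneg 3
  have b4 := h.nonneg 4
  have b5 := h.nonneg 5
  have b6 := h.nonneg 6
  have b7 := h.nonneg 7
  norm_num [Finset.sum_range_succ, Nat.choose, a0, a1] at h1 h2 h3 ⊢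
  linarith

/-- reformulation of F2 -/
lemma F2' (h : BMSeq n W) (hn : 1 ≤ n) (t : ℝ) (ht : 0 ≤ t) :
    ∑ j ∈ Finset.range (n + 1), (n.choose j : ℝ) * W j * t ^ j * (j - (n - j) * t) ≤ 0 := by
  obtain ⟨m, rfl⟩ : ∃ m, n = m + 1 := ⟨n - 1, by omega⟩
  have h2 := h.F2 t ht
  simp only [Nat.add_sub_cancel] at h2
  have e1 : ∑ j ∈ Finset.range (m + 1 + 1), ((m + 1).choose j : ℝ) * W j * t ^ j * j
      = (m + 1) * t * ∑ j ∈ Finset.range (m + 1), (m.choose j : ℝ) * W (j + 1) * t ^ j := by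
    rw [Finset.sum_range_succ', Finset.mul_sum]
    simp only [Nat.cast_zero, mul_zero, add_zero]
    refine Finset.sum_congr rfl fun j _ => ?_
    have := Nat.add_one_mul_choose_eq m j
    have h' : ((m : ℝ) + 1) * m.choose j = (m + 1).choose (j + 1) * (j + 1) := by exact_mod_cast this
    push_cast
    rw [pow_succ]
    linear_combination (-W (j + 1) * t ^ j * t) * h'
  have e2 : ∑ j ∈ Finset.range (m + 1 + 1), ((m + 1).choose j : ℝ) * W j * t ^ j * (((m + 1 : ℕ) : ℝ) - j)
      = (m + 1) * ∑ j ∈ Finset.range (m + 1), (m.choose j : ℝ) * W j * t ^ j := by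
    rw [Finset.sum_range_succ, Finset.mul_sum]
    simp only [sub_self, mul_zero, add_zero]
    refine Finset.sum_congr rfl fun j hj => ?_
    have hj' : j ≤ m := by simp at hj; omega
    have := Nat.choose_mul_succ_eq m j
    have h' : (m.choose j : ℝ) * (m + 1) = (m + 1).choose j * (((m + 1 : ℕ) : ℝ) - j) := by
      rw [← Nat.cast_sub (by omega)]; exact_mod_cast this
    linear_combination (-W j * t ^ j) * h'
  have e3 : ∑ j ∈ Finset.range (m + 1 + 1), ((m + 1).choose j : ℝ) * W j * t ^ j * (j - (((m + 1 : ℕ) : ℝ) - j) * t)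
     = (m + 1) * t * ∑ j ∈ Finset.range (m + 1), (m.choose j : ℝ) * W (j + 1) * t ^ j
      - t * ((m + 1) * ∑ j ∈ Finset.range (m + 1), (m.choose j : ℝ) * W j * t ^ j) := by
    rw [← e1, ← e2, Finset.mul_sum, ← Finset.sum_sub_distrib]
    refine Finset.sum_congr rfl fun j hj => ?_
    ring
  rw [e3]
  have : (0 : ℝ) ≤ (m + 1) * t := by positivity
  nlinarith [mul_le_mul_of_nonneg_left h2 this]

lemma twopoint (m : ℕ) (h : BMSeq (m + 1) W) (ν θ μ : ℝ) (hν : 1 ≤ ν) (hνn : ν < m + 1) (hθ : 1 ≤ θ)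
    (hμ0 : 0 ≤ μ)
    (hμ : ∀ i : ℕ, 2 ≤ i → (i : ℝ) - ν ≤ μ * θ ^ i) (t : ℝ) (ht : t * (ν * θ) = m + 1 - ν) :
    (m + 1) * W m * t ^ m * ((ν - 1) / θ + μ) ≤ μ * (1 + t) ^ (m + 1) := by
  have hθ0 : 0 < θ := by linarith
  have hν0 : 0 < ν := by linarith
  have ht0 : 0 ≤ t := by
    by_contra hc
    push Not at hc
    have : t * (ν * θ) < 0 := mul_neg_of_neg_of_pos hc (by positivity)
    linarith
  have hF1 := h.F1 t ht0
  have hF2 := h.F2' (by omega) (t * θ) (by positivity)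
  set Q : ℕ → ℝ := fun j => ((m + 1).choose j : ℝ) * W j * t ^ j with hQ
  have hQ0 : ∀ j, 0 ≤ Q j := fun j => by
    have := h.nonneg j
    simp only [hQ]; positivity
  -- each term
  have key : ∑ j ∈ Finset.range (m + 1 + 1), Q j * (θ ^ j * (((m : ℝ) + 1 - j) - ν)) ≥ 0 := by
    have : ∑ j ∈ Finset.range (m + 1 + 1), ((m + 1).choose j : ℝ) * W j * (t * θ) ^ j * (j - (((m + 1 : ℕ) : ℝ) - j) * (t * θ))
       = -((m + 1) / ν) * ∑ j ∈ Finset.range (m + 1 + 1), Q j * (θ ^ j * (((m : ℝ) + 1 - j) - ν)) := by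
      rw [Finset.mul_sum]
      refine Finset.sum_congr rfl fun j hj => ?_
      have e : t * θ = (m + 1 - ν) / ν := by field_simp; linarith
      have : ((j : ℝ) - (((m + 1 : ℕ) : ℝ) - j) * (t * θ)) = -((m + 1) / ν) * (((m : ℝ) + 1 - j) - ν) := by
        rw [e]; push_cast; field_simp; ring
      rw [this, mul_pow]; simp only [hQ]; ring
    rw [this] at hF2
    have hp : 0 < ((m : ℝ) + 1) / ν := by positivity
    by_contra hc
    push Not at hc
    nlinarith
  -- bound
  have b : ∀ j ∈ Finset.range m, Q j * (θ ^ j * (((m : ℝ) + 1 - j) - ν)) ≤ Q j * (μ * θ ^ (m + 1)) := by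
    intro j hj
    have hj' : j < m := by simpa using hj
    apply mul_le_mul_of_nonneg_left _ (hQ0 j)
    obtain ⟨i, hi⟩ : ∃ i, m + 1 = j + i := ⟨m + 1 - j, by omega⟩
    have h1 := hμ i (by omega)
    have h2 : (m : ℝ) + 1 = j + i := by exact_mod_cast hi
    rw [hi, pow_add, h2]
    have h3 : (0 : ℝ) ≤ θ ^ j := by positivity
    nlinarith [mul_le_mul_of_nonneg_left h1 h3]
  rw [Finset.sum_range_succ, Finset.sum_range_succ] at key hF1
  have bs := Finset.sum_le_sum b
  rw [← Finset.sum_mul] at bs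
  push_cast at key
  have hlast : Q (m + 1) * (θ ^ (m + 1) * ((m : ℝ) + 1 - (m + 1) - ν)) ≤ 0 := by
    have := hQ0 (m + 1)
    have : (m : ℝ) + 1 - (m + 1) - ν = -ν := by ring
    rw [this]
    have : 0 ≤ Q (m + 1) * (θ ^ (m + 1) * ν) := by positivity
    linarith
  have hm' : Q m * (θ ^ m * ((m : ℝ) + 1 - m - ν)) = - (Q m * θ ^ m * (ν - 1)) := by ring
  rw [hm'] at key
  have hsum : ∑ j ∈ Finset.range m, Q j ≤ (1 + t) ^ (m + 1) - Q m - Q (m + 1) := by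
    simp only [hQ] at hF1 ⊢; linarith
  have hμθ : 0 ≤ μ * θ ^ (m + 1) := by positivity
  have h5 := mul_le_mul_of_nonneg_right hsum hμθ
  have h6 : Q m * θ ^ m * (ν - 1) ≤ ((1 + t) ^ (m + 1) - Q m) * (μ * θ ^ (m + 1)) := by
    nlinarith [mul_nonneg (hQ0 (m + 1)) hμθ]
  have hQm : Q m = (m + 1) * W m * t ^ m := by
    simp only [hQ]; simp [Nat.choose_succ_self_right]
  rw [← hQm]
  have h7 : θ ^ (m + 1) * (Q m * ((ν - 1) / θ + μ)) ≤ θ ^ (m + 1) * (μ * (1 + t) ^ (m + 1)) := by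
    have : θ ^ (m + 1) * (Q m * ((ν - 1) / θ + μ)) = Q m * θ ^ m * (ν - 1) + Q m * (μ * θ ^ (m + 1)) := by
      rw [pow_succ]; field_simp
    rw [this]; linarith
  exact le_of_mul_le_mul_left h7 (by positivity)

lemma mu_bound (i : ℕ) (hi : 2 ≤ i) : (i : ℝ) - 9 / 5 ≤ 1375 / 6561 * (9 / 5) ^ i := by
  induction i, hi using Nat.le_induction with
  | base => norm_num
  | succ i hi ih =>
    rcases Nat.lt_or_ge i 4 with h | h
    · interval_cases i <;> norm_num
    · have : (4 : ℝ) ≤ i := by exact_mod_cast h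
      rw [pow_succ]; push_cast; nlinarith

lemma big_ineq (m : ℕ) (hm : 7 ≤ m) :
    (1375 / 6561 : ℝ) * (1 + (m - 4 / 5) / (81 / 25)) ^ (m + 1) ≤
      (m + 1) * ((m - 4 / 5) / (81 / 25)) ^ m * ((9 / 5 - 1) / (9 / 5) + 1375 / 6561) * (((m : ℝ) + 1) / m) ^ (m - 1) := by
  rcases Nat.lt_or_ge m 39 with h | h
  · interval_cases m <;> norm_num
  have hm' : (39 : ℝ) ≤ m := by exact_mod_cast h
  have h1 : (1 + (36 / 25 : ℝ) / (m + 1)) ^ (m + 1) ≤ Real.exp (36 / 25) := by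
    have := Real.add_one_le_exp ((36 / 25 : ℝ) / (m + 1))
    calc _ ≤ (Real.exp ((36 / 25 : ℝ) / (m + 1))) ^ (m + 1) := by
          apply pow_le_pow_left₀ (by positivity); linarith
      _ = _ := by
          rw [← Real.exp_nat_mul]; congr 1; push_cast; field_simp
  have hd : (0 : ℝ) < m - 4 / 5 := by linarith
  have h2 : ((m : ℝ) / (m - 4 / 5)) ^ m ≤ Real.exp (0.817) := by
    have := Real.add_one_le_exp ((4 / 5 : ℝ) / (m - 4 / 5))
    have e : (m : ℝ) / (m - 4 / 5) = (4 / 5 : ℝ) / (m - 4 / 5) + 1 := by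
      rw [eq_comm, div_add_one hd.ne']; congr 1; ring
    calc _ ≤ (Real.exp ((4 / 5 : ℝ) / (m - 4 / 5))) ^ m := by
          apply pow_le_pow_left₀ (by positivity); rw [e]; exact this
      _ = Real.exp (m * ((4 / 5 : ℝ) / (m - 4 / 5))) := by
          rw [← Real.exp_nat_mul]
      _ ≤ _ := by
          apply Real.exp_le_exp.2
          rw [mul_div_assoc', div_le_iff₀ hd]; nlinarith
  have h3 : Real.exp (36 / 25) * Real.exp 0.817 ≤ 9.6 := by
    rw [← Real.exp_add]
    have a1 : Real.exp (36 / 25 + 0.817) = Real.exp 1 ^ 2 * (Real.exp (-0.032125))⁻¹ ^ 8 := by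
      rw [← Real.exp_nat_mul, ← Real.exp_neg, ← Real.exp_nat_mul, ← Real.exp_add]; norm_num
    have a2 : (Real.exp (-0.032125))⁻¹ ≤ (1 - 0.032125 : ℝ)⁻¹ := by
      apply inv_anti₀ (by norm_num)
      have := Real.add_one_le_exp (-0.032125); linarith
    rw [a1]
    calc _ ≤ (2.7182818286 : ℝ) ^ 2 * ((1 - 0.032125 : ℝ)⁻¹) ^ 8 := by
          apply mul_le_mul _ _ (by positivity) (by positivity)
          · exact pow_le_pow_left₀ (by positivity) Real.exp_one_lt_d9.le _
          · exact pow_le_pow_left₀ (by positivity) a2 _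
      _ ≤ _ := by norm_num
  have h4 : (1 + (36 / 25 : ℝ) / (m + 1)) ^ (m + 1) * ((m : ℝ) / (m - 4 / 5)) ^ m ≤ 9.6 :=
    (mul_le_mul h1 h2 (by positivity) (by positivity)).trans h3
  have e1 : (1 + ((m : ℝ) - 4 / 5) / (81 / 25)) = (m + 1) / (81 / 25) * (1 + (36 / 25 : ℝ) / (m + 1)) := by
    field_simp; ring
  have hm0 : (0 : ℝ) < m := by linarith
  have e2 : ((m : ℝ) - 4 / 5) / (81 / 25) = m / (81 / 25) * ((m : ℝ) / (m - 4 / 5))⁻¹ := by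
    field_simp
  obtain ⟨p, rfl⟩ : ∃ p, m = p + 1 := ⟨m - 1, by omega⟩
  rw [e1, e2]
  set X := (1 + (36 / 25 : ℝ) / (((p + 1 : ℕ) : ℝ) + 1)) ^ (p + 1 + 1)
  set Y := ((((p + 1 : ℕ) : ℝ)) / (((p + 1 : ℕ) : ℝ) - 4 / 5))
  set q := ((p + 1 : ℕ) : ℝ)
  have hY : 0 < Y := by positivity
  rw [mul_pow, mul_pow (q / (81 / 25)), inv_pow, Nat.add_sub_cancel]
  have hYp : 0 < Y ^ (p + 1) := by positivity
  rw [div_pow (q + 1) (81 / 25), div_pow q (81 / 25), div_pow (q + 1) q]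
  have : (1375 / 6561 : ℝ) * ((q + 1) ^ (p + 1 + 1) / (81 / 25) ^ (p + 1 + 1) * X) ≤
     (q + 1) ^ (p + 1) * q / (81 / 25) ^ (p + 1) * (Y ^ (p + 1))⁻¹ * ((9 / 5 - 1) / (9 / 5) + 1375 / 6561) := by
    rw [← sub_nonneg]
    have e : (q + 1) ^ (p + 1) * q / (81 / 25) ^ (p + 1) * (Y ^ (p + 1))⁻¹ * ((9 / 5 - 1) / (9 / 5) + 1375 / 6561) - (1375 / 6561 : ℝ) * ((q + 1) ^ (p + 1 + 1) / (81 / 25) ^ (p + 1 + 1) * X)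
      = (q + 1) ^ (p + 1) / (81 / 25) ^ (p + 1) * (Y ^ (p + 1))⁻¹ * (q * ((9 / 5 - 1) / (9 / 5) + 1375 / 6561) - 1375 / 6561 * (q + 1) / (81 / 25) * (X * Y ^ (p + 1))) := by
      rw [pow_succ (q + 1) (p + 1), pow_succ (81 / 25 : ℝ) (p + 1)]
      field_simp
    rw [e]
    apply mul_nonneg (by positivity)
    have : 0 ≤ (q + 1) := by positivity
    nlinarith [mul_le_mul_of_nonneg_left h4 this]
  refine this.trans (le_of_eq ?_)
  rw [pow_succ (q + 1) p, pow_succ q p]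
  field_simp

lemma case_big (m : ℕ) (hm : 7 ≤ m) (h : BMSeq (m + 1) W) : W m ≤ (((m : ℝ) + 1) / m) ^ (m - 1) := by
  have hm' : (7 : ℝ) ≤ m := by exact_mod_cast hm
  have h1 := h.twopoint m (9 / 5) (9 / 5) (1375 / 6561) (by norm_num) (by linarith) (by norm_num)
    (by norm_num) mu_bound ((m - 4 / 5) / (81 / 25)) (by ring)
  have h2 := big_ineq m hm
  have h3 := h1.trans h2
  have hd : (0 : ℝ) < m - 4 / 5 := by linarith
  have hp : (0 : ℝ) < (m + 1) * ((m - 4 / 5) / (81 / 25)) ^ m * ((9 / 5 - 1) / (9 / 5) + 1375 / 6561) := by positivity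
  refine le_of_mul_le_mul_left ?_ hp
  linarith [h3]

lemma case_r_succ (m : ℕ) (hm : 3 ≤ m) (h : BMSeq (m + 1) W) : W m ≤ (((m : ℝ) + 1) / m) ^ (m - 1) := by
  rcases Nat.lt_or_ge m 7 with h7 | h7
  · interval_cases m
    · have := h.case4; norm_num at this ⊢; exact this
    · have := h.case5; norm_num at this ⊢; exact this
    · have := h.case6; norm_num at this ⊢; exact this
    · have := h.case7; norm_num at this ⊢; exact this
  · exact case_big m h7 h

lemma final_r_succ (m k : ℕ) (hm : 3 ≤ m) (hk1 : 1 ≤ k) (hk : k ≤ m) (h : BMSeq (m + 1) W) :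
    gfun m * W m ≤ Bc (m + 1) m k := by
  refine le_trans ?_ (Bc_mono_of m k hm hk1 hk)
  have h1 := h.case_r_succ m hm
  have hg := gfun_pos m
  refine (mul_le_mul_of_nonneg_left h1 hg.le).trans (le_of_eq ?_)
  obtain ⟨p, rfl⟩ : ∃ p, m = p + 1 := ⟨m - 1, by omega⟩
  unfold gfun Bc
  simp only [Nat.add_sub_cancel, Nat.factorial_succ]
  norm_num
  have hp : (p.factorial : ℝ) ≠ 0 := by positivity
  rw [div_pow, pow_succ ((p : ℝ) + 1) p]
  field_simp

end BMSeq



namespace BMSeq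
variable {n : ℕ} {W : ℕ → ℝ}

lemma w3_num (κ w : ℝ) (hκ : 2 / 3 ≤ κ) (hκ1 : κ ≤ 1) (hw : 0 ≤ w) (hw1 : w ≤ 1) :
    (1 + 3 / 5 * w + 8 / 25 * κ) ^ 2
      < (8 / 5 + 9 / 50 * κ * w + 8 / 125 * (κ * (2 * κ - 1))) * (w + 16 / 15) := by
  have g0 : (1 + 8 / 25 * κ) ^ 2 + 1/50 < (8 / 5 + 8 / 125 * (κ * (2 * κ - 1))) * (16 / 15) := by
    nlinarith [mul_nonneg (sub_nonneg.2 hκ) (sub_nonneg.2 hκ1)]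
  have g1 : (1 + 3 / 5 + 8 / 25 * κ) ^ 2 + 1/50 < (8 / 5 + 9 / 50 * κ + 8 / 125 * (κ * (2 * κ - 1))) * (31 / 15) := by
    nlinarith [mul_nonneg (sub_nonneg.2 hκ) (sub_nonneg.2 hκ1)]
  have hw' : 0 ≤ 1 - w := by linarith
  have h0 := mul_le_mul_of_nonneg_left g0.le hw'
  have h1 := mul_le_mul_of_nonneg_left g1.le hw
  have h2 : 0 ≤ (9/25 - 9/50 * κ) * (w * (1 - w)) := by
    apply mul_nonneg (by linarith) (by positivity)
  nlinarith

lemma w3_abstract (κ w t v y a b c : ℝ) (hκ : 2 / 3 ≤ κ) (hκ1 : κ ≤ 1) (hw : 0 ≤ w) (hw1 : w ≤ 1)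
    (ht : t ≤ 1 / 5) (ht0 : 0 ≤ t) (hv : 16 / 9 < v) (hy : 0 ≤ y)
    (ha : 8 / 5 + 9 / 50 * κ * w + 9 / 250 * (κ * (2 * κ - 1)) * v ≤ a)
    (hb : b = 1 + 3 / 5 * w + 9 / 50 * κ * v + y)
    (hc : w + 3 / 5 * v + 10 / 3 * y ≤ c)
    (hF2 : b + t * c ≤ a + t * b) (hF3 : a * c ≤ b ^ 2) : False := by
  set x := b - (1 + 3 / 5 * w + 8 / 25 * κ) with hx
  have hκv : 8 / 25 * κ ≤ 9 / 50 * κ * v := by nlinarith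
  have hx0 : 0 ≤ x := by rw [hx, hb]; linarith
  have hcx : w + 16 / 15 + 10 / 3 * x ≤ c := by
    refine le_trans ?_ hc
    rw [hx, hb]
    nlinarith
  have hax : 8 / 5 + 9 / 50 * κ * w + 8 / 125 * (κ * (2 * κ - 1)) ≤ a := by
    refine le_trans ?_ ha
    have : 0 ≤ κ * (2 * κ - 1) := mul_nonneg (by linarith) (by linarith)
    nlinarith
  have hbx : b = 1 + 3 / 5 * w + 8 / 25 * κ + x := by rw [hx]; ring
  have hb0 : 0 < b := by rw [hbx]; positivity
  have hc0 : 0 < c := lt_of_lt_of_le (by positivity) hcx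
  have hcb : c ≤ 5 / 4 * b := by
    have h1 : 4 / 5 * b ≤ a := by nlinarith
    have h2 : 4 / 5 * b * c ≤ b ^ 2 := le_trans (mul_le_mul_of_nonneg_right h1 hc0.le) hF3
    have h3 : b * (4 / 5 * c) ≤ b * b := by nlinarith
    have := le_of_mul_le_mul_left h3 hb0
    linarith
  have hxs : x ≤ 3 / 10 := by
    rw [hbx] at hcb
    linarith
  have hnum := w3_num κ w hκ hκ1 hw hw1
  set a0 := 8 / 5 + 9 / 50 * κ * w + 8 / 125 * (κ * (2 * κ - 1)) with ha0
  have ha0' : 8 / 5 ≤ a0 := by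
    have : 0 ≤ κ * (2 * κ - 1) := mul_nonneg (by linarith) (by linarith)
    have : 0 ≤ κ * w := mul_nonneg (by linarith) hw
    rw [ha0]; linarith
  have h5 : a0 * (w + 16 / 15 + 10 / 3 * x) ≤ b ^ 2 := by
    refine le_trans (mul_le_mul hax hcx (by positivity) (by linarith)) hF3
  rw [hbx] at h5
  set b0 := 1 + 3 / 5 * w + 8 / 25 * κ
  have hb0' : b0 ≤ 48 / 25 := by
    simp only [b0]; linarith
  nlinarith [mul_nonneg hx0 (show 0 ≤ 10 / 3 * a0 - 2 * b0 - x by linarith)]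

lemma W3_le (h : BMSeq n W) (hn : 5 ≤ n) : W 3 ≤ 16 / 9 := by
  obtain ⟨q, rfl⟩ : ∃ q, n = q + 5 := ⟨n - 5, by omega⟩
  by_contra hcon
  push Not at hcon
  set p : ℝ := (q : ℝ) + 3 with hp
  have hp3 : 3 ≤ p := by rw [hp]; linarith [(Nat.cast_nonneg q : (0 : ℝ) ≤ q)]
  have hp0 : 0 < p := by linarith
  set t : ℝ := 3 / 5 / p with ht
  have htp : t * p = 3 / 5 := by rw [ht]; field_simp
  have ht0 : 0 < t := by positivity
  have ht5 : t ≤ 1 / 5 := by rw [ht, div_le_iff₀ hp0]; linarith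
  have hF2 := h.F2 t ht0.le
  have hF3 := h.F3 t ht0.le
  simp only [show q + 5 - 1 = q + 4 by omega, show q + 5 - 2 = q + 3 by omega] at hF2 hF3
  set a := ∑ j ∈ Finset.range (q + 4), ((q + 3).choose j : ℝ) * W j * t ^ j with hadef
  set b := ∑ j ∈ Finset.range (q + 4), ((q + 3).choose j : ℝ) * W (j + 1) * t ^ j with hbdef
  set c := ∑ j ∈ Finset.range (q + 4), ((q + 3).choose j : ℝ) * W (j + 2) * t ^ j with hcdef
  have pas : ∀ U : ℕ → ℝ, ∑ j ∈ Finset.range (q + 5), ((q + 4).choose j : ℝ) * U j * t ^ j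
      = ∑ j ∈ Finset.range (q + 4), ((q + 3).choose j : ℝ) * U j * t ^ j
       + t * ∑ j ∈ Finset.range (q + 4), ((q + 3).choose j : ℝ) * U (j + 1) * t ^ j := by
    intro U
    rw [Finset.sum_range_succ', Finset.mul_sum]
    have e : ∑ j ∈ Finset.range (q + 4), ((q + 3).choose j : ℝ) * U j * t ^ j
       = ∑ j ∈ Finset.range (q + 4), ((q + 3).choose (j + 1) : ℝ) * U (j + 1) * t ^ (j + 1) + U 0 := by
      have : ∑ j ∈ Finset.range (q + 5), ((q + 3).choose j : ℝ) * U j * t ^ j = ∑ j ∈ Finset.range (q + 4), ((q + 3).choose j : ℝ) * U j * t ^ j := by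
        rw [Finset.sum_range_succ, Nat.choose_eq_zero_of_lt (by omega)]; simp
      rw [← this, Finset.sum_range_succ']; simp
    rw [e]
    have : ∀ A B C D : ℝ, A = B + C → A + D = B + D + C := by intros; linarith
    simp only [Nat.choose_zero_right, Nat.cast_one, one_mul, pow_zero, mul_one]
    apply this
    rw [← Finset.sum_add_distrib]
    refine Finset.sum_congr rfl fun j _ => ?_
    rw [show q + 4 = (q + 3) + 1 by ring, Nat.choose_succ_succ]
    push_cast; rw [pow_succ]; ring
  rw [pas W, pas (fun j => W (j + 1))] at hF2
  -- expand
  have ch2 : ((q + 3).choose 2 : ℝ) = p * (p - 1) / 2 := by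
    rw [Nat.cast_choose_two]; push_cast; ring
  have ch3 : ((q + 3).choose 3 : ℝ) = p * (p - 1) * (p - 2) / 6 := by
    have h1 := Nat.add_one_mul_choose_eq (q + 2) 2
    have h2 : ((q + 2).choose 2 : ℝ) = (p - 1) * (p - 2) / 2 := by
      rw [Nat.cast_choose_two]; push_cast; rw [hp]; ring
    have h3 : ((q : ℝ) + 2 + 1) * (q + 2).choose 2 = (q + 3).choose 3 * 3 := by exact_mod_cast h1
    rw [h2] at h3
    rw [hp] at *
    linarith
  have hκ : 1 - 1 / p = (p - 1) / p := by field_simp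
  have spl : ∀ U : ℕ → ℝ, ∑ j ∈ Finset.range (q + 4), ((q + 3).choose j : ℝ) * U j * t ^ j
     = ∑ j ∈ Finset.range (q + 1), ((q + 3).choose (j + 3) : ℝ) * U (j + 3) * t ^ (j + 3)
       + (9 / 50 * (1 - 1 / p) * U 2 + 3 / 5 * U 1 + U 0) := by
    intro U
    rw [Finset.sum_range_succ', Finset.sum_range_succ', Finset.sum_range_succ']
    simp only [zero_add, Nat.choose_one_right, Nat.choose_zero_right, show (1 + 1 : ℕ) = 2 by rfl, ch2]
    have e1 : p * (p - 1) / 2 * t ^ 2 = 9 / 50 * (1 - 1 / p) := by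
      rw [ht]; field_simp; ring
    have e2 : ((q + 3 : ℕ) : ℝ) * t = 3 / 5 := by rw [← htp, hp]; push_cast; ring
    simp only [add_assoc, show (1 : ℕ) + (1 + 1) = 3 by rfl, show (1 + 1 : ℕ) = 2 by rfl]
    push_cast at e2 ⊢
    linear_combination U 2 * e1 + U 1 * e2
  have hy0 : 0 ≤ ∑ j ∈ Finset.range (q + 1), ((q + 3).choose (j + 3) : ℝ) * W (j + 3 + 1) * t ^ (j + 3) := by
    apply Finset.sum_nonneg
    intro j _
    have := h.nonneg (j + 3 + 1)
    positivity
  refine w3_abstract (1 - 1 / p) (W 2) t (W 3)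
    (∑ j ∈ Finset.range (q + 1), ((q + 3).choose (j + 3) : ℝ) * W (j + 3 + 1) * t ^ (j + 3)) a b c
    ?_ ?_ (h.nonneg 2) (h.W2_le (by omega)) ht5 ht0.le hcon hy0 ?_ ?_ ?_ hF2 hF3
  · rw [hκ, div_le_div_iff₀ (by norm_num) hp0]; linarith
  · have : 0 < 1 / p := by positivity
    linarith
  · rw [hadef, spl W, Finset.sum_range_succ']
    have e3 : p * (p - 1) * (p - 2) / 6 * t ^ 3 = 9 / 250 * ((1 - 1 / p) * (2 * (1 - 1 / p) - 1)) := by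
      rw [ht]; field_simp; ring
    have : 0 ≤ ∑ k ∈ Finset.range q, ((q + 3).choose (k + 1 + 3) : ℝ) * W (k + 1 + 3) * t ^ (k + 1 + 3) := by
      apply Finset.sum_nonneg
      intro j _
      have := h.nonneg (j + 1 + 3)
      positivity
    simp only [zero_add, ch3, h.zero, h.one]
    have e4 : p * (p - 1) * (p - 2) / 6 * W 3 * t ^ 3 = 9 / 250 * ((1 - 1 / p) * (2 * (1 - 1 / p) - 1)) * W 3 := by
      rw [← e3]; ring
    rw [e4]
    linarith
  · rw [hbdef, spl (fun j => W (j + 1))]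
    simp only [zero_add, h.one]
    norm_num; ring
  · have e : c = ∑ j ∈ Finset.range (q + 1 + 1), ((q + 3).choose (j + 2) : ℝ) * W (j + 2 + 2) * t ^ (j + 2)
        + (3 / 5 * W 3 + W 2) := by
      rw [hcdef, Finset.sum_range_succ', Finset.sum_range_succ']
      have e2 : ((q + 3 : ℕ) : ℝ) * t = 3 / 5 := by rw [← htp, hp]; push_cast; ring
      simp only [zero_add, Nat.choose_one_right, Nat.choose_zero_right, add_assoc, show (1 + 1 : ℕ) = 2 by rfl, show (1 + 2 : ℕ) = 3 by rfl]
      push_cast at e2 ⊢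
      linear_combination W 3 * e2
    rw [e, Finset.sum_range_succ _ (q + 1)]
    have hl : 0 ≤ ((q + 3).choose (q + 1 + 2) : ℝ) * W (q + 1 + 2 + 2) * t ^ (q + 1 + 2) := by
      have := h.nonneg (q + 1 + 2 + 2)
      positivity
    have hs : 10 / 3 * ∑ j ∈ Finset.range (q + 1), ((q + 3).choose (j + 3) : ℝ) * W (j + 3 + 1) * t ^ (j + 3)
        ≤ ∑ j ∈ Finset.range (q + 1), ((q + 3).choose (j + 2) : ℝ) * W (j + 2 + 2) * t ^ (j + 2) := by
      rw [Finset.mul_sum]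
      apply Finset.sum_le_sum
      intro j hj
      have hj' : j ≤ q := by simp at hj; omega
      have h1 := Nat.choose_succ_right_eq (q + 3) (j + 2)
      have h2 : ((q + 3).choose (j + 3) : ℝ) * (j + 3) = (q + 3).choose (j + 2) * ((q : ℝ) + 1 - j) := by
        have e5 : q + 3 - (j + 2) = q + 1 - j := by omega
        rw [e5] at h1
        have := congrArg (Nat.cast : ℕ → ℝ) h1
        push_cast [Nat.cast_sub (show j ≤ q + 1 by omega)] at this
        rw [← this]; ring
      have h3 : 10 / 3 * ((q + 3).choose (j + 3) : ℝ) * t ≤ (q + 3).choose (j + 2) := by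
        have hC : (0 : ℝ) ≤ (q + 3).choose (j + 2) := by positivity
        have hC3 : (0 : ℝ) ≤ (q + 3).choose (j + 3) := by positivity
        have h4 : ((q + 3).choose (j + 3) : ℝ) * 3 ≤ (q + 3).choose (j + 2) * p := by
          have : (0 : ℝ) ≤ j := by positivity
          calc _ ≤ ((q + 3).choose (j + 3) : ℝ) * (j + 3) := by
                apply mul_le_mul_of_nonneg_left _ hC3; linarith
            _ = _ := h2
            _ ≤ _ := by apply mul_le_mul_of_nonneg_left _ hC; rw [hp]; linarith
        have h5 := mul_le_mul_of_nonneg_right h4 ht0.le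
        rw [mul_assoc _ p t, mul_comm p t, htp] at h5
        linarith
      have hW := h.nonneg (j + 4)
      have : 0 ≤ W (j + 4) * t ^ (j + 2) := by positivity
      have h6 := mul_le_mul_of_nonneg_right h3 this
      rw [pow_succ t (j + 2)]
      calc _ = 10 / 3 * ((q + 3).choose (j + 3) : ℝ) * t * (W (j + 4) * t ^ (j + 2)) := by
            rw [show j + 3 + 1 = j + 4 by ring]; ring
        _ ≤ _ := h6
        _ = _ := by rw [show j + 2 + 2 = j + 4 by ring]; ring
    linarith

theorem numeric (h : BMSeq n W) (r k : ℕ) (hr : 2 ≤ r) (hrn : r ≤ n) (hk1 : 1 ≤ k) (hk : k ≤ r) :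
    gfun r * W r ≤ Bc n r k := by
  rcases Nat.lt_or_ge r 3 with h3 | h3
  · have : r = 2 := by omega
    subst this
    have h2 := h.W2_le hrn
    have hn : (2 : ℝ) ≤ n := by exact_mod_cast hrn
    have hg : gfun 2 = 2 := by norm_num [gfun, Nat.factorial]
    rw [hg]
    interval_cases k
    · norm_num [Bc]; linarith
    · norm_num [Bc]; linarith
  rcases Nat.eq_or_lt_of_le hrn with e | hlt
  · subst e
    have h1 := h.Wn_le
    have := gfun_le_Bc_self r k hk (by omega)
    have hg := gfun_pos r
    nlinarith
  rcases Nat.eq_or_lt_of_le (Nat.succ_le_of_lt hlt) with e | hlt2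
  · subst e
    exact h.final_r_succ r k h3 hk1 hk
  rcases Nat.lt_or_ge r 4 with h4 | h4
  · have : r = 3 := by omega
    subst this
    have hn5 : 5 ≤ n := by omega
    have h2 := h.W3_le hn5
    have hn : (5 : ℝ) ≤ n := by exact_mod_cast hn5
    have hg : gfun 3 = 9 / 2 := by norm_num [gfun, Nat.factorial]
    rw [hg]
    interval_cases k
    · norm_num [Bc, Nat.factorial]; nlinarith
    · norm_num [Bc]; linarith
    · norm_num [Bc]; linarith
  obtain ⟨m, rfl⟩ : ∃ m, n = m + r := ⟨n - r, by omega⟩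
  have h1 := h.main_F1 m r (by omega) rfl (by omega)
  have h2 : gfun (m + r) ≤ gfun m * Bc (m + r) r k := by
    rcases Nat.lt_or_ge k 4 with hk4 | hk4
    · exact E_le_Bc_small m r k (by omega) h4 hk1 (by omega)
    · exact E_le_Bc_large m r k (by omega) hk4 hk
  have hg := gfun_pos m
  refine le_of_mul_le_mul_left ?_ hg
  linarith
end BMSeq



section MixedDisc
variable {n : ℕ}

/-- determinant as multilinear function, row `i` taken from matrix number `i` -/
noncomputable def rowDet (n : ℕ) :
    MultilinearMap ℝ (fun _ : Fin n => Matrix (Fin n) (Fin n) ℝ) ℝ :=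
  (Matrix.detRowAlternating (n := Fin n) (R := ℝ)).toMultilinearMap.compLinearMap
    (fun i => (LinearMap.proj i : (Fin n → Fin n → ℝ) →ₗ[ℝ] (Fin n → ℝ)))

lemma rowDet_apply (M : Fin n → Matrix (Fin n) (Fin n) ℝ) :
    rowDet n M = Matrix.det (Matrix.of fun i j => M i i j) := rfl

/-- `n!` times the mixed discriminant -/
noncomputable def mdet (n : ℕ) : MultilinearMap ℝ (fun _ : Fin n => Matrix (Fin n) (Fin n) ℝ) ℝ :=
  ∑ σ : Equiv.Perm (Fin n), (rowDet n).domDomCongr σ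

lemma mdet_apply (M : Fin n → Matrix (Fin n) (Fin n) ℝ) :
    mdet n M = ∑ σ : Equiv.Perm (Fin n), rowDet n (fun i => M (σ i)) := by
  simp [mdet]

lemma mdet_perm (M : Fin n → Matrix (Fin n) (Fin n) ℝ) (τ : Equiv.Perm (Fin n)) :
    mdet n (fun i => M (τ i)) = mdet n M := by
  rw [mdet_apply, mdet_apply]
  exact Fintype.sum_equiv (Equiv.mulLeft τ) _ _ (fun σ => by simp)

lemma mdet_const (M : Matrix (Fin n) (Fin n) ℝ) :
    mdet n (fun _ => M) = n.factorial * M.det := by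
  rw [mdet_apply]
  simp [rowDet_apply, Fintype.card_perm]
  left
  rfl

lemma sum_sign_subset (f : Fin n → Fin n) :
    ∑ S : Finset (Fin n), (-1 : ℝ) ^ (n + S.card) * (if ∀ i, f i ∈ S then 1 else 0)
      = if Function.Surjective f then 1 else 0 := by
  split_ifs with hf
  · rw [Finset.sum_eq_single Finset.univ]
    · simp [← two_mul]
    · intro S _ hS
      rw [if_neg]; · simp
      intro h
      apply hS
      rw [Finset.eq_univ_iff_forall]
      intro x
      obtain ⟨i, rfl⟩ := hf x
      exact h i
    · simp
  · rw [Function.Surjective] at hf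
    push Not at hf
    obtain ⟨k, hk⟩ := hf
    refine Finset.sum_involution (fun S _ => symmDiff S {k}) ?_ ?_ ?_ ?_
    · intro S _
      have hiff : (∀ i, f i ∈ symmDiff S {k}) ↔ ∀ i, f i ∈ S := by
        refine forall_congr' fun i => ?_
        simp [Finset.mem_symmDiff, hk i]
      simp only [hiff]
      have hc : (-1 : ℝ) ^ (n + (symmDiff S {k}).card) = - (-1 : ℝ) ^ (n + S.card) := by
        by_cases hkS : k ∈ S
        · have e : symmDiff S {k} = S.erase k := by
            ext x; simp [Finset.mem_symmDiff]
            constructor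
            · rintro (h | h)
              · exact ⟨h.2, h.1⟩
              · exact absurd (h.1 ▸ hkS) h.2
            · intro h; exact Or.inl ⟨h.2, h.1⟩
          rw [e]
          have := Finset.card_erase_add_one hkS
          rw [← this, ← add_assoc, pow_succ]; ring
        · have e : symmDiff S {k} = insert k S := by
            ext x; simp [Finset.mem_symmDiff]
            constructor
            · rintro (h | h)
              · exact Or.inr h.1
              · exact Or.inl h.1
            · rintro (h | h)
              · exact Or.inr ⟨h, h ▸ hkS⟩
              · refine Or.inl ⟨h, ?_⟩
                rintro rfl; exact hkS h
          rw [e, Finset.card_insert_of_notMem hkS, ← add_assoc, pow_succ]; ring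
      rw [hc]; ring
    · intro S _ _ h
      have : k ∈ symmDiff S {k} ↔ k ∈ S := by rw [h]
      simp [Finset.mem_symmDiff] at this
    · simp
    · simp

/-- polarization -/
lemma polarization (M : Fin n → Matrix (Fin n) (Fin n) ℝ) :
    ∑ S : Finset (Fin n), (-1 : ℝ) ^ (n + S.card) * (∑ i ∈ S, M i).det = mdet n M := by
  have h1 : ∀ S : Finset (Fin n), (∑ i ∈ S, M i).det
      = ∑ f : Fin n → Fin n, (if ∀ i, f i ∈ S then 1 else 0) * rowDet n (fun i => M (f i)) := by
    intro S
    have : (∑ i ∈ S, M i).det = rowDet n (fun _ => ∑ i ∈ S, M i) := rfl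
    rw [this, MultilinearMap.map_sum_finset]
    simp only [ite_mul, one_mul, zero_mul]
    rw [← Finset.sum_filter]
    apply Finset.sum_congr
    · ext f; simp
    · intros; rfl
  simp only [h1, Finset.mul_sum]
  rw [Finset.sum_comm]
  have h2 : ∀ f : Fin n → Fin n, ∑ S : Finset (Fin n), (-1 : ℝ) ^ (n + S.card) *
      ((if ∀ i, f i ∈ S then 1 else 0) * rowDet n (fun i => M (f i)))
      = (if Function.Surjective f then 1 else 0) * rowDet n (fun i => M (f i)) := by
    intro f
    rw [← sum_sign_subset f, Finset.sum_mul]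
    refine Finset.sum_congr rfl fun S _ => ?_
    ring
  simp only [h2]
  simp only [ite_mul, one_mul, zero_mul]
  rw [← Finset.sum_filter, mdet_apply]
  symm
  refine Finset.sum_bij (fun σ _ => (σ : Fin n → Fin n)) ?_ ?_ ?_ ?_
  · intro σ _; simp [σ.surjective]
  · intro σ _ τ _ h; exact Equiv.coe_fn_injective h
  · intro f hf
    simp at hf
    exact ⟨Equiv.ofBijective f ⟨Finite.injective_iff_surjective.2 hf, hf⟩, Finset.mem_univ _, rfl⟩
  · intros; rfl

lemma mdet_rank_one (v : Fin n → Fin n → ℝ) :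
    mdet n (fun i => Matrix.vecMulVec (v i) (v i)) = (Matrix.of v).det ^ 2 := by
  rw [mdet_apply]
  have : ∀ σ : Equiv.Perm (Fin n), rowDet n (fun i => Matrix.vecMulVec (v (σ i)) (v (σ i)))
     = (∏ i, v (σ i) i) * (Equiv.Perm.sign σ * (Matrix.of v).det) := by
    intro σ
    rw [rowDet_apply, ← Matrix.det_permute, ← Matrix.det_mul_column]
    rfl
  simp only [this]
  have h2 : (Matrix.of v).det = ∑ σ : Equiv.Perm (Fin n), (∏ i, v (σ i) i) * (Equiv.Perm.sign σ : ℝ) := by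
    rw [Matrix.det_apply]
    refine Finset.sum_congr rfl fun σ _ => ?_
    simp only [Matrix.of_apply, Units.smul_def, zsmul_eq_mul]
    ring
  rw [pow_two]
  nth_rewrite 2 [h2]
  rw [Finset.sum_mul]
  refine Finset.sum_congr rfl fun σ _ => ?_
  ring

lemma psd_decomp (M : Matrix (Fin n) (Fin n) ℝ) (h : M.PosSemidef) :
    ∃ B : Fin n → Fin n → ℝ, M = ∑ k, Matrix.vecMulVec (B k) (B k) := by
  open MatrixOrder in
  obtain ⟨B, hB⟩ := CStarAlgebra.nonneg_iff_eq_star_mul_self.1 h.nonneg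
  refine ⟨B, ?_⟩
  rw [hB]
  ext i j
  simp [Matrix.mul_apply, Matrix.star_apply, Matrix.sum_apply, Matrix.vecMulVec_apply]

lemma mdet_nonneg (M : Fin n → Matrix (Fin n) (Fin n) ℝ) (h : ∀ i, (M i).PosSemidef) :
    0 ≤ mdet n M := by
  choose B hB using fun i => psd_decomp (M i) (h i)
  have : M = fun i => ∑ k, Matrix.vecMulVec (B i k) (B i k) := funext hB
  rw [this, MultilinearMap.map_sum]
  apply Finset.sum_nonneg
  intro e _
  rw [mdet_rank_one (fun i => B i (e i))]
  positivity

/-- `L` in the first `j` slots, `A` in the others -/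
noncomputable def slots {X : Type*} (n : ℕ) (j : ℕ) (L A : X) : Fin n → X :=
  fun i => if (i : ℕ) < j then L else A

lemma mdet_piecewise (L A : Matrix (Fin n) (Fin n) ℝ) (s : Finset (Fin n)) :
    mdet n (s.piecewise (fun _ => L) (fun _ => A)) = mdet n (slots n s.card L A) := by
  have hc : Fintype.card {x // x ∈ s} = Fintype.card {x : Fin n // (x : ℕ) < s.card} := by
    rw [Fintype.card_coe, Fintype.card_subtype]
    have hle : s.card ≤ n := by simpa using Finset.card_le_univ s
    rcases Nat.eq_or_lt_of_le hle with h | h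
    · rw [Finset.filter_true_of_mem]
      · simp [h]
      · intro x _; omega
    · have := Fin.card_Iio (⟨s.card, h⟩ : Fin n)
      rw [show (Finset.univ.filter fun x : Fin n => (x : ℕ) < s.card) = Finset.Iio ⟨s.card, h⟩ by
        ext x; simp [Fin.lt_def]]
      simpa using this.symm
  let e := (Fintype.equivOfCardEq hc)
  rw [← mdet_perm (slots n s.card L A) e.extendSubtype]
  congr 1
  ext1 i
  by_cases hi : i ∈ s
  · have := e.extendSubtype_mem i hi
    simp [slots, hi, this]
  · have := e.extendSubtype_not_mem i hi
    simp [slots, hi, this]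

lemma det_add_smul (L A : Matrix (Fin n) (Fin n) ℝ) (t : ℝ) :
    n.factorial * (A + t • L).det
      = ∑ j ∈ Finset.range (n + 1), (n.choose j : ℝ) * mdet n (slots n j L A) * t ^ j := by
  rw [← mdet_const]
  have : (fun _ : Fin n => A + t • L) = (fun _ => t • L) + (fun _ => A) := by
    ext1 i; simp [add_comm]
  rw [this, MultilinearMap.map_add_univ]
  have h2 : ∀ s : Finset (Fin n), mdet n (s.piecewise (fun _ => t • L) (fun _ => A))
     = (fun j => mdet n (slots n j L A) * t ^ j) s.card := by
    intro s
    have : s.piecewise (fun _ => t • L) (fun _ => A) =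
        fun i => (s.piecewise (fun _ => t) (fun _ => (1 : ℝ)) i) • (s.piecewise (fun _ => L) (fun _ => A) i) := by
      ext1 i
      by_cases hi : i ∈ s <;> simp [hi]
    rw [this, MultilinearMap.map_smul_univ, Finset.prod_piecewise]
    simp only [mdet_piecewise]
    simp [mul_comm]
  rw [Finset.sum_congr rfl (fun s _ => h2 s), ← Finset.powerset_univ,
    Finset.sum_powerset_apply_card (fun j => mdet n (slots n j L A) * t ^ j) (x := (Finset.univ : Finset (Fin n)))]
  simp [mul_assoc]

/-- the lower bound by multilinearity -/
lemma mdet_sum_ge (r : ℕ) (hr : 0 < r) (hrn : r ≤ n) (H : Fin r → Matrix (Fin n) (Fin n) ℝ)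
    (A : Matrix (Fin n) (Fin n) ℝ) (hH : ∀ i, (H i).PosSemidef) (hA : A.PosSemidef)
    (s : Fin r → ℝ) (hs : ∀ i, 0 ≤ s i) :
    r.factorial * (∏ i, s i) * mdet n (fun j => if h : (j : ℕ) < r then H ⟨j, h⟩ else A)
      ≤ mdet n (slots n r (∑ i, s i • H i) A) := by
  have : NeZero r := ⟨hr.ne'⟩
  set M : Fin n → Matrix (Fin n) (Fin n) ℝ := fun j => if h : (j : ℕ) < r then H ⟨j, h⟩ else A with hM
  let g : Fin n → Fin r → Matrix (Fin n) (Fin n) ℝ := fun j i =>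
    if (j : ℕ) < r then s i • H i else (if i = 0 then A else 0)
  have e1 : slots n r (∑ i, s i • H i) A = fun j => ∑ i, g j i := by
    ext1 j
    by_cases hj : (j : ℕ) < r <;> simp [slots, g, hj]
  rw [e1, MultilinearMap.map_sum]
  have hg : ∀ j i, (g j i).PosSemidef := by
    intro j i
    simp only [g]
    split_ifs
    · exact (hH i).smul (hs i)
    · exact hA
    · exact Matrix.PosSemidef.zero
  let E : Equiv.Perm (Fin r) → (Fin n → Fin r) := fun σ j => if h : (j : ℕ) < r then σ ⟨j, h⟩ else 0
  have hE : Function.Injective E := by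
    intro σ τ h
    ext1 i
    have := congrFun h ⟨i, by omega⟩
    simpa [E] using this
  have hterm : ∀ σ : Equiv.Perm (Fin r), mdet n (fun j => g j (E σ j)) = (∏ i, s i) * mdet n M := by
    intro σ
    let f : Fin r ≃ {j : Fin n // (j : ℕ) < r} :=
      { toFun := fun i => ⟨⟨i, by omega⟩, i.2⟩
        invFun := fun j => ⟨j.1, j.2⟩
        left_inv := fun i => rfl
        right_inv := fun j => rfl }
    let τ := σ.extendDomain f
    have : (fun j => g j (E σ j)) = fun j : Fin n => (if h : (j : ℕ) < r then s (σ ⟨j, h⟩) else 1) • M (τ j) := by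
      ext1 j
      by_cases hj : (j : ℕ) < r
      · have : τ j = f (σ ⟨j, hj⟩) := Equiv.Perm.extendDomain_apply_subtype σ f hj
        rw [this]
        simp [g, E, hj, M, f]
      · have : τ j = j := Equiv.Perm.extendDomain_apply_not_subtype σ f hj
        rw [this]
        simp [g, E, hj, M]
    rw [this, MultilinearMap.map_smul_univ, mdet_perm, smul_eq_mul]
    congr 1
    rw [← Equiv.prod_comp σ s]
    rw [← Fintype.prod_subtype_mul_prod_subtype (fun j : Fin n => (j : ℕ) < r)]
    have h2 : ∏ i : {x : Fin n // ¬ (x : ℕ) < r}, (if h : ((i : Fin n) : ℕ) < r then s (σ ⟨i, h⟩) else 1) = 1 := by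
      apply Finset.prod_eq_one
      intro i _
      rw [dif_neg i.2]
    rw [h2, mul_one]
    refine (Fintype.prod_equiv f _ _ ?_).symm
    intro i
    have : ((f i : Fin n) : ℕ) < r := i.2
    rw [dif_pos this]
    rfl
  calc _ = ∑ σ : Equiv.Perm (Fin r), mdet n (fun j => g j (E σ j)) := by
        simp only [hterm]
        simp [Fintype.card_perm]; ring
    _ = ∑ e ∈ Finset.univ.image E, mdet n (fun j => g j (e j)) := by
        rw [Finset.sum_image hE.injOn]
    _ ≤ _ := by
        apply Finset.sum_le_sum_of_subset_of_nonneg (Finset.subset_univ _)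
        intro e _ _
        exact mdet_nonneg _ (fun i => hg _ _)

end MixedDisc



section PL
open scoped ENNReal

lemma bm_compact_one (K L : Set ℝ) (hK : IsCompact K) (hL : IsCompact L) (hK0 : K.Nonempty)
    (hL0 : L.Nonempty) : volume K + volume L ≤ volume (K + L) := by
  obtain ⟨k, hk, hkm⟩ := hK.exists_isGreatest hK0
  obtain ⟨l, hl, hlm⟩ := hL.exists_isLeast hL0
  have h1 : (fun x => x + l) '' K ∪ (fun x => k + x) '' L ⊆ K + L := by
    rintro x (⟨y, hy, rfl⟩ | ⟨y, hy, rfl⟩)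
    · exact Set.add_mem_add hy hl
    · exact Set.add_mem_add hk hy
  have h2 : (fun x => x + l) '' K ∩ (fun x => k + x) '' L ⊆ {k + l} := by
    rintro x ⟨⟨y, hy, rfl⟩, ⟨z, hz, hzy⟩⟩
    have := hkm hy
    have := hlm hz
    simp only at hzy
    simp only [Set.mem_singleton_iff]
    linarith
  have m2 : MeasurableSet ((fun x => k + x) '' L) := (hL.image (by fun_prop)).measurableSet
  have h3 := measure_union_add_inter (μ := volume) ((fun x => x + l) '' K) m2
  have h4 : volume ((fun x => x + l) '' K ∩ (fun x => k + x) '' L) = 0 :=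
    measure_mono_null h2 (by simp)
  rw [h4, add_zero] at h3
  have e1 : volume ((fun x => x + l) '' K) = volume K := by
    simp
  have e2 : volume ((fun x => k + x) '' L) = volume L := by
    simp
  rw [e1, e2] at h3
  rw [← h3]
  exact measure_mono h1

lemma bm_meas_one (A B C : Set ℝ) (hA : MeasurableSet A) (hB : MeasurableSet B)
    (hA0 : A.Nonempty) (hB0 : B.Nonempty) (hC : A + B ⊆ C) : volume A + volume B ≤ volume C := by
  have h1 : ∀ K L : Set ℝ, K ⊆ A → L ⊆ B → IsCompact K → IsCompact L → volume K + volume L ≤ volume C := by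
    intro K L hKA hLB hK hL
    obtain ⟨a, ha⟩ := hA0
    obtain ⟨b, hb⟩ := hB0
    have := bm_compact_one (insert a K) (insert b L) (hK.insert a) (hL.insert b) ⟨a, by simp⟩ ⟨b, by simp⟩
    calc _ ≤ volume (insert a K) + volume (insert b L) := by
          gcongr <;> simp
      _ ≤ _ := this
      _ ≤ _ := by
          apply measure_mono
          refine subset_trans ?_ hC
          apply Set.add_subset_add
          · exact Set.insert_subset ha hKA
          · exact Set.insert_subset hb hLB
  by_cases hT : volume C = ⊤
  · rw [hT]; exact le_top
  have h2 : ∀ L : Set ℝ, L ⊆ B → IsCompact L → volume A + volume L ≤ volume C := by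
    intro L hLB hL
    have : volume A ≤ volume C - volume L := by
      rw [hA.measure_eq_iSup_isCompact volume]
      refine iSup_le fun K => iSup_le fun hKA => iSup_le fun hK => ?_
      exact ENNReal.le_sub_of_add_le_right hL.measure_ne_top (h1 K L hKA hLB hK hL)
    have hle : volume L ≤ volume C := by
      have := h1 ∅ L (by simp) hLB isCompact_empty hL
      simpa using this
    calc _ ≤ volume C - volume L + volume L := by gcongr
      _ = _ := tsub_add_cancel_of_le hle
  have hAle : volume A ≤ volume C := by
    have := h2 ∅ (by simp) isCompact_empty
    simpa using this
  have hAf : volume A ≠ ⊤ := ne_top_of_le_ne_top hT hAle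
  have : volume B ≤ volume C - volume A := by
    rw [hB.measure_eq_iSup_isCompact volume]
    refine iSup_le fun L => iSup_le fun hLB => iSup_le fun hL => ?_
    exact ENNReal.le_sub_of_add_le_left hAf (h2 L hLB hL)
  calc _ ≤ volume A + (volume C - volume A) := by gcongr
    _ = _ := add_tsub_cancel_of_le hAle

lemma bm_smul_one (a b : ℝ) (ha : 0 < a) (hb : 0 < b) (A B C : Set ℝ) (hA : MeasurableSet A) (hB : MeasurableSet B)
    (hA0 : A.Nonempty) (hB0 : B.Nonempty) (hC : ∀ x ∈ A, ∀ y ∈ B, a * x + b * y ∈ C) :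
    ENNReal.ofReal a * volume A + ENNReal.ofReal b * volume B ≤ volume C := by
  have := bm_meas_one (a • A) (b • B) C (hA.const_smul₀ a) (hB.const_smul₀ b) (hA0.smul_set) (hB0.smul_set) (by
    rintro _ ⟨_, ⟨x, hx, rfl⟩, _, ⟨y, hy, rfl⟩, rfl⟩
    exact hC x hx y hy)
  rw [Measure.addHaar_smul, Measure.addHaar_smul] at this
  simpa [abs_of_pos ha, abs_of_pos hb] using this

lemma layer (F : ℝ → ℝ≥0∞) (hF : Measurable F) (hF1 : ∀ x, F x ≤ 1) :
    ∫⁻ x, F x = ∫⁻ s in Set.Ioi (0 : ℝ), volume {x | ENNReal.ofReal s < F x} := by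
  have h1 : ∀ x, F x ≠ ⊤ := fun x => ne_top_of_le_ne_top ENNReal.one_ne_top (hF1 x)
  have := lintegral_eq_lintegral_meas_lt (f := fun x => (F x).toReal) volume
    (Filter.Eventually.of_forall fun x => ENNReal.toReal_nonneg) (hF.ennreal_toReal.aemeasurable)
  rw [show (fun x => F x) = fun x => ENNReal.ofReal (F x).toReal from funext fun x => (ENNReal.ofReal_toReal (h1 x)).symm]
  rw [this]
  refine setLIntegral_congr_fun measurableSet_Ioi fun s hs => ?_
  congr 1
  ext x
  simp only [Set.mem_setOf_eq]
  rw [ENNReal.ofReal_lt_iff_lt_toReal (le_of_lt hs) (h1 x)]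

lemma ennreal_amgm (a b : ℝ) (ha : 0 < a) (hb : 0 < b) (hab : a + b = 1) (x y : ℝ≥0∞) (hx : x ≠ ⊤) (hy : y ≠ ⊤) :
    x ^ a * y ^ b ≤ ENNReal.ofReal a * x + ENNReal.ofReal b * y := by
  lift x to NNReal using hx
  lift y to NNReal using hy
  have := NNReal.geom_mean_le_arith_mean2_weighted ⟨a, ha.le⟩ ⟨b, hb.le⟩ x y (NNReal.coe_injective hab)
  rw [← ENNReal.coe_rpow_of_nonneg _ ha.le, ← ENNReal.coe_rpow_of_nonneg _ hb.le]
  rw [ENNReal.ofReal_eq_coe_nnreal ha.le, ENNReal.ofReal_eq_coe_nnreal hb.le]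
  exact_mod_cast this

lemma pl_one (a b : ℝ) (ha : 0 < a) (hb : 0 < b) (hab : a + b = 1) (f g h : ℝ → ℝ≥0∞)
    (hf : Measurable f) (hg : Measurable g) (hh : Measurable h) (C : ℝ≥0∞) (hC : C ≠ ⊤)
    (hfC : ∀ x, f x ≤ C) (hgC : ∀ x, g x ≤ C) (hfi : ∫⁻ x, f x ≠ ⊤) (hgi : ∫⁻ x, g x ≠ ⊤)
    (H : ∀ x y, f x ^ a * g y ^ b ≤ h (a * x + b * y)) :
    (∫⁻ x, f x) ^ a * (∫⁻ x, g x) ^ b ≤ ∫⁻ x, h x := by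
  set S := ⨆ x, f x with hS
  set T := ⨆ x, g x with hT
  have hST : S ≠ ⊤ := ne_top_of_le_ne_top hC (iSup_le hfC)
  have hTT : T ≠ ⊤ := ne_top_of_le_ne_top hC (iSup_le hgC)
  by_cases hS0 : S = 0
  · have : ∀ x, f x = 0 := fun x => le_antisymm (by rw [← hS0]; exact le_iSup f x) bot_le
    simp [this, ha]
  by_cases hT0 : T = 0
  · have : ∀ x, g x = 0 := fun x => le_antisymm (by rw [← hT0]; exact le_iSup g x) bot_le
    simp [this, hb]
  set k := S ^ a * T ^ b with hk
  have hk0 : k ≠ 0 := by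
    rw [hk]
    refine mul_ne_zero ?_ ?_
    · simp [ENNReal.rpow_eq_zero_iff, hS0, hST]
    · simp [ENNReal.rpow_eq_zero_iff, hT0, hTT]
  have hkT : k ≠ ⊤ := ENNReal.mul_ne_top (ENNReal.rpow_ne_top_of_nonneg ha.le hST) (ENNReal.rpow_ne_top_of_nonneg hb.le hTT)
  set F := fun x => f x / S with hF
  set G := fun x => g x / T with hG
  set Hm := fun x => min (h x / k) 1 with hHm
  have hFm : Measurable F := hf.div_const _
  have hGm : Measurable G := hg.div_const _
  have hHmm : Measurable Hm := (hh.div_const _).min measurable_const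
  have hF1 : ∀ x, F x ≤ 1 := fun x => ENNReal.div_le_of_le_mul (by rw [one_mul]; exact le_iSup f x)
  have hG1 : ∀ x, G x ≤ 1 := fun x => ENNReal.div_le_of_le_mul (by rw [one_mul]; exact le_iSup g x)
  have hH1 : ∀ x, Hm x ≤ 1 := fun x => min_le_right _ _
  have hFG : ∀ x y, F x ^ a * G y ^ b ≤ h (a * x + b * y) / k := by
    intro x y
    rw [ENNReal.le_div_iff_mul_le (Or.inl hk0) (Or.inl hkT)]
    refine le_trans (le_of_eq ?_) (H x y)
    simp only [hF, hG, hk]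
    rw [ENNReal.div_rpow_of_nonneg _ _ ha.le, ENNReal.div_rpow_of_nonneg _ _ hb.le]
    have e1 : f x ^ a / S ^ a * S ^ a = f x ^ a :=
      ENNReal.div_mul_cancel (by simp [ENNReal.rpow_eq_zero_iff, hS0, hST]) (ENNReal.rpow_ne_top_of_nonneg ha.le hST)
    have e2 : g y ^ b / T ^ b * T ^ b = g y ^ b :=
      ENNReal.div_mul_cancel (by simp [ENNReal.rpow_eq_zero_iff, hT0, hTT]) (ENNReal.rpow_ne_top_of_nonneg hb.le hTT)
    calc _ = (f x ^ a / S ^ a * S ^ a) * (g y ^ b / T ^ b * T ^ b) := by ring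
      _ = _ := by rw [e1, e2]
  have lev : ∀ s : ℝ, 0 < s → ENNReal.ofReal a * volume {x | ENNReal.ofReal s < F x}
      + ENNReal.ofReal b * volume {x | ENNReal.ofReal s < G x} ≤ volume {x | ENNReal.ofReal s < Hm x} := by
    intro s hs
    rcases lt_or_ge s 1 with hs1 | hs1
    · have hs1' : ENNReal.ofReal s < 1 := by rw [← ENNReal.ofReal_one]; exact (ENNReal.ofReal_lt_ofReal_iff one_pos).2 hs1
      apply bm_smul_one a b ha hb
      · exact measurableSet_lt measurable_const hFm
      · exact measurableSet_lt measurable_const hGm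
      · have : ENNReal.ofReal s * S < S := by
          conv_rhs => rw [← one_mul S]
          exact ENNReal.mul_lt_mul_left hS0 hST hs1'
        obtain ⟨x, hx⟩ := lt_iSup_iff.1 this
        refine ⟨x, ?_⟩
        simp only [Set.mem_setOf_eq, hF]
        rwa [ENNReal.lt_div_iff_mul_lt (Or.inl hS0) (Or.inl hST)]
      · have : ENNReal.ofReal s * T < T := by
          conv_rhs => rw [← one_mul T]
          exact ENNReal.mul_lt_mul_left hT0 hTT hs1'
        obtain ⟨x, hx⟩ := lt_iSup_iff.1 this
        refine ⟨x, ?_⟩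
        simp only [Set.mem_setOf_eq, hG]
        rwa [ENNReal.lt_div_iff_mul_lt (Or.inl hT0) (Or.inl hTT)]
      · intro x hx y hy
        simp only [Set.mem_setOf_eq] at hx hy ⊢
        refine lt_min (lt_of_lt_of_le ?_ (hFG x y)) hs1'
        have e : ENNReal.ofReal s = ENNReal.ofReal s ^ a * ENNReal.ofReal s ^ b := by
          rw [← ENNReal.rpow_add _ _ (by simpa using hs) (by simp), hab, ENNReal.rpow_one]
        rw [e]
        exact ENNReal.mul_lt_mul (ENNReal.rpow_lt_rpow hx ha) (ENNReal.rpow_lt_rpow hy hb)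
    · have hs1' : 1 ≤ ENNReal.ofReal s := by rw [← ENNReal.ofReal_one]; exact ENNReal.ofReal_le_ofReal hs1
      have e1 : {x | ENNReal.ofReal s < F x} = ∅ := by
        ext x; simp; exact (hF1 x).trans hs1'
      have e2 : {x | ENNReal.ofReal s < G x} = ∅ := by
        ext x; simp; exact (hG1 x).trans hs1'
      simp [e1, e2]
  have key : (ENNReal.ofReal a * ∫⁻ x, F x) + (ENNReal.ofReal b * ∫⁻ x, G x) ≤ ∫⁻ x, Hm x := by
    rw [layer F hFm hF1, layer G hGm hG1, layer Hm hHmm hH1]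
    rw [← lintegral_const_mul' _ _ ENNReal.ofReal_ne_top, ← lintegral_const_mul' _ _ ENNReal.ofReal_ne_top]
    have anti : Antitone fun s : ℝ => volume {x | ENNReal.ofReal s < F x} := by
      intro s t hst
      apply measure_mono
      intro x hx
      exact lt_of_le_of_lt (ENNReal.ofReal_le_ofReal hst) hx
    rw [← lintegral_add_left (anti.measurable.const_mul _)]
    exact setLIntegral_mono' measurableSet_Ioi (fun s hs => lev s hs)
  have iF : ∫⁻ x, F x = (∫⁻ x, f x) / S := by
    simp only [hF, div_eq_mul_inv]
    rw [lintegral_mul_const' _ _ (by simp [hS0])]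
  have iG : ∫⁻ x, G x = (∫⁻ x, g x) / T := by
    simp only [hG, div_eq_mul_inv]
    rw [lintegral_mul_const' _ _ (by simp [hT0])]
  have iH : ∫⁻ x, Hm x ≤ (∫⁻ x, h x) / k := by
    calc _ ≤ ∫⁻ x, h x / k := lintegral_mono fun x => min_le_left _ _
      _ = _ := by
        simp only [div_eq_mul_inv]
        rw [lintegral_mul_const' _ _ (by simp [hk0])]
  have am := ennreal_amgm a b ha hb hab (∫⁻ x, F x) (∫⁻ x, G x)
    (by rw [iF]; exact ENNReal.div_ne_top hfi hS0) (by rw [iG]; exact ENNReal.div_ne_top hgi hT0)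
  have fin := am.trans (key.trans iH)
  rw [iF, iG, ENNReal.le_div_iff_mul_le (Or.inl hk0) (Or.inl hkT)] at fin
  refine le_trans (le_of_eq ?_) fin
  rw [ENNReal.div_rpow_of_nonneg _ _ ha.le, ENNReal.div_rpow_of_nonneg _ _ hb.le, hk]
  have e1 : (∫⁻ x, f x) ^ a / S ^ a * S ^ a = (∫⁻ x, f x) ^ a :=
    ENNReal.div_mul_cancel (by simp [ENNReal.rpow_eq_zero_iff, hS0, hST]) (ENNReal.rpow_ne_top_of_nonneg ha.le hST)
  have e2 : (∫⁻ x, g x) ^ b / T ^ b * T ^ b = (∫⁻ x, g x) ^ b :=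
    ENNReal.div_mul_cancel (by simp [ENNReal.rpow_eq_zero_iff, hT0, hTT]) (ENNReal.rpow_ne_top_of_nonneg hb.le hTT)
  calc _ = ((∫⁻ x, f x) ^ a / S ^ a * S ^ a) * ((∫⁻ x, g x) ^ b / T ^ b * T ^ b) := by rw [e1, e2]
    _ = _ := by ring

/-- Prékopa–Leindler for bounded functions with bounded support -/
lemma pl_pi (a b : ℝ) (ha : 0 < a) (hb : 0 < b) (hab : a + b = 1) (n : ℕ) :
    ∀ (f g h : (Fin n → ℝ) → ℝ≥0∞)
    (_ : Measurable f) (_ : Measurable g) (_ : Measurable h) (C : ℝ≥0∞) (_ : C ≠ ⊤) (R : ℝ)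
    (_ : ∀ x, f x ≤ C) (_ : ∀ x, g x ≤ C) (_ : ∀ x, f x ≠ 0 → ∀ i, |x i| ≤ R)
    (_ : ∀ x, g x ≠ 0 → ∀ i, |x i| ≤ R)
    (_ : ∀ x y, f x ^ a * g y ^ b ≤ h (a • x + b • y)),
    (∫⁻ x, f x) ^ a * (∫⁻ x, g x) ^ b ≤ ∫⁻ x, h x := by
  induction n with
  | zero =>
    intro f g h hf hg hh C hC R hfC hgC hfR hgR H
    rw [Measure.volume_pi_eq_dirac (fun i => isEmptyElim i)]
    rw [lintegral_dirac, lintegral_dirac, lintegral_dirac]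
    refine (H _ _).trans (le_of_eq ?_)
    congr 1
    exact Subsingleton.elim _ _
  | succ n ih =>
    intro f g h hf hg hh C hC R hfC hgC hfR hgR H
    let e := MeasurableEquiv.piFinSuccAbove (fun _ : Fin (n + 1) => ℝ) 0
    have he : MeasurePreserving e.symm volume volume :=
      (volume_preserving_piFinSuccAbove (fun _ : Fin (n + 1) => ℝ) 0).symm
    have hes : ∀ p, e.symm p = Fin.cons p.1 p.2 := by
      intro p
      ext i
      refine Fin.cases ?_ (fun j => ?_) i <;> simp [e, MeasurableEquiv.piFinSuccAbove]
    have fub : ∀ φ : (Fin (n + 1) → ℝ) → ℝ≥0∞, Measurable φ →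
        ∫⁻ x, φ x = ∫⁻ x : ℝ, ∫⁻ y : Fin n → ℝ, φ (e.symm (x, y)) := by
      intro φ hφ
      rw [← he.lintegral_comp hφ, Measure.volume_eq_prod]
      exact lintegral_prod (fun p => φ (e.symm p)) (hφ.comp e.symm.measurable).aemeasurable
    have meas : ∀ φ : (Fin (n + 1) → ℝ) → ℝ≥0∞, Measurable φ →
        Measurable fun x : ℝ => ∫⁻ y : Fin n → ℝ, φ (e.symm (x, y)) := by
      intro φ hφ
      exact (hφ.comp e.symm.measurable).lintegral_prod_right'
    have meas2 : ∀ φ : (Fin (n + 1) → ℝ) → ℝ≥0∞, Measurable φ → ∀ x : ℝ,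
        Measurable fun y : Fin n → ℝ => φ (e.symm (x, y)) := by
      intro φ hφ x
      exact (hφ.comp e.symm.measurable).comp measurable_prodMk_left
    set V : ℝ≥0∞ := volume (Set.pi Set.univ fun _ : Fin n => Set.Icc (-R) R) with hV
    have hVT : V ≠ ⊤ := (isCompact_univ_pi fun _ => isCompact_Icc).measure_ne_top
    have bd : ∀ φ : (Fin (n + 1) → ℝ) → ℝ≥0∞, (∀ x, φ x ≤ C) → (∀ x, φ x ≠ 0 → ∀ i, |x i| ≤ R) →
        ∀ x : ℝ, ∫⁻ y : Fin n → ℝ, φ (e.symm (x, y)) ≤ (Set.Icc (-R) R).indicator (fun _ => C * V) x := by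
      intro φ h1 h2 x
      by_cases hx : x ∈ Set.Icc (-R) R
      · rw [Set.indicator_of_mem hx]
        calc _ ≤ ∫⁻ y : Fin n → ℝ, (Set.pi Set.univ fun _ : Fin n => Set.Icc (-R) R).indicator (fun _ => C) y := by
              apply lintegral_mono
              intro y
              by_cases h0 : φ (e.symm (x, y)) = 0
              · simp [h0]
              · rw [Set.indicator_of_mem]
                · exact h1 _
                · intro i _
                  have := h2 _ h0 i.succ
                  rw [hes] at this
                  simpa [abs_le] using this
          _ = _ := by
              rw [lintegral_indicator_const]
              exact MeasurableSet.univ_pi fun _ => measurableSet_Icc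
      · rw [Set.indicator_of_notMem hx]
        apply le_of_eq
        rw [show (fun y : Fin n → ℝ => φ (e.symm (x, y))) = fun _ => 0 by
          ext y
          by_contra h0
          have := h2 _ h0 0
          rw [hes] at this
          apply hx
          simpa [abs_le] using this]
        simp
    have bd2 : ∀ φ : (Fin (n + 1) → ℝ) → ℝ≥0∞, (∀ x, φ x ≤ C) → (∀ x, φ x ≠ 0 → ∀ i, |x i| ≤ R) →
        ∫⁻ x : ℝ, ∫⁻ y : Fin n → ℝ, φ (e.symm (x, y)) ≠ ⊤ := by
      intro φ h1 h2
      refine ne_top_of_le_ne_top ?_ (lintegral_mono (bd φ h1 h2))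
      rw [lintegral_indicator_const measurableSet_Icc]
      exact ENNReal.mul_ne_top (ENNReal.mul_ne_top hC hVT) isCompact_Icc.measure_ne_top
    have bd3 : ∀ x, (Set.Icc (-R) R).indicator (fun _ => C * V) x ≤ C * V := fun x =>
      Set.indicator_le_self _ _ x
    rw [fub f hf, fub g hg, fub h hh]
    refine pl_one a b ha hb hab _ _ _ (meas f hf) (meas g hg) (meas h hh) (C * V) (ENNReal.mul_ne_top hC hVT)
      (fun x => (bd f hfC hfR x).trans (bd3 x)) (fun x => (bd g hgC hgR x).trans (bd3 x))
      (bd2 f hfC hfR) (bd2 g hgC hgR) ?_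
    intro x x'
    refine ih _ _ _ (meas2 f hf x) (meas2 g hg x') (meas2 h hh _) C hC R (fun y => hfC _) (fun y => hgC _) ?_ ?_ ?_
    · intro y hy i
      have := hfR _ hy i.succ
      rw [hes] at this
      simpa using this
    · intro y hy i
      have := hgR _ hy i.succ
      rw [hes] at this
      simpa using this
    · intro y y'
      refine (H _ _).trans (le_of_eq ?_)
      congr 1
      rw [hes, hes, hes]
      ext i
      refine Fin.cases ?_ (fun j => ?_) i <;> simp

end PL



section BM
open scoped ENNReal

lemma bm_pi {n : ℕ} (a b : ℝ) (ha : 0 < a) (hb : 0 < b) (hab : a + b = 1) (K L : Set (Fin n → ℝ))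
    (hK : IsCompact K) (hL : IsCompact L) :
    (volume K) ^ a * (volume L) ^ b ≤ volume (a • K + b • L) := by
  have hM : IsCompact (a • K + b • L) := (hK.smul a).add (hL.smul b)
  obtain ⟨R1, hR1⟩ := hK.isBounded.subset_closedBall 0
  obtain ⟨R2, hR2⟩ := hL.isBounded.subset_closedBall 0
  have := pl_pi a b ha hb hab n (K.indicator 1) (L.indicator 1) ((a • K + b • L).indicator 1)
    (measurable_one.indicator hK.measurableSet) (measurable_one.indicator hL.measurableSet)
    (measurable_one.indicator hM.measurableSet) 1 ENNReal.one_ne_top (max R1 R2)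
    (fun x => Set.indicator_le_self _ _ x) (fun x => Set.indicator_le_self _ _ x)
    (by
      intro x hx i
      have hxK : x ∈ K := by by_contra h; simp [h] at hx
      have := hR1 hxK
      rw [mem_closedBall_zero_iff] at this
      exact ((norm_le_pi_norm x i).trans this).trans (le_max_left _ _))
    (by
      intro x hx i
      have hxK : x ∈ L := by by_contra h; simp [h] at hx
      have := hR2 hxK
      rw [mem_closedBall_zero_iff] at this
      exact ((norm_le_pi_norm x i).trans this).trans (le_max_right _ _))
    (by
      intro x y
      by_cases hx : x ∈ K
      · by_cases hy : y ∈ L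
        · have : a • x + b • y ∈ a • K + b • L :=
            Set.add_mem_add (Set.smul_mem_smul_set hx) (Set.smul_mem_smul_set hy)
          simp [hx, hy, this]
        · simp [hy, hb]
      · simp [hx, ha])
  rwa [lintegral_indicator_one hK.measurableSet, lintegral_indicator_one hL.measurableSet,
    lintegral_indicator_one hM.measurableSet] at this

lemma bm_eucl {n : ℕ} (a b : ℝ) (ha : 0 < a) (hb : 0 < b) (hab : a + b = 1) (K L : Set (EuclideanSpace ℝ (Fin n)))
    (hK : IsCompact K) (hL : IsCompact L) :
    (volume K) ^ a * (volume L) ^ b ≤ volume (a • K + b • L) := by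
  let e := (PiLp.continuousLinearEquiv 2 ℝ (fun _ : Fin n => ℝ))
  have he : MeasurePreserving e volume volume := PiLp.volume_preserving_ofLp (Fin n)
  have key : ∀ S : Set (EuclideanSpace ℝ (Fin n)), volume (e '' S) = volume S := by
    intro S
    have := he.measure_preimage_emb e.toHomeomorph.measurableEmbedding (e '' S)
    rw [← this, Set.preimage_image_eq _ e.injective]
  have := bm_pi a b ha hb hab (e '' K) (e '' L) (hK.image e.continuous) (hL.image e.continuous)
  rw [key, key] at this
  rw [← key (a • K + b • L), Set.image_add, ]
  rwa [image_smul_set, image_smul_set]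

lemma bm_root {n : ℕ} (hn : 0 < n) (K L : Set (EuclideanSpace ℝ (Fin n)))
    (hK : IsCompact K) (hL : IsCompact L) (hK0 : 0 < (volume K).toReal) (hL0 : 0 < (volume L).toReal) :
    (volume K).toReal ^ (1 / n : ℝ) + (volume L).toReal ^ (1 / n : ℝ) ≤ (volume (K + L)).toReal ^ (1 / n : ℝ) := by
  set u := (volume K).toReal ^ (1 / n : ℝ) with hu
  set v := (volume L).toReal ^ (1 / n : ℝ) with hv
  have hu0 : 0 < u := Real.rpow_pos_of_pos hK0 _
  have hv0 : 0 < v := Real.rpow_pos_of_pos hL0 _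
  have hun : u ^ n = (volume K).toReal := by
    rw [hu, one_div, Real.rpow_inv_natCast_pow ENNReal.toReal_nonneg hn.ne']
  have hvn : v ^ n = (volume L).toReal := by
    rw [hv, one_div, Real.rpow_inv_natCast_pow ENNReal.toReal_nonneg hn.ne']
  have h := bm_eucl (u / (u + v)) (v / (u + v)) (by positivity) (by positivity) (by field_simp)
    (u⁻¹ • K) (v⁻¹ • L) (hK.smul _) (hL.smul _)
  have e1 : ∀ (w : ℝ) (S : Set (EuclideanSpace ℝ (Fin n))), 0 < w →  (volume S).toReal = w ^ n → IsCompact S →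
      volume (w⁻¹ • S) = 1 := by
    intro w S hw hS hSc
    rw [Measure.addHaar_smul, finrank_euclideanSpace_fin, ← ENNReal.ofReal_toReal hSc.measure_ne_top, hS,
      ← ENNReal.ofReal_mul (abs_nonneg _), abs_of_pos (by positivity), inv_pow, inv_mul_cancel₀ (by positivity), ENNReal.ofReal_one]
  rw [e1 u K hu0 hun.symm hK, e1 v L hv0 hvn.symm hL, smul_smul, smul_smul] at h
  have e2 : u / (u + v) * u⁻¹ = (u + v)⁻¹ := by field_simp
  have e3 : v / (u + v) * v⁻¹ = (u + v)⁻¹ := by field_simp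
  rw [e2, e3, ← smul_add, Measure.addHaar_smul, finrank_euclideanSpace_fin, 
    ← ENNReal.ofReal_toReal (hK.add hL).measure_ne_top, ← ENNReal.ofReal_mul (abs_nonneg _),
    ENNReal.one_rpow, ENNReal.one_rpow, one_mul, ENNReal.one_le_ofReal, abs_of_pos (by positivity), inv_pow] at h
  rw [← div_eq_inv_mul, le_div_iff₀ (by positivity), one_mul] at h
  rw [one_div]
  calc u + v = ((u + v) ^ n) ^ ((n : ℝ)⁻¹) := (Real.pow_rpow_inv_natCast (by positivity) hn.ne').symm
    _ ≤ _ := Real.rpow_le_rpow (by positivity) h (by positivity)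

lemma bm_concave {n : ℕ} (hn : 0 < n) (A L : Set (EuclideanSpace ℝ (Fin n)))
    (hA : IsCompact A) (hL : IsCompact L) (hAc : Convex ℝ A) (hLc : Convex ℝ L)
    (hA0 : 0 < (volume A).toReal) (hLn : L.Nonempty) :
    ConcaveOn ℝ (Set.Ici 0) fun t : ℝ => (volume (A + t • L)).toReal ^ (1 / n : ℝ) := by
  obtain ⟨l, hl⟩ := hLn
  have hpos : ∀ t : ℝ, 0 < (volume (A + t • L)).toReal := by
    intro t
    refine lt_of_lt_of_le hA0 (ENNReal.toReal_mono (hA.add (hL.smul t)).measure_ne_top ?_)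
    calc volume A = volume (A + {t • l}) := by simp
      _ ≤ _ := by
        apply measure_mono
        apply Set.add_subset_add_left
        simpa using Set.smul_mem_smul_set hl
  refine ⟨convex_Ici 0, ?_⟩
  intro s hs t ht a b ha hb hab
  rcases ha.eq_or_lt with rfl | ha
  · simp at hab; simp [hab]
  rcases hb.eq_or_lt with rfl | hb
  · simp at hab; simp [hab]
  have sc : ∀ (w : ℝ) (S : Set (EuclideanSpace ℝ (Fin n))), 0 < w → 
      (volume (w • S)).toReal ^ (1 / n : ℝ) = w * (volume S).toReal ^ (1 / n : ℝ) := by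
    intro w S hw
    rw [Measure.addHaar_smul, finrank_euclideanSpace_fin, ENNReal.toReal_mul, ENNReal.toReal_ofReal (abs_nonneg _),
      abs_of_pos (by positivity), Real.mul_rpow (by positivity) ENNReal.toReal_nonneg, one_div,
      Real.pow_rpow_inv_natCast hw.le hn.ne']
  have := bm_root hn (a • (A + s • L)) (b • (A + t • L)) ((hA.add (hL.smul s)).smul a) ((hA.add (hL.smul t)).smul b)
    (by
      rw [Measure.addHaar_smul, ENNReal.toReal_mul]
      refine mul_pos ?_ (hpos s)
      rw [ENNReal.toReal_ofReal (abs_nonneg _)]; positivity)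
    (by
      rw [Measure.addHaar_smul, ENNReal.toReal_mul]
      refine mul_pos ?_ (hpos t)
      rw [ENNReal.toReal_ofReal (abs_nonneg _)]; positivity)
  rw [sc a _ ha, sc b _ hb] at this
  refine this.trans (le_of_eq ?_)
  congr 3
  have hs' : (0:ℝ) ≤ s := hs
  have ht' : (0:ℝ) ≤ t := ht
  have e1 : a • A + b • A = A := by
    rw [← hAc.add_smul ha.le hb.le, hab, one_smul]
  have e2 : (a * s) • L + (b * t) • L = (a * s + b * t) • L := by
    rw [← hLc.add_smul (by positivity) (by positivity)]
  rw [smul_add, smul_add, smul_smul, smul_smul]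
  calc _ = (a • A + b • A) + ((a * s) • L + (b * t) • L) := by abel
    _ = _ := by rw [e1, e2]; rfl

end BM



section G1
open scoped RealInnerProductSpace ContDiff

/-- `φ` is a smooth convex potential with gradient image essentially `K`. -/
structure SuppPot {n : ℕ} (K : Set (EuclideanSpace ℝ (Fin n))) (φ : EuclideanSpace ℝ (Fin n) → ℝ) : Prop where
  smooth : ContDiff ℝ 2 φ
  conv : ConvexOn ℝ Set.univ φ
  up : ∀ x v, ∃ y ∈ K, φ (x + v) - φ x ≤ ⟪v, y⟫
  low : ∃ C : ℝ, ∀ x, ∀ y ∈ K, ⟪x, y⟫ ≤ φ x + C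

lemma SuppPot.zero {n : ℕ} : SuppPot (n := n) 0 (fun _ => 0) where
  smooth := contDiff_const
  conv := convexOn_const _ convex_univ
  up := fun x v => ⟨0, by simp, by simp⟩
  low := ⟨0, by simp⟩

lemma SuppPot.add {n : ℕ} {K L : Set (EuclideanSpace ℝ (Fin n))} {φ ψ : EuclideanSpace ℝ (Fin n) → ℝ}
    (h1 : SuppPot K φ) (h2 : SuppPot L ψ) : SuppPot (K + L) (fun x => φ x + ψ x) where
  smooth := h1.smooth.add h2.smooth
  conv := h1.conv.add h2.conv
  up := by
    intro x v
    obtain ⟨y, hy, h⟩ := h1.up x v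
    obtain ⟨z, hz, h'⟩ := h2.up x v
    refine ⟨y + z, Set.add_mem_add hy hz, ?_⟩
    rw [inner_add_right]
    linarith
  low := by
    obtain ⟨C, hC⟩ := h1.low
    obtain ⟨D, hD⟩ := h2.low
    refine ⟨C + D, ?_⟩
    rintro x _ ⟨y, hy, z, hz, rfl⟩
    have := hC x y hy
    have := hD x z hz
    simp only [inner_add_right]
    linarith

lemma SuppPot.smul {n : ℕ} {K : Set (EuclideanSpace ℝ (Fin n))} {φ : EuclideanSpace ℝ (Fin n) → ℝ}
    (h1 : SuppPot K φ) (t : ℝ) (ht : 0 ≤ t) : SuppPot (t • K) (fun x => t * φ x) where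
  smooth := contDiff_const.mul h1.smooth
  conv := h1.conv.smul ht
  up := by
    intro x v
    obtain ⟨y, hy, h⟩ := h1.up x v
    refine ⟨t • y, Set.smul_mem_smul_set hy, ?_⟩
    rw [inner_smul_right, ← mul_sub]
    gcongr
  low := by
    obtain ⟨C, hC⟩ := h1.low
    refine ⟨t * C, ?_⟩
    rintro x _ ⟨y, hy, rfl⟩
    have := hC x y hy
    simp only [inner_smul_right]
    rw [← mul_add]
    gcongr

lemma SuppPot.sum {n : ℕ} {ι : Type*} (S : Finset ι) (K : ι → Set (EuclideanSpace ℝ (Fin n)))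
    (φ : ι → EuclideanSpace ℝ (Fin n) → ℝ) (h : ∀ i ∈ S, SuppPot (K i) (φ i)) :
    SuppPot (∑ i ∈ S, K i) (fun x => ∑ i ∈ S, φ i x) := by
  classical
  induction S using Finset.induction_on with
  | empty => simpa using SuppPot.zero
  | insert a S ha ih =>
    have h2 := ih (fun i hi => h i (Finset.mem_insert_of_mem hi))
    have h1 := h a (Finset.mem_insert_self _ _)
    rw [Finset.sum_insert ha]
    simp only [Finset.sum_insert ha]
    exact h1.add h2

/-- support function -/
noncomputable def suppFun {n : ℕ} (K : Set (EuclideanSpace ℝ (Fin n))) (x : EuclideanSpace ℝ (Fin n)) : ℝ :=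
  sSup ((fun y => ⟪x, y⟫) '' K)

lemma suppFun_ge {n : ℕ} {K : Set (EuclideanSpace ℝ (Fin n))} (hK : IsCompact K) (x y) (hy : y ∈ K) :
    ⟪x, y⟫ ≤ suppFun K x :=
  le_csSup (hK.image (by fun_prop : Continuous fun y => ⟪x, y⟫)).bddAbove ⟨y, hy, rfl⟩

lemma suppFun_att {n : ℕ} {K : Set (EuclideanSpace ℝ (Fin n))} (hK : IsCompact K) (hK0 : K.Nonempty) (x) :
    ∃ y ∈ K, suppFun K x = ⟪x, y⟫ := by
  obtain ⟨y, hy, h⟩ := (hK.image (by fun_prop : Continuous fun y => ⟪x, y⟫)).sSup_mem (hK0.image _)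
  exact ⟨y, hy, h.symm⟩

lemma suppFun_sub {n : ℕ} {K : Set (EuclideanSpace ℝ (Fin n))} (hK : IsCompact K) (hK0 : K.Nonempty) (x v) :
    suppFun K (x + v) ≤ suppFun K x + suppFun K v := by
  obtain ⟨y, hy, h⟩ := suppFun_att hK hK0 (x + v)
  rw [h, inner_add_left]
  exact add_le_add (suppFun_ge hK x y hy) (suppFun_ge hK v y hy)

lemma suppFun_smul {n : ℕ} {K : Set (EuclideanSpace ℝ (Fin n))} (hK : IsCompact K) (hK0 : K.Nonempty) (x) (t : ℝ)
    (ht : 0 ≤ t) : suppFun K (t • x) ≤ t * suppFun K x := by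
  obtain ⟨y, hy, h⟩ := suppFun_att hK hK0 (t • x)
  rw [h, inner_smul_left]
  exact mul_le_mul_of_nonneg_left (suppFun_ge hK x y hy) ht

lemma suppFun_convex {n : ℕ} {K : Set (EuclideanSpace ℝ (Fin n))} (hK : IsCompact K) (hK0 : K.Nonempty) :
    ConvexOn ℝ Set.univ (suppFun K) := by
  refine ⟨convex_univ, ?_⟩
  intro x _ y _ a b ha hb _
  exact (suppFun_sub hK hK0 _ _).trans (add_le_add (suppFun_smul hK hK0 x a ha) (suppFun_smul hK hK0 y b hb))

lemma suppFun_cont {n : ℕ} {K : Set (EuclideanSpace ℝ (Fin n))} (hK : IsCompact K) (hK0 : K.Nonempty) :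
    Continuous (suppFun K) := by
  have := (suppFun_convex hK hK0).continuousOn isOpen_univ
  exact continuousOn_univ.1 this

lemma exists_suppPot {n : ℕ} (K : Set (EuclideanSpace ℝ (Fin n))) (hK : IsCompact K) (hK0 : K.Nonempty) :
    ∃ φ, SuppPot K φ := by
  let b : ContDiffBump (0 : EuclideanSpace ℝ (Fin n)) := ⟨1, 2, one_pos, one_lt_two⟩
  set ρ := b.normed volume with hρ
  have hρ0 : ∀ x, 0 ≤ ρ x := b.nonneg_normed
  have hρ1 : ∫ x, ρ x = 1 := b.integral_normed
  have hρc : HasCompactSupport ρ := b.hasCompactSupport_normed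
  have hρs : ContDiff ℝ 2 ρ := b.contDiff_normed
  have hρcont : Continuous ρ := hρs.continuous
  have hh := suppFun_cont hK hK0
  have int : ∀ g : EuclideanSpace ℝ (Fin n) → ℝ, Continuous g → Integrable fun y => ρ y * g y := by
    intro g hg
    exact (hρcont.mul hg).integrable_of_hasCompactSupport hρc.mul_right
  let φ : EuclideanSpace ℝ (Fin n) → ℝ := fun x => ∫ y, ρ y * suppFun K (x - y)
  have hφ : φ = MeasureTheory.convolution ρ (suppFun K) (ContinuousLinearMap.mul ℝ ℝ) volume := by
    ext x; rfl
  have hc : ∀ x, Continuous fun y => suppFun K (x - y) := fun x => hh.comp (by fun_prop)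
  refine ⟨φ, ?_, ?_, ?_, ?_⟩
  · rw [hφ]
    exact hρc.contDiff_convolution_left _ hρs hh.locallyIntegrable
  · refine ⟨convex_univ, ?_⟩
    intro x _ z _ s t hs ht hst
    simp only [φ, smul_eq_mul]
    rw [← integral_const_mul, ← integral_const_mul, ← integral_add ((int _ (hc x)).const_mul _) ((int _ (hc z)).const_mul _)]
    apply integral_mono (int _ (hc _)) (((int _ (hc x)).const_mul _).add ((int _ (hc z)).const_mul _))
    intro y
    have e : s • x + t • z - y = s • (x - y) + t • (z - y) := by
      rw [smul_sub, smul_sub]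
      nth_rewrite 1 [← one_smul ℝ y]
      rw [← hst, add_smul]; abel
    have := (suppFun_convex hK hK0).2 (Set.mem_univ (x - y)) (Set.mem_univ (z - y)) hs ht hst
    simp only [smul_eq_mul] at this
    simp only [e, Pi.add_apply]
    nlinarith [mul_le_mul_of_nonneg_left this (hρ0 y)]
  · intro x v
    obtain ⟨y, hy, h⟩ := suppFun_att hK hK0 v
    refine ⟨y, hy, ?_⟩
    rw [← h]
    simp only [φ]
    rw [← integral_sub (int _ (hc _)) (int _ (hc _))]
    calc _ ≤ ∫ y, ρ y * suppFun K v := by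
          apply integral_mono ((int _ (hc _)).sub (int _ (hc _))) (int _ continuous_const)
          intro z
          have := suppFun_sub hK hK0 (x - z) v
          simp only [Pi.sub_apply]
          rw [← mul_sub]
          apply mul_le_mul_of_nonneg_left _ (hρ0 z)
          rw [show x + v - z = x - z + v by abel]
          linarith
      _ = _ := by rw [integral_mul_const, hρ1, one_mul]
  · obtain ⟨M, hM⟩ := hK.isBounded.exists_norm_le
    refine ⟨∫ y, ρ y * (‖y‖ * M), ?_⟩
    intro x z hz
    simp only [φ]
    rw [← integral_add (int _ (hc _)) (int _ (by fun_prop))]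
    calc ⟪x, z⟫ = ∫ y, ρ y * ⟪x, z⟫ := by rw [integral_mul_const, hρ1, one_mul]
      _ ≤ _ := by
          apply integral_mono (int _ continuous_const) ((int _ (hc _)).add (int _ (by fun_prop)))
          intro y
          simp only [Pi.add_apply]
          rw [← mul_add]
          apply mul_le_mul_of_nonneg_left _ (hρ0 y)
          have h1 := suppFun_ge hK (x - y) z hz
          rw [inner_sub_left] at h1
          have h2 : ⟪y, z⟫ ≤ ‖y‖ * M := (real_inner_le_norm _ _).trans (by gcongr; exact hM z hz)
          linarith

end G1



section G2
open scoped RealInnerProductSpace ContDiff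

/-- Hessian matrix -/
noncomputable def Hm {n : ℕ} (φ : EuclideanSpace ℝ (Fin n) → ℝ) (x : EuclideanSpace ℝ (Fin n)) :
    Matrix (Fin n) (Fin n) ℝ :=
  Matrix.of fun i j => fderiv ℝ (fderiv ℝ φ) x (EuclideanSpace.basisFun (Fin n) ℝ j) (EuclideanSpace.basisFun (Fin n) ℝ i)

variable {n : ℕ} {K : Set (EuclideanSpace ℝ (Fin n))} {φ : EuclideanSpace ℝ (Fin n) → ℝ}

lemma SuppPot.fderiv_diff (h : SuppPot K φ) : Differentiable ℝ (fderiv ℝ φ) :=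
  (h.smooth.fderiv_right (m := 1) (by norm_num)).differentiable (by norm_num)

lemma SuppPot.diff (h : SuppPot K φ) : Differentiable ℝ φ := h.smooth.differentiable (by norm_num)

lemma SuppPot.hasFDerivAt_gradient (h : SuppPot K φ) (x) : HasFDerivAt (gradient φ) (fderiv ℝ (gradient φ) x) x := by
  have : Differentiable ℝ (gradient φ) :=
    ((InnerProductSpace.toDual ℝ (EuclideanSpace ℝ (Fin n))).symm.toContinuousLinearEquiv.differentiable).comp h.fderiv_diff
  exact (this x).hasFDerivAt

lemma SuppPot.fderiv_gradient (h : SuppPot K φ) (x u v) :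
    ⟪fderiv ℝ (gradient φ) x u, v⟫ = fderiv ℝ (fderiv ℝ φ) x u v := by
  have h1 : HasFDerivAt (fun y => ⟪gradient φ y, v⟫) ((innerSL ℝ v).comp (fderiv ℝ (gradient φ) x)) x := by
    have := (innerSL ℝ v).hasFDerivAt.comp x (h.hasFDerivAt_gradient x)
    refine this.congr_of_eventuallyEq (Filter.Eventually.of_forall fun y => ?_)
    simp [real_inner_comm]
  have h2 : HasFDerivAt (fun y => ⟪gradient φ y, v⟫) ((fderiv ℝ (fderiv ℝ φ) x).flip v) x := by
    simp only [inner_gradient_left]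
    have := ((h.fderiv_diff x).hasFDerivAt).clm_apply (hasFDerivAt_const v x)
    have e : (fderiv ℝ φ x).comp (0 : EuclideanSpace ℝ (Fin n) →L[ℝ] EuclideanSpace ℝ (Fin n))
        + (fderiv ℝ (fderiv ℝ φ) x).flip v = (fderiv ℝ (fderiv ℝ φ) x).flip v := by
      ext u; simp
    rw [← e]
    exact this
  have := congrArg (fun L => L u) (h1.unique h2)
  simp only [ContinuousLinearMap.comp_apply, innerSL_apply_apply, ContinuousLinearMap.flip_apply] at this
  rw [← this, real_inner_comm]

lemma SuppPot.hasDerivAt_line (h : SuppPot K φ) (x v : EuclideanSpace ℝ (Fin n)) (s : ℝ) :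
    HasDerivAt (fun s : ℝ => φ (x + s • v)) ⟪gradient φ (x + s • v), v⟫ s := by
  rw [inner_gradient_left]
  have h1 : HasDerivAt (fun s : ℝ => x + s • v) v s := by
    simpa using ((hasDerivAt_id s).smul_const v).const_add x
  exact ((h.diff _).hasFDerivAt).comp_hasDerivAt s h1

lemma SuppPot.grad_le (h : SuppPot K φ) (x v) : φ x + ⟪gradient φ x, v⟫ ≤ φ (x + v) := by
  have hc : ConvexOn ℝ Set.univ (fun s : ℝ => φ (x + s • v)) := by
    refine ⟨convex_univ, ?_⟩
    intro s _ t _ a b ha hb hab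
    have := h.conv.2 (Set.mem_univ (x + s • v)) (Set.mem_univ (x + t • v)) ha hb hab
    refine le_trans (le_of_eq ?_) this
    simp only
    congr 1
    nth_rewrite 1 [← one_smul ℝ x]
    rw [← hab, add_smul, add_smul, smul_add, smul_add, smul_smul, smul_smul, smul_eq_mul, smul_eq_mul]
    abel
  have := hc.le_slope_of_hasDerivAt (Set.mem_univ 0) (Set.mem_univ 1) one_pos (h.hasDerivAt_line x v 0)
  simp [slope] at this
  rw [inner_gradient_left]
  linarith

lemma SuppPot.grad_mono (h : SuppPot K φ) (x y) : 0 ≤ ⟪gradient φ y - gradient φ x, y - x⟫ := by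
  have h1 := h.grad_le x (y - x)
  have h2 := h.grad_le y (x - y)
  rw [add_sub_cancel] at h1 h2
  rw [inner_sub_left]
  rw [← neg_sub y x, inner_neg_right] at h2
  linarith

lemma SuppPot.hasDerivAt_grad (h : SuppPot K φ) (x v : EuclideanSpace ℝ (Fin n)) :
    HasDerivAt (fun s : ℝ => ⟪gradient φ (x + s • v), v⟫) (fderiv ℝ (fderiv ℝ φ) x v v) 0 := by
  rw [← h.fderiv_gradient]
  have h1 : HasDerivAt (fun s : ℝ => x + s • v) v 0 := by
    simpa using ((hasDerivAt_id (0:ℝ)).smul_const v).const_add x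
  have h2 : HasFDerivAt (gradient φ) (fderiv ℝ (gradient φ) x) (x + (0:ℝ) • v) := by
    simpa using h.hasFDerivAt_gradient x
  have h3 := h2.comp_hasDerivAt 0 h1
  have h4 := h3.inner ℝ (hasDerivAt_const (0:ℝ) v)
  simpa using h4

lemma SuppPot.hess_nonneg (h : SuppPot K φ) (x v) : 0 ≤ fderiv ℝ (fderiv ℝ φ) x v v := by
  have hm : Monotone (fun s : ℝ => ⟪gradient φ (x + s • v), v⟫) := by
    intro s t hst
    rcases hst.eq_or_lt with rfl | hst
    · exact le_rfl
    have := h.grad_mono (x + s • v) (x + t • v)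
    rw [show x + t • v - (x + s • v) = (t - s) • v by rw [sub_smul]; abel, inner_smul_right] at this
    have h2 : 0 ≤ ⟪gradient φ (x + t • v) - gradient φ (x + s • v), v⟫ := by
      by_contra hneg
      push Not at hneg
      have := mul_neg_of_pos_of_neg (sub_pos.2 hst) hneg
      linarith
    rw [inner_sub_left] at h2
    simp only
    linarith
  have := (h.hasDerivAt_grad x v).deriv
  rw [← this]
  exact hm.deriv_nonneg

lemma Hm_quad (φ : EuclideanSpace ℝ (Fin n) → ℝ) (x) (v : EuclideanSpace ℝ (Fin n)) :
    dotProduct v (Matrix.mulVec (Hm φ x) v) = fderiv ℝ (fderiv ℝ φ) x v v := by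
  have hv : v = ∑ i, v i • EuclideanSpace.basisFun (Fin n) ℝ i := by
    ext j
    simp [Finset.sum_apply, Pi.single_apply, EuclideanSpace.single_apply]
  conv_rhs => rw [hv]
  simp only [map_sum, map_smul, ContinuousLinearMap.sum_apply, ContinuousLinearMap.smul_apply, dotProduct, Matrix.mulVec, Hm,
    Matrix.of_apply, smul_eq_mul, Finset.mul_sum]
  refine Finset.sum_congr rfl fun i _ => Finset.sum_congr rfl fun j _ => ?_
  ring

lemma SuppPot.posSemidef (h : SuppPot K φ) (x) : (Hm φ x).PosSemidef := by
  rw [Matrix.posSemidef_iff_dotProduct_mulVec]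
  constructor
  · ext i j
    simp only [Hm, Matrix.conjTranspose_apply, Matrix.of_apply, star_trivial]
    have hs : IsSymmSndFDerivAt ℝ φ x := (h.smooth.contDiffAt).isSymmSndFDerivAt (by simp)
    exact hs _ _
  · intro v
    have := Hm_quad φ x (WithLp.toLp 2 v)
    have h2 := h.hess_nonneg x (WithLp.toLp 2 v)
    rw [← this] at h2
    simpa using h2

lemma SuppPot.det_eq (h : SuppPot K φ) (x) : (fderiv ℝ (gradient φ) x).det = (Hm φ x).det := by
  rw [ContinuousLinearMap.det, ← LinearMap.det_toMatrix (EuclideanSpace.basisFun (Fin n) ℝ).toBasis]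
  congr 1
  ext i j
  rw [LinearMap.toMatrix_apply]
  simp only [Hm, Matrix.of_apply]
  rw [← h.fderiv_gradient]
  simp [EuclideanSpace.inner_single_right]

lemma SuppPot.injOn (h : SuppPot K φ) : Set.InjOn (gradient φ) {x | (Hm φ x).det ≠ 0} := by
  intro x hx y hy hxy
  by_contra hne
  set d := y - x with hd
  have hd0 : d ≠ 0 := sub_ne_zero.2 (Ne.symm hne)
  have hcon : ∀ s ∈ Set.Icc (0:ℝ) 1, ⟪gradient φ (x + s • d), d⟫ = ⟪gradient φ x, d⟫ := by
    intro s hs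
    rcases hs.1.eq_or_lt with rfl | h0
    · simp
    rcases hs.2.eq_or_lt with rfl | h1
    · simp [hd, hxy]
    have m1 := h.grad_mono x (x + s • d)
    have m2 := h.grad_mono (x + s • d) y
    rw [add_sub_cancel_left, inner_smul_right, inner_sub_left] at m1
    rw [show y - (x + s • d) = (1 - s) • d by rw [sub_smul, one_smul, hd]; abel, inner_smul_right, inner_sub_left, ← hxy] at m2
    have a1 := nonneg_of_mul_nonneg_right m1 h0
    have a2 := nonneg_of_mul_nonneg_right m2 (by linarith : 0 < 1 - s)
    linarith
  have hz : fderiv ℝ (fderiv ℝ φ) x d d = 0 := by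
    have h1 := (h.hasDerivAt_grad x d).hasDerivWithinAt (s := Set.Icc 0 1)
    have h2 : HasDerivWithinAt (fun s : ℝ => ⟪gradient φ (x + s • d), d⟫) 0 (Set.Icc 0 1) 0 :=
      (hasDerivWithinAt_const (0:ℝ) (Set.Icc (0:ℝ) 1) ⟪gradient φ x, d⟫).congr hcon (hcon 0 (by simp))
    exact (uniqueDiffOn_Icc one_pos 0 (by simp)).eq_deriv _ h1 h2
  rw [← Hm_quad] at hz
  have := ((h.posSemidef x).dotProduct_mulVec_zero_iff d.ofLp).1 (by simpa using hz)
  apply hx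
  rw [← Matrix.exists_mulVec_eq_zero_iff]
  refine ⟨d.ofLp, ?_, this⟩
  simpa using hd0

lemma SuppPot.grad_mem (h : SuppPot K φ) (hK : IsCompact K) (hKc : Convex ℝ K) (x) : gradient φ x ∈ K := by
  by_contra hx
  obtain ⟨f, u, h1, h2⟩ := geometric_hahn_banach_closed_point hKc hK.isClosed hx
  set v := (InnerProductSpace.toDual ℝ _).symm f with hv
  have hf : ∀ y, f y = ⟪v, y⟫ := fun y => by rw [hv, InnerProductSpace.toDual_symm_apply]
  obtain ⟨y, hy, hu⟩ := h.up x v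
  have := h.grad_le x v
  have a := h1 y hy
  rw [hf] at a h2
  rw [real_inner_comm] at this
  linarith

lemma SuppPot.interior_sub (h : SuppPot K φ) : interior K ⊆ gradient φ '' Set.univ := by
  intro y hy
  obtain ⟨ε, hε, hball⟩ := Metric.nhds_basis_closedBall.mem_iff.1 (mem_interior_iff_mem_nhds.1 hy)
  obtain ⟨C, hC⟩ := h.low
  have low : ∀ x, ε * ‖x‖ - C ≤ φ x - ⟪x, y⟫ := by
    intro x
    rcases eq_or_ne x 0 with rfl | hx
    · have := hC 0 y (interior_subset hy)
      simp at this ⊢; linarith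
    have hx' : ‖x‖ ≠ 0 := norm_ne_zero_iff.2 hx
    have := hC x (y + (ε / ‖x‖) • x) (hball (by
      rw [mem_closedBall_iff_norm, add_sub_cancel_left, norm_smul, Real.norm_of_nonneg (by positivity)]
      field_simp; exact le_rfl))
    rw [inner_add_right, inner_smul_right, real_inner_self_eq_norm_sq] at this
    have e : ε / ‖x‖ * ‖x‖ ^ 2 = ε * ‖x‖ := by field_simp
    linarith
  have hcont : Continuous fun x => φ x - ⟪x, y⟫ := h.diff.continuous.sub (by fun_prop)
  have htend : Filter.Tendsto (fun x => φ x - ⟪x, y⟫) (Filter.cocompact _) Filter.atTop := by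
    refine Filter.tendsto_atTop_mono low ?_
    apply Filter.tendsto_atTop_add_const_right
    exact (tendsto_norm_cocompact_atTop).const_mul_atTop hε
  obtain ⟨x, hx⟩ := hcont.exists_forall_le htend
  refine ⟨x, Set.mem_univ _, ?_⟩
  have hmin : IsLocalMin (fun x => φ x - ⟪x, y⟫) x := Filter.Eventually.of_forall hx
  have hd : HasFDerivAt (fun x => φ x - ⟪x, y⟫) (fderiv ℝ φ x - innerSL ℝ y) x := by
    refine (h.diff x).hasFDerivAt.sub ?_
    refine ((innerSL ℝ y).hasFDerivAt).congr_of_eventuallyEq (Filter.Eventually.of_forall fun z => ?_)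
    simp [real_inner_comm]
  have h0 := hmin.hasFDerivAt_eq_zero hd
  apply ext_inner_right ℝ
  intro v
  rw [inner_gradient_left]
  have := congrArg (fun L => L v) h0
  simp at this
  linarith

lemma SuppPot.hm_cont (h : SuppPot K φ) : Continuous (Hm φ) := by
  have : Continuous (fderiv ℝ (fderiv ℝ φ)) :=
    (h.smooth.fderiv_right (m := 1) (by norm_num)).continuous_fderiv (by norm_num)
  apply continuous_matrix
  intro i j
  simp only [Hm, Matrix.of_apply]
  fun_prop

lemma SuppPot.lintegral (h : SuppPot K φ) (hK : IsCompact K) (hKc : Convex ℝ K) :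
    ∫⁻ x, ENNReal.ofReal (Hm φ x).det = volume K := by
  have hdc : Continuous fun x => (Hm φ x).det := h.hm_cont.matrix_det
  have hN : MeasurableSet {x | (Hm φ x).det ≠ 0} := (isOpen_ne_fun hdc continuous_const).measurableSet
  have e1 := lintegral_abs_det_fderiv_eq_addHaar_image volume hN
    (fun x _ => (h.hasFDerivAt_gradient x).hasFDerivWithinAt) h.injOn
  have e2 : volume (gradient φ '' {x | (Hm φ x).det ≠ 0}ᶜ) = 0 := by
    apply addHaar_image_eq_zero_of_det_fderivWithin_eq_zero volume
      (fun x _ => (h.hasFDerivAt_gradient x).hasFDerivWithinAt)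
    intro x hx
    rw [h.det_eq]
    simpa using hx
  have e3 : volume K = volume (gradient φ '' {x | (Hm φ x).det ≠ 0}) := by
    apply le_antisymm
    · calc volume K ≤ volume (interior K ∪ frontier K) := by
            apply measure_mono
            rw [← closure_eq_interior_union_frontier]; exact subset_closure
        _ ≤ volume (interior K) + volume (frontier K) := measure_union_le _ _
        _ = volume (interior K) := by rw [hKc.addHaar_frontier volume, add_zero]
        _ ≤ volume (gradient φ '' {x | (Hm φ x).det ≠ 0} ∪ gradient φ '' {x | (Hm φ x).det ≠ 0}ᶜ) := by
            apply measure_mono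
            rw [← Set.image_union, Set.union_compl_self]
            exact h.interior_sub
        _ ≤ _ := measure_union_le _ _
        _ = _ := by rw [e2, add_zero]
    · apply measure_mono
      rintro _ ⟨x, _, rfl⟩
      exact h.grad_mem hK hKc x
  rw [e3, ← e1, ← lintegral_indicator hN]
  congr 1
  ext x
  simp only [h.det_eq]
  by_cases hx : (Hm φ x).det = 0
  · rw [hx, Set.indicator_of_notMem (by simpa using hx)]; simp
  · rw [Set.indicator_of_mem (by simpa using hx), abs_of_nonneg (h.posSemidef x).det_nonneg]

lemma SuppPot.integrable (h : SuppPot K φ) (hK : IsCompact K) (hKc : Convex ℝ K) :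
    Integrable fun x => (Hm φ x).det := by
  have hdc : Continuous fun x => (Hm φ x).det := h.hm_cont.matrix_det
  refine ⟨hdc.aestronglyMeasurable, ?_⟩
  rw [hasFiniteIntegral_iff_ofReal (Filter.Eventually.of_forall fun x => (h.posSemidef x).det_nonneg), h.lintegral hK hKc]
  exact hK.measure_lt_top

lemma SuppPot.integral (h : SuppPot K φ) (hK : IsCompact K) (hKc : Convex ℝ K) :
    ∫ x, (Hm φ x).det = (volume K).toReal := by
  have hdc : Continuous fun x => (Hm φ x).det := h.hm_cont.matrix_det
  rw [integral_eq_lintegral_of_nonneg_ae (Filter.Eventually.of_forall fun x => (h.posSemidef x).det_nonneg)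
    hdc.aestronglyMeasurable, h.lintegral hK hKc]

end G2



section G3
variable {n : ℕ}

lemma Hm_sum {ι : Type*} (S : Finset ι) (K : ι → Set (EuclideanSpace ℝ (Fin n)))
    (φ : ι → EuclideanSpace ℝ (Fin n) → ℝ) (h : ∀ i ∈ S, SuppPot (K i) (φ i)) (x) :
    Hm (fun x => ∑ i ∈ S, φ i x) x = ∑ i ∈ S, Hm (φ i) x := by
  have h1 : fderiv ℝ (fun x => ∑ i ∈ S, φ i x) = fun x => ∑ i ∈ S, fderiv ℝ (φ i) x := by
    ext1 y
    exact fderiv_fun_sum fun i hi => (h i hi).diff y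
  have h2 : fderiv ℝ (fun x => ∑ i ∈ S, fderiv ℝ (φ i) x) x = ∑ i ∈ S, fderiv ℝ (fderiv ℝ (φ i)) x :=
    fderiv_fun_sum fun i hi => (h i hi).fderiv_diff x
  ext i j
  rw [Matrix.sum_apply]
  simp only [Hm, Matrix.of_apply, h1, h2, ContinuousLinearMap.sum_apply]

lemma Hm_add {K L : Set (EuclideanSpace ℝ (Fin n))} {φ ψ : EuclideanSpace ℝ (Fin n) → ℝ} (h : SuppPot K φ)
    (h' : SuppPot L ψ) (x) :
    Hm (fun x => φ x + ψ x) x = Hm φ x + Hm ψ x := by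
  have h1 : fderiv ℝ (fun x => φ x + ψ x) = fun x => fderiv ℝ φ x + fderiv ℝ ψ x := by
    ext1 y
    exact fderiv_fun_add (h.diff y) (h'.diff y)
  have h2 : fderiv ℝ (fun x => fderiv ℝ φ x + fderiv ℝ ψ x) x = fderiv ℝ (fderiv ℝ φ) x + fderiv ℝ (fderiv ℝ ψ) x :=
    fderiv_fun_add (h.fderiv_diff x) (h'.fderiv_diff x)
  ext i j
  simp only [Hm, Matrix.of_apply, Matrix.add_apply, h1, h2, ContinuousLinearMap.add_apply]

lemma Hm_smul {K : Set (EuclideanSpace ℝ (Fin n))} {φ : EuclideanSpace ℝ (Fin n) → ℝ} (h : SuppPot K φ)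
    (t : ℝ) (x) :
    Hm (fun x => t * φ x) x = t • Hm φ x := by
  have h1 : fderiv ℝ (fun x => t * φ x) = fun x => t • fderiv ℝ φ x := by
    ext1 y
    exact fderiv_const_mul (h.diff y) t
  have h2 : fderiv ℝ (fun x => t • fderiv ℝ φ x) x = t • fderiv ℝ (fderiv ℝ φ) x :=
    fderiv_fun_const_smul (h.fderiv_diff x) t
  ext i j
  simp only [Hm, Matrix.of_apply, Matrix.smul_apply, h1, h2, ContinuousLinearMap.smul_apply]

lemma compact_sum {ι : Type*} (S : Finset ι) (K : ι → Set (EuclideanSpace ℝ (Fin n))) (h : ∀ i ∈ S, IsCompact (K i)) :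
    IsCompact (∑ i ∈ S, K i) := by
  classical
  induction S using Finset.induction_on with
  | empty => simp
  | insert a S ha ih =>
    rw [Finset.sum_insert ha]
    exact (h a (Finset.mem_insert_self _ _)).add (ih (fun i hi => h i (Finset.mem_insert_of_mem hi)))

lemma convex_sum' {ι : Type*} (S : Finset ι) (K : ι → Set (EuclideanSpace ℝ (Fin n))) (h : ∀ i ∈ S, Convex ℝ (K i)) :
    Convex ℝ (∑ i ∈ S, K i) := by
  classical
  induction S using Finset.induction_on with
  | empty => rw [Finset.sum_empty]; exact convex_singleton (𝕜 := ℝ) (0 : EuclideanSpace ℝ (Fin n))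
  | insert a S ha ih =>
    rw [Finset.sum_insert ha]
    exact (h a (Finset.mem_insert_self _ _)).add (ih (fun i hi => h i (Finset.mem_insert_of_mem hi)))

/-- compact convex set with a potential -/
structure CPot (K : Set (EuclideanSpace ℝ (Fin n))) (φ : EuclideanSpace ℝ (Fin n) → ℝ) : Prop where
  pot : SuppPot K φ
  cpt : IsCompact K
  cvx : Convex ℝ K

lemma mv_aux (K : Fin n → Set (EuclideanSpace ℝ (Fin n))) (φ : Fin n → EuclideanSpace ℝ (Fin n) → ℝ)
    (h : ∀ i, CPot (K i) (φ i)) :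
    Integrable (fun x => mdet n fun i => Hm (φ i) x) ∧
      mixedVolume K = (n.factorial : ℝ)⁻¹ * ∫ x, mdet n fun i => Hm (φ i) x := by
  have hS : ∀ S : Finset (Fin n), SuppPot (∑ i ∈ S, K i) (fun x => ∑ i ∈ S, φ i x) := fun S =>
    SuppPot.sum S K φ fun i _ => (h i).pot
  have hc := fun S : Finset (Fin n) => compact_sum S K fun i _ => (h i).cpt
  have hv := fun S : Finset (Fin n) => convex_sum' S K fun i _ => (h i).cvx
  have hi : ∀ S : Finset (Fin n), Integrable fun x => (-1 : ℝ) ^ (n + S.card) * (∑ i ∈ S, Hm (φ i) x).det := by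
    intro S
    have := (hS S).integrable (hc S) (hv S)
    simp only [Hm_sum S K φ fun i _ => (h i).pot] at this
    exact this.const_mul _
  have e : ∀ x, mdet n (fun i => Hm (φ i) x) = ∑ S : Finset (Fin n), (-1 : ℝ) ^ (n + S.card) * (∑ i ∈ S, Hm (φ i) x).det :=
    fun x => (polarization _).symm
  simp only [e]
  refine ⟨integrable_finsetSum _ fun S _ => hi S, ?_⟩
  rw [integral_finsetSum _ fun S _ => hi S, mixedVolume]
  congr 1
  refine Finset.sum_congr rfl fun S _ => ?_
  rw [integral_const_mul, ← (hS S).integral (hc S) (hv S)]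
  simp only [Hm_sum S K φ fun i _ => (h i).pot]

lemma mv_nonneg (K : Fin n → Set (EuclideanSpace ℝ (Fin n))) (φ : Fin n → EuclideanSpace ℝ (Fin n) → ℝ)
    (h : ∀ i, CPot (K i) (φ i)) : 0 ≤ mixedVolume K := by
  rw [(mv_aux K φ h).2]
  have : 0 ≤ ∫ x, mdet n fun i => Hm (φ i) x := integral_nonneg fun x => mdet_nonneg _ fun i => (h i).pot.posSemidef x
  positivity

lemma slots_cpot {L A : Set (EuclideanSpace ℝ (Fin n))} {φ ψ : EuclideanSpace ℝ (Fin n) → ℝ} (hL : CPot L φ) (hA : CPot A ψ) (j : ℕ) :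
    ∀ i, CPot (slots n j L A i) (slots n j φ ψ i) := by
  intro i
  simp only [slots]
  split_ifs <;> assumption

lemma slots_Hm (φ ψ : EuclideanSpace ℝ (Fin n) → ℝ) (j : ℕ) (x) :
    (fun i => Hm (slots n j φ ψ i) x) = slots n j (Hm φ x) (Hm ψ x) := by
  ext1 i
  simp only [slots]
  split_ifs <;> rfl

lemma mv_slots {L A : Set (EuclideanSpace ℝ (Fin n))} {φ ψ : EuclideanSpace ℝ (Fin n) → ℝ} (hL : CPot L φ) (hA : CPot A ψ) (j : ℕ) :
    Integrable (fun x => mdet n (slots n j (Hm φ x) (Hm ψ x))) ∧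
      mixedVolume (slots n j L A) = (n.factorial : ℝ)⁻¹ * ∫ x, mdet n (slots n j (Hm φ x) (Hm ψ x)) := by
  have := mv_aux _ _ (slots_cpot hL hA j)
  simp only [slots_Hm] at this
  exact this

lemma vol_poly {L A : Set (EuclideanSpace ℝ (Fin n))} {φ ψ : EuclideanSpace ℝ (Fin n) → ℝ} (hL : CPot L φ) (hA : CPot A ψ)
    (t : ℝ) (ht : 0 ≤ t) :
    (volume (A + t • L)).toReal = ∑ j ∈ Finset.range (n + 1), (n.choose j : ℝ) * mixedVolume (slots n j L A) * t ^ j := by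
  have hp := hA.pot.add (hL.pot.smul t ht)
  rw [← hp.integral (hA.cpt.add (hL.cpt.smul t)) (hA.cvx.add (hL.cvx.smul t))]
  have e : ∀ x, (Hm (fun x => ψ x + t * φ x) x).det
      = ∑ j ∈ Finset.range (n + 1), (n.factorial : ℝ)⁻¹ * (n.choose j : ℝ) * t ^ j * mdet n (slots n j (Hm φ x) (Hm ψ x)) := by
    intro x
    rw [Hm_add hA.pot (hL.pot.smul t ht), Hm_smul hL.pot]
    have := det_add_smul (Hm φ x) (Hm ψ x) t
    have hn : (n.factorial : ℝ) ≠ 0 := by positivity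
    rw [← eq_inv_mul_iff_mul_eq₀ hn] at this
    rw [this, Finset.mul_sum]
    exact Finset.sum_congr rfl fun j _ => by ring
  simp only [e]
  rw [integral_finsetSum _ fun j _ => (mv_slots hL hA j).1.const_mul _]
  refine Finset.sum_congr rfl fun j _ => ?_
  rw [integral_const_mul, (mv_slots hL hA j).2]
  ring

lemma cpot_sum {r : ℕ} {B : Fin r → Set (EuclideanSpace ℝ (Fin n))} {φ : Fin r → EuclideanSpace ℝ (Fin n) → ℝ}
    (hB : ∀ i, CPot (B i) (φ i)) (s : Fin r → ℝ) (hs : ∀ i, 0 ≤ s i) :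
    CPot (∑ i, s i • B i) (fun x => ∑ i, s i * φ i x) ∧
      ∀ x, Hm (fun x => ∑ i, s i * φ i x) x = ∑ i, s i • Hm (φ i) x := by
  have h1 : ∀ i ∈ Finset.univ, SuppPot (s i • B i) (fun x => s i * φ i x) := fun i _ => (hB i).pot.smul (s i) (hs i)
  refine ⟨⟨SuppPot.sum Finset.univ _ _ h1, compact_sum _ _ fun i _ => (hB i).cpt.smul _,
    convex_sum' _ _ fun i _ => (hB i).cvx.smul _⟩, ?_⟩
  intro x
  rw [Hm_sum _ _ (fun i x => s i * φ i x) h1]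
  exact Finset.sum_congr rfl fun i _ => Hm_smul (hB i).pot _ _

lemma mv_sum_ge {r : ℕ} (hr : 0 < r) (hrn : r ≤ n) {A : Set (EuclideanSpace ℝ (Fin n))} {ψ : EuclideanSpace ℝ (Fin n) → ℝ}
    (hA : CPot A ψ) {B : Fin r → Set (EuclideanSpace ℝ (Fin n))} {φ : Fin r → EuclideanSpace ℝ (Fin n) → ℝ}
    (hB : ∀ i, CPot (B i) (φ i)) (s : Fin r → ℝ) (hs : ∀ i, 0 ≤ s i) :
    r.factorial * (∏ i, s i) * mixedVolume (fun j : Fin n => if h : (j : ℕ) < r then B ⟨j, h⟩ else A)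
      ≤ mixedVolume (slots n r (∑ i, s i • B i) A) := by
  obtain ⟨hc, hH⟩ := cpot_sum hB s hs
  have h1 := mv_aux (fun j : Fin n => if h : (j : ℕ) < r then B ⟨j, h⟩ else A) (fun j : Fin n => if h : (j : ℕ) < r then φ ⟨j, h⟩ else ψ)
    (by intro i; split_ifs with h; exacts [hB _, hA])
  have e : ∀ x, (fun j : Fin n => Hm (if h : (j : ℕ) < r then φ ⟨j, h⟩ else ψ) x)
      = fun j : Fin n => if h : (j : ℕ) < r then Hm (φ ⟨j, h⟩) x else Hm ψ x := by
    intro x; ext1 j; split_ifs <;> rfl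
  simp only [e] at h1
  have h2 := mv_slots hc hA r
  simp only [hH] at h2
  rw [h1.2, h2.2]
  have h3 : r.factorial * (∏ i, s i) * ∫ x, mdet n (fun j : Fin n => if h : (j : ℕ) < r then Hm (φ ⟨j, h⟩) x else Hm ψ x)
      ≤ ∫ x, mdet n (slots n r (∑ i, s i • Hm (φ i) x) (Hm ψ x)) := by
    rw [← integral_const_mul]
    apply integral_mono (h1.1.const_mul _) h2.1
    intro x
    exact mdet_sum_ge r hr hrn _ _ (fun i => (hB i).pot.posSemidef x) (hA.pot.posSemidef x) s hs
  have : (0:ℝ) ≤ (n.factorial : ℝ)⁻¹ := by positivity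
  calc _ = (n.factorial : ℝ)⁻¹ * (r.factorial * (∏ i, s i) * ∫ x, mdet n (fun j : Fin n => if h : (j : ℕ) < r then Hm (φ ⟨j, h⟩) x else Hm ψ x)) := by ring
    _ ≤ _ := mul_le_mul_of_nonneg_left h3 this

lemma slots_one {X : Type*} (hn : 0 < n) (L A : X) : slots n 1 L A = Function.update (fun _ => A) ⟨0, hn⟩ L := by
  ext1 i
  simp only [slots, Function.update_apply, Fin.ext_iff, Nat.lt_one_iff]

lemma mv_one {r : ℕ} (hn : 0 < n) {A : Set (EuclideanSpace ℝ (Fin n))} {ψ : EuclideanSpace ℝ (Fin n) → ℝ}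
    (hA : CPot A ψ) {B : Fin r → Set (EuclideanSpace ℝ (Fin n))} {φ : Fin r → EuclideanSpace ℝ (Fin n) → ℝ}
    (hB : ∀ i, CPot (B i) (φ i)) (s : Fin r → ℝ) (hs : ∀ i, 0 ≤ s i) :
    mixedVolume (slots n 1 (∑ i, s i • B i) A) = ∑ i, s i * mixedVolume (slots n 1 (B i) A) := by
  obtain ⟨hc, hH⟩ := cpot_sum hB s hs
  rw [(mv_slots hc hA 1).2]
  have e : ∀ x, mdet n (slots n 1 (Hm (fun x => ∑ i, s i * φ i x) x) (Hm ψ x))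
      = ∑ i, s i * mdet n (slots n 1 (Hm (φ i) x) (Hm ψ x)) := by
    intro x
    rw [hH]
    simp only [slots_one hn]
    rw [MultilinearMap.map_update_sum]
    exact Finset.sum_congr rfl fun i _ => by rw [MultilinearMap.map_update_smul, smul_eq_mul]
  simp only [e]
  rw [integral_finsetSum _ fun i _ => (mv_slots (hB i) hA 1).1.const_mul _, Finset.mul_sum]
  refine Finset.sum_congr rfl fun i _ => ?_
  rw [integral_const_mul, (mv_slots (hB i) hA 1).2]
  ring

end G3



section HH

/-- binomial-type polynomials attached to a sequence -/
noncomputable def PP (W : ℕ → ℝ) (m k : ℕ) (t : ℝ) : ℝ :=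
  ∑ j ∈ Finset.range (m + 1), (m.choose j : ℝ) * W (j + k) * t ^ j

lemma PP_succ (W : ℕ → ℝ) (m k : ℕ) (t : ℝ) : PP W (m + 1) k t = PP W m k t + t * PP W m (k + 1) t := by
  have h1 : PP W m k t = ∑ j ∈ Finset.range (m + 1 + 1), (m.choose j : ℝ) * W (j + k) * t ^ j := by
    rw [Finset.sum_range_succ]; simp [PP]
  rw [h1, PP, Finset.sum_range_succ', Finset.sum_range_succ' _ (m + 1), PP, Finset.mul_sum]
  simp only [Nat.choose_succ_succ]
  rw [add_right_comm, ← Finset.sum_add_distrib]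
  congr 1
  · refine Finset.sum_congr rfl fun j _ => ?_
    rw [show j + (k + 1) = j + 1 + k by ring]
    push_cast
    ring
  · simp

lemma PP_deriv (W : ℕ → ℝ) (m k : ℕ) (t : ℝ) :
    HasDerivAt (PP W (m + 1) k) ((m + 1 : ℝ) * PP W m (k + 1) t) t := by
  have h : HasDerivAt (PP W (m + 1) k)
      (∑ j ∈ Finset.range (m + 1 + 1), ((m + 1).choose j : ℝ) * W (j + k) * ((j : ℝ) * t ^ (j - 1))) t := by
    apply HasDerivAt.fun_sum
    intro j _
    exact (hasDerivAt_pow j t).const_mul _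
  convert h using 1
  rw [Finset.sum_range_succ', PP, Finset.mul_sum]
  simp only [Nat.cast_zero, zero_mul, mul_zero, add_zero]
  refine Finset.sum_congr rfl fun j _ => ?_
  have := Nat.add_one_mul_choose_eq m j
  have h2 : ((m : ℝ) + 1) * (m.choose j : ℝ) = ((m + 1).choose (j + 1) : ℝ) * ((j : ℝ) + 1) := by exact_mod_cast this
  rw [show j + (k + 1) = j + 1 + k by ring, Nat.add_sub_cancel]
  push_cast
  linear_combination (W (j + 1 + k) * t ^ j) * h2

lemma PP_zero (W : ℕ → ℝ) (m k : ℕ) : PP W m k 0 = W k := by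
  rw [PP, Finset.sum_range_succ']
  simp

lemma PP_ge (W : ℕ → ℝ) (hW : ∀ j, 0 ≤ W j) (m k : ℕ) (t : ℝ) (ht : 0 ≤ t) : W k ≤ PP W m k t := by
  rw [PP, Finset.sum_range_succ']
  have : 0 ≤ ∑ j ∈ Finset.range m, (m.choose (j + 1) : ℝ) * W (j + 1 + k) * t ^ (j + 1) :=
    Finset.sum_nonneg fun j _ => by have := hW (j + 1 + k); positivity
  simp only [Nat.choose_zero_right, Nat.cast_one, one_mul, zero_add, pow_zero, mul_one]
  linarith

lemma concave_tangent {h h' : ℝ → ℝ} (hc : ConcaveOn ℝ (Set.Ici 0) h) (hd : ∀ t, 0 ≤ t → HasDerivAt h (h' t) t)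
    (s t : ℝ) (hs : 0 ≤ s) (ht : 0 ≤ t) : h s ≤ h t + h' t * (s - t) := by
  rcases lt_trichotomy s t with hst | rfl | hst
  · have := hc.le_slope_of_hasDerivAt (Set.mem_Ici.2 hs) (Set.mem_Ici.2 ht) hst (hd t ht)
    rw [slope_def_field, le_div_iff₀ (by linarith)] at this
    nlinarith
  · simp
  · have := hc.slope_le_of_hasDerivAt (Set.mem_Ici.2 ht) (Set.mem_Ici.2 hs) hst (hd t ht)
    rw [slope_def_field, div_le_iff₀ (by linarith)] at this
    nlinarith

variable {n : ℕ} {W : ℕ → ℝ}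

lemma h_deriv (hW : ∀ j, 0 ≤ W j) (h0 : 0 < W 0) (m : ℕ) (t : ℝ) (ht : 0 ≤ t) :
    HasDerivAt (fun t => PP W (m + 1) 0 t ^ (1 / ((m + 1 : ℕ) : ℝ)))
      (PP W (m + 1) 0 t ^ (1 / ((m + 1 : ℕ) : ℝ) - 1) * PP W m 1 t) t := by
  have hp : 0 < PP W (m + 1) 0 t := h0.trans_le (PP_ge W hW _ _ t ht)
  have := (PP_deriv W m 0 t).rpow_const (p := 1 / ((m + 1 : ℕ) : ℝ)) (Or.inl hp.ne')
  convert this using 1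
  have hm : ((m : ℝ) + 1) ≠ 0 := by positivity
  push_cast
  field_simp

lemma concave_bound (m : ℕ) (hW : ∀ j, 0 ≤ W j) (h0 : 0 < W 0)
    (hc : ConcaveOn ℝ (Set.Ici 0) (fun t => PP W (m + 1) 0 t ^ (1 / ((m + 1 : ℕ) : ℝ)))) (h1 : W 1 = 0)
    (t : ℝ) (ht : 0 ≤ t) : PP W (m + 1) 0 t ≤ W 0 := by
  have := concave_tangent hc (fun t ht => h_deriv hW h0 m t ht) t 0 ht le_rfl
  rw [PP_zero W m 1, h1, mul_zero, zero_mul, add_zero] at this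
  rw [Real.rpow_le_rpow_iff (h0.le.trans (PP_ge W hW _ _ t ht)) (h0.le.trans (PP_ge W hW _ _ 0 le_rfl)) (by positivity),
    PP_zero] at this
  exact this

lemma bmseq_of_concave (m : ℕ) (hW : ∀ j, 0 ≤ W j) (h0 : W 0 = 1) (h1 : W 1 = 1)
    (hc : ConcaveOn ℝ (Set.Ici 0) (fun t => PP W (m + 2) 0 t ^ (1 / ((m + 2 : ℕ) : ℝ)))) : BMSeq (m + 2) W := by
  have h0' : 0 < W 0 := by rw [h0]; exact one_pos
  have hq : ∀ t, 0 ≤ t → 1 ≤ PP W (m + 2) 0 t := fun t ht => by rw [← h0]; exact PP_ge W hW _ _ t ht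
  have hd := fun (t : ℝ) (ht : 0 ≤ t) => h_deriv hW h0' (m + 1) t ht
  have tan := concave_tangent hc hd
  set p : ℝ := 1 / ((m + 2 : ℕ) : ℝ) with hp
  have hp0 : 0 < p := by positivity
  have tan0 : ∀ t, 0 ≤ t → PP W (m + 2) 0 t ^ p ≤ 1 + t := by
    intro t ht
    have := tan t 0 ht le_rfl
    simpa [PP_zero, h0, h1] using this
  have anti : AntitoneOn (fun t => PP W (m + 2) 0 t ^ (p - 1) * PP W (m + 1) 1 t) (Set.Ici 0) := by
    intro s hs t ht hst
    rcases hst.eq_or_lt with rfl | hst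
    · exact le_rfl
    have a1 := tan s t hs ht
    have a2 := tan t s ht hs
    by_contra hcon
    push Not at hcon
    nlinarith [mul_lt_mul_of_pos_right hcon (sub_pos.2 hst)]
  refine ⟨hW, h0, h1, ?_, ?_, ?_⟩
  · intro t ht
    have h2 := tan0 t ht
    have h3 := pow_le_pow_left₀ (Real.rpow_nonneg (zero_le_one.trans (hq t ht)) p) h2 (m + 2)
    rw [hp, one_div, Real.rpow_inv_natCast_pow (zero_le_one.trans (hq t ht)) (by omega)] at h3
    exact h3
  · intro t ht
    have hqt := hq t ht
    have hqp : 0 < PP W (m + 2) 0 t := by linarith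
    set u := PP W (m + 2) 0 t ^ (p - 1) with hu
    have hu0 : 0 < u := Real.rpow_pos_of_pos (by linarith) _
    have b1 : u * PP W (m + 1) 1 t ≤ 1 := by
      have := anti (Set.mem_Ici.2 le_rfl) (Set.mem_Ici.2 ht) ht
      simpa [PP_zero, h0, h1] using this
    have b2 : 1 ≤ u * PP W (m + 1) 0 t := by
      have this : PP W (m + 2) 0 0 ^ p ≤ PP W (m + 2) 0 t ^ p + u * PP W (m + 1) 1 t * (0 - t) := tan 0 t le_rfl ht
      rw [PP_zero, h0, Real.one_rpow] at this
      have e : PP W (m + 2) 0 t ^ p = u * PP W (m + 2) 0 t := by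
        rw [hu, Real.rpow_sub_one hqp.ne' p, div_mul_cancel₀ _ hqp.ne']
      rw [e, PP_succ W (m + 1) 0] at this
      rw [zero_add] at this
      nlinarith
    have b3 : u * PP W (m + 1) 1 t ≤ u * PP W (m + 1) 0 t := b1.trans b2
    exact le_of_mul_le_mul_left b3 hu0
  · intro t ht
    have hqt := hq t ht
    have hqp : 0 < PP W (m + 2) 0 t := by linarith
    have d1 : HasDerivAt (fun t => PP W (m + 2) 0 t ^ (p - 1) * PP W (m + 1) 1 t)
        (((((m + 1 : ℕ) : ℝ) + 1) * PP W (m + 1) 1 t) * (p - 1) * PP W (m + 2) 0 t ^ (p - 1 - 1) * PP W (m + 1) 1 t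
          + PP W (m + 2) 0 t ^ (p - 1) * (((m : ℝ) + 1) * PP W m 2 t)) t :=
      ((PP_deriv W (m + 1) 0 t).rpow_const (p := p - 1) (Or.inl hqp.ne')).mul (PP_deriv W m 1 t)
    have d2 := (d1.hasDerivWithinAt (s := Set.Ici 0)).derivWithin (uniqueDiffOn_Ici 0 t ht)
    have d3 : derivWithin (fun t => PP W (m + 2) 0 t ^ (p - 1) * PP W (m + 1) 1 t) (Set.Ici 0) t ≤ 0 := anti.derivWithin_nonpos
    rw [d2] at d3
    set v := PP W (m + 2) 0 t ^ (p - 1 - 1) with hv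
    have hv0 : 0 < v := Real.rpow_pos_of_pos (by linarith) _
    have e : PP W (m + 2) 0 t ^ (p - 1) = v * PP W (m + 2) 0 t := by
      rw [hv, Real.rpow_sub_one hqp.ne' (p - 1), div_mul_cancel₀ _ hqp.ne']
    have hpe : (((m + 1 : ℕ) : ℝ) + 1) * (p - 1) = - ((m : ℝ) + 1) := by
      rw [hp]; push_cast
      have : (m : ℝ) + 2 ≠ 0 := by positivity
      field_simp; ring
    have d4 : v * (m + 1 : ℝ) * (PP W (m + 2) 0 t * PP W m 2 t - PP W (m + 1) 1 t ^ 2) ≤ 0 := by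
      rw [e] at d3
      refine le_trans (le_of_eq ?_) d3
      linear_combination (- PP W (m + 1) 1 t ^ 2 * v) * hpe
    have d5 : PP W (m + 2) 0 t * PP W m 2 t - PP W (m + 1) 1 t ^ 2 ≤ 0 := by
      by_contra hcon
      push Not at hcon
      have : 0 < v * (m + 1 : ℝ) * (PP W (m + 2) 0 t * PP W m 2 t - PP W (m + 1) 1 t ^ 2) := by positivity
      linarith
    have e1 := PP_succ W (m + 1) 0 t
    have e2 := PP_succ W m 0 t
    have e3 := PP_succ W m 1 t
    have goal : PP W m 0 t * PP W m 2 t ≤ PP W m 1 t ^ 2 := by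
      simp only [zero_add] at e1 e2 e3
      rw [e1, e2, e3] at d5
      linear_combination d5
    exact goal

end HH



section ZZ
variable {n : ℕ}

lemma SuppPot.nonempty {K : Set (EuclideanSpace ℝ (Fin n))} {φ : EuclideanSpace ℝ (Fin n) → ℝ} (h : SuppPot K φ) :
    K.Nonempty := by
  obtain ⟨y, hy, _⟩ := h.up 0 0
  exact ⟨y, hy⟩

lemma IsConvexBody.vol_pos {K : Set (EuclideanSpace ℝ (Fin n))} (h : IsConvexBody K) : 0 < (volume K).toReal :=
  ENNReal.toReal_pos (Measure.measure_pos_of_nonempty_interior _ h.2.2).ne' h.2.1.measure_ne_top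

lemma IsConvexBody.cpot {K : Set (EuclideanSpace ℝ (Fin n))} (h : IsConvexBody K) : ∃ φ, CPot K φ := by
  obtain ⟨φ, hφ⟩ := exists_suppPot K h.2.1 (h.2.2.mono interior_subset)
  exact ⟨φ, hφ, h.2.1, h.1⟩

lemma vol_PP {L A : Set (EuclideanSpace ℝ (Fin n))} {φ ψ : EuclideanSpace ℝ (Fin n) → ℝ} (hL : CPot L φ) (hA : CPot A ψ)
    (t : ℝ) (ht : 0 ≤ t) :
    (volume (A + t • L)).toReal = PP (fun j => mixedVolume (slots n j L A)) n 0 t := vol_poly hL hA t ht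

lemma mv_zero {L A : Set (EuclideanSpace ℝ (Fin n))} {φ ψ : EuclideanSpace ℝ (Fin n) → ℝ} (hL : CPot L φ) (hA : CPot A ψ) :
    mixedVolume (slots n 0 L A) = (volume A).toReal := by
  have := vol_PP hL hA 0 le_rfl
  rw [PP_zero, Set.zero_smul_set hL.pot.nonempty, add_zero] at this
  exact this.symm

lemma mv_pos (hn : 0 < n) {B A : Set (EuclideanSpace ℝ (Fin n))} {φ ψ : EuclideanSpace ℝ (Fin n) → ℝ} (hB : CPot B φ) (hA : CPot A ψ)
    (hBp : 0 < (volume B).toReal) (hAp : 0 < (volume A).toReal) : 0 < mixedVolume (slots n 1 B A) := by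
  obtain ⟨m, rfl⟩ : ∃ m, n = m + 1 := ⟨n - 1, by omega⟩
  set W : ℕ → ℝ := fun j => mixedVolume (slots (m + 1) j B A) with hW
  have hW0 : ∀ j, 0 ≤ W j := fun j => mv_nonneg _ _ (slots_cpot hB hA j)
  have hz : W 0 = (volume A).toReal := mv_zero hB hA
  refine lt_of_le_of_ne (hW0 1) fun h1 => ?_
  have hc := (bm_concave hn A B hA.cpt hB.cpt hA.cvx hB.cvx hAp hB.pot.nonempty).congr
    (g := fun t => PP W (m + 1) 0 t ^ (1 / ((m + 1 : ℕ) : ℝ))) (by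
      intro t ht
      simp only
      rw [vol_PP hB hA t ht])
  have hb := concave_bound m hW0 (by rw [hz]; exact hAp) hc h1.symm
  set a := (volume A).toReal with ha
  set b := (volume B).toReal with hb'
  have hT : (0:ℝ) ≤ a / b + 1 := by positivity
  have h2 := hb (a / b + 1) hT
  rw [← vol_PP hB hA _ hT, hz] at h2
  obtain ⟨y, hy⟩ := hA.pot.nonempty
  have h3 : (volume ((a / b + 1) • B)).toReal ≤ (volume (A + (a / b + 1) • B)).toReal := by
    refine ENNReal.toReal_mono (hA.cpt.add (hB.cpt.smul _)).measure_ne_top ?_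
    calc _ = volume ({y} + (a / b + 1) • B) := by simp
      _ ≤ _ := measure_mono (Set.add_subset_add_right (by simpa using hy))
  rw [Measure.addHaar_smul, finrank_euclideanSpace_fin, ENNReal.toReal_mul, ENNReal.toReal_ofReal (abs_nonneg _),
    abs_of_nonneg (by positivity), ← hb'] at h3
  have h4 : a / b + 1 ≤ (a / b + 1) ^ (m + 1) := le_self_pow₀ (by have : 0 ≤ a / b := by positivity
                                                                  linarith) (by omega)
  have h5 : (a / b + 1) * b ≤ a := (mul_le_mul_of_nonneg_right h4 hBp.le).trans (h3.trans h2)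
  rw [add_mul, div_mul_cancel₀ _ hBp.ne'] at h5
  linarith

lemma final_arith {α P f ρ a X w : ℝ} (hα : 0 < α) (hP : 0 < P) (hf : 0 < f) (hρ : 0 < ρ)
    (h : f * (α * a / (ρ * P)) * X ≤ α * w) : a * X ≤ ρ / f * w * P := by
  have h2 : (f / (ρ * P)) * (a * X) ≤ w := by
    refine le_of_mul_le_mul_left ?_ hα
    refine le_trans (le_of_eq ?_) h
    ring
  rw [div_mul_eq_mul_div, div_le_iff₀ (mul_pos hρ hP)] at h2
  rw [div_mul_eq_mul_div, div_mul_eq_mul_div, le_div_iff₀ hf]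
  linarith

lemma main_bound (n r : ℕ) (hr : 2 ≤ r) (hrn : r ≤ n)
    (A : Set (EuclideanSpace ℝ (Fin n))) (B : Fin r → Set (EuclideanSpace ℝ (Fin n)))
    (hA : IsConvexBody A) (hB : ∀ k, IsConvexBody (B k))
    (k : ℕ) (hk1 : 1 ≤ k) (hkr : k ≤ r) :
    (volume A).toReal ^ (r - 1) *
      mixedVolume (fun j : Fin n => if h : (j : ℕ) < r then B ⟨(j : ℕ), h⟩ else A) ≤
    Bc n r k *
      ∏ i, mixedVolume (slots n 1 (B i) A) := by
  obtain ⟨ψ, hψ⟩ := hA.cpot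
  choose φ hφ using fun i => (hB i).cpot
  have hn : 0 < n := by omega
  set α := (volume A).toReal with hα
  have hα0 : 0 < α := hA.vol_pos
  set V : Fin r → ℝ := fun i => mixedVolume (slots n 1 (B i) A) with hV
  have hV0 : ∀ i, 0 < V i := fun i => mv_pos hn (hφ i) hψ (hB i).vol_pos hα0
  have hr0 : (0:ℝ) < r := by exact_mod_cast (by omega : 0 < r)
  set s : Fin r → ℝ := fun i => α / (r * V i) with hs
  have hs0 : ∀ i, 0 ≤ s i := fun i => by have := hV0 i; positivity
  set L := ∑ i, s i • B i with hL
  obtain ⟨hLp, -⟩ := cpot_sum hφ s hs0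
  set w : ℕ → ℝ := fun j => mixedVolume (slots n j L A) with hw
  have hw0 : ∀ j, 0 ≤ w j := fun j => mv_nonneg _ _ (slots_cpot hLp hψ j)
  set W : ℕ → ℝ := fun j => w j / α with hW
  have w0 : w 0 = α := mv_zero hLp hψ
  have w1 : w 1 = α := by
    have := mv_one hn hψ hφ s hs0
    rw [← hL] at this
    have e : ∀ i, s i * V i = α / r := fun i => by
      have := (hV0 i).ne'
      simp only [hs]
      field_simp
    change w 1 = ∑ i, s i * V i at this
    rw [this]
    simp only [e]
    simp
    field_simp
  have hPP : ∀ t, PP W n 0 t = PP w n 0 t / α := by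
    intro t
    rw [PP, PP, Finset.sum_div]
    refine Finset.sum_congr rfl fun j _ => ?_
    simp only [hW]
    ring
  have hc : ConcaveOn ℝ (Set.Ici 0) (fun t => PP W n 0 t ^ (1 / (n : ℝ))) := by
    refine ((bm_concave hn A L hψ.cpt hLp.cpt hψ.cvx hLp.cvx hα0 hLp.pot.nonempty).smul
      (c := (α⁻¹) ^ (1 / (n : ℝ))) (by positivity)).congr ?_
    intro t ht
    simp only [smul_eq_mul]
    rw [vol_PP hLp hψ t ht, hPP, show PP w n 0 t / α = α⁻¹ * PP w n 0 t from div_eq_inv_mul _ _,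
      Real.mul_rpow (inv_nonneg.2 hα0.le) ((hw0 0).trans (PP_ge w hw0 _ _ t ht))]
  have hbm : BMSeq n W := by
    obtain ⟨m, rfl⟩ : ∃ m, n = m + 2 := ⟨n - 2, by omega⟩
    refine bmseq_of_concave m (fun j => div_nonneg (hw0 j) hα0.le) ?_ ?_ hc
    · simp only [hW, w0]; exact div_self hα0.ne'
    · simp only [hW, w1]; exact div_self hα0.ne'
  have hnum := hbm.numeric r k hr hrn hk1 hkr
  have hge := mv_sum_ge (by omega : 0 < r) hrn hψ hφ s hs0
  rw [← hL] at hge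
  set X := mixedVolume (fun j : Fin n => if h : (j : ℕ) < r then B ⟨(j : ℕ), h⟩ else A) with hX
  change r.factorial * (∏ i, s i) * X ≤ w r at hge
  have hwr : w r = α * W r := by simp only [hW]; field_simp
  have hPV : 0 < ∏ i, V i := Finset.prod_pos fun i _ => hV0 i
  have hps : ∏ i, s i = α ^ r / (r ^ r * ∏ i, V i) := by
    simp only [hs]
    rw [Finset.prod_div_distrib, Finset.prod_mul_distrib]
    simp
  have hfac : (0:ℝ) < r.factorial := by positivity
  have hαr : α ^ r = α * α ^ (r - 1) := by
    rw [← pow_succ']; congr 1; omega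
  have key : α ^ (r - 1) * X ≤ gfun r * W r * ∏ i, V i := by
    rw [hps, hwr, hαr] at hge
    exact final_arith hα0 hPV hfac (pow_pos hr0 r) hge
  exact key.trans (mul_le_mul_of_nonneg_right hnum hPV.le)

end ZZ

theorem bezout_mixed_volume_bound (n r : ℕ) (hr : 2 ≤ r) (hrn : r ≤ n)
    (A : Set (EuclideanSpace ℝ (Fin n))) (B : Fin r → Set (EuclideanSpace ℝ (Fin n)))
    (hA : IsConvexBody A) (hB : ∀ k, IsConvexBody (B k))
    (k : ℕ) (hk1 : 1 ≤ k) (hkr : k ≤ r) :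
    (volume A).toReal ^ (r - 1) *
      mixedVolume (fun j : Fin n => if h : (j : ℕ) < r then B ⟨(j : ℕ), h⟩ else A) ≤
    (2 : ℝ) ^ (k * (k - 1) / 2) * (n : ℝ) ^ (r - k) / ((r - k).factorial : ℝ) *
      ∏ i, mixedVolume (fun j : Fin n => if (j : ℕ) = 0 then B i else A) := by
  have h := main_bound n r hr hrn A B hA hB k hk1 hkr
  have e : ∀ i, slots n 1 (B i) A = fun j : Fin n => if (j : ℕ) = 0 then B i else A := by
    intro i
    ext1 j
    simp only [slots, Nat.lt_one_iff]
  simp only [e] at h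
  exact h
end

section
/- For any convex bodies $A, B_1, \dots, B_m$ in $\mathbb{R}^n$ with $|A| > 0$: $|A|^{m-1} |B_1 + \cdots + B_m| \leq \prod_{k=1}^m |A + B_k|$, where $+$ denotes Minkowski sum. -/
open scoped Pointwise
open MeasureTheory

theorem petridis_weighted {G ι : Type*} [AddCommGroup G] [DecidableEq G] [Fintype ι]
    (X : Finset G) (B : ι → Finset G) (w : ι → ℝ) (hw : ∀ i, 0 ≤ w i) (K : ℝ)
    (hmin : ∀ Y ⊆ X, K * (Y.card : ℝ) ≤ ∑ i, w i * ((Y + B i).card : ℝ))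
    (hX : ∑ i, w i * ((X + B i).card : ℝ) = K * X.card) (C : Finset G) :
    ∑ i, w i * ((X + C + B i).card : ℝ) ≤ K * ((X + C).card : ℝ) := by
  induction C using Finset.induction_on with
  | empty => simp
  | insert c C hc ih =>
    set W := X.filter (fun x => x + c ∈ X + C) with hW
    have hWX : W ⊆ X := Finset.filter_subset _ _
    have h1 : ((X + insert c C).card : ℝ) = (X + C).card + X.card - W.card := by
      have e : X + insert c C = (X + C) ∪ ((X \ W) + {c}) := by
        ext g
        simp only [Finset.mem_add, Finset.mem_union, Finset.mem_insert, Finset.mem_sdiff,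
          Finset.mem_singleton, hW, Finset.mem_filter]
        constructor
        · rintro ⟨x, hx, y, rfl | hy, rfl⟩
          · by_cases h : ∃ u ∈ X, ∃ v ∈ C, u + v = x + y
            · exact Or.inl h
            · exact Or.inr ⟨x, ⟨hx, fun h' => h h'.2⟩, y, rfl, rfl⟩
          · exact Or.inl ⟨x, hx, y, hy, rfl⟩
        · rintro (⟨x, hx, y, hy, rfl⟩ | ⟨x, ⟨hx, _⟩, y, rfl, rfl⟩)
          · exact ⟨x, hx, y, Or.inr hy, rfl⟩
          · exact ⟨x, hx, y, Or.inl rfl, rfl⟩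
      have d : Disjoint (X + C) ((X \ W) + {c}) := by
        rw [Finset.disjoint_left]
        intro g hg hg'
        obtain ⟨x, hx, y, hy, rfl⟩ := Finset.mem_add.1 hg'
        rw [Finset.mem_singleton] at hy
        subst hy
        rw [Finset.mem_sdiff] at hx
        exact hx.2 (Finset.mem_filter.2 ⟨hx.1, hg⟩)
      rw [e, Finset.card_union_of_disjoint d, Finset.card_add_singleton]
      have := Finset.card_sdiff_add_card_eq_card hWX
      have : ((X \ W).card : ℝ) + W.card = X.card := by exact_mod_cast this
      push_cast
      linarith
    have h2 : ∀ i, ((X + insert c C + B i).card : ℝ) ≤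
        (X + C + B i).card + (X + B i).card - (W + B i).card := by
      intro i
      have e : X + insert c C + B i ⊆ (X + C + B i) ∪ (((X + B i) \ (W + B i)) + {c}) := by
        intro g hg
        obtain ⟨s, hs, b, hb, rfl⟩ := Finset.mem_add.1 hg
        obtain ⟨x, hx, y, hy, rfl⟩ := Finset.mem_add.1 hs
        rw [Finset.mem_union]
        rcases Finset.mem_insert.1 hy with rfl | hy
        · by_cases h : x + b ∈ W + B i
          · left
            obtain ⟨u, hu, v, hv, huv⟩ := Finset.mem_add.1 h
            have : x + y + b = (u + y) + v := by
              rw [add_right_comm x y b, ← huv]; abel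
            rw [this]
            exact Finset.add_mem_add (Finset.mem_filter.1 hu).2 hv
          · right
            rw [add_right_comm]
            exact Finset.add_mem_add
              (Finset.mem_sdiff.2 ⟨Finset.add_mem_add hx hb, h⟩) (Finset.mem_singleton_self _)
        · left
          exact Finset.add_mem_add (Finset.add_mem_add hx hy) hb
      have h3 := (Finset.card_le_card e).trans (Finset.card_union_le _ _)
      rw [Finset.card_add_singleton] at h3
      have h4 := Finset.card_sdiff_add_card_eq_card
        (Finset.add_subset_add_right hWX : W + B i ⊆ X + B i)
      have h3' : ((X + insert c C + B i).card : ℝ) ≤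
        (X + C + B i).card + ((X + B i) \ (W + B i)).card := by exact_mod_cast h3
      have h4' : (((X + B i) \ (W + B i)).card : ℝ) + (W + B i).card = (X + B i).card := by
        exact_mod_cast h4
      linarith
    calc ∑ i, w i * ((X + insert c C + B i).card : ℝ)
        ≤ ∑ i, w i * ((X + C + B i).card + (X + B i).card - (W + B i).card : ℝ) :=
          Finset.sum_le_sum fun i _ => mul_le_mul_of_nonneg_left (h2 i) (hw i)
      _ = ∑ i, w i * ((X + C + B i).card : ℝ) + ∑ i, w i * ((X + B i).card : ℝ)
          - ∑ i, w i * ((W + B i).card : ℝ) := by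
          rw [← Finset.sum_add_distrib, ← Finset.sum_sub_distrib]
          exact Finset.sum_congr rfl fun i _ => by ring
      _ ≤ K * (X + C).card + K * X.card - K * W.card := by
          have := hmin W hWX
          linarith
      _ = K * ((X + insert c C).card : ℝ) := by rw [h1]; ring

set_option maxHeartbeats 1000000 in
theorem plunnecke_weak {G : Type*} [AddCommGroup G] [DecidableEq G] (m : ℕ)
    (A : Finset G) (B : Fin m → Finset G) (hA : A.Nonempty) (hB : ∀ i, (B i).Nonempty) :
    (A.card : ℝ) ^ m * ((∑ i, B i).card : ℝ) ≤
      (m : ℝ) ^ m * ((∏ i, ((A + B i).card : ℝ)) * A.card) := by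
  have hA0 : (0 : ℝ) < A.card := by exact_mod_cast hA.card_pos
  have hAB : ∀ i, (0 : ℝ) < (A + B i).card := fun i => by
    exact_mod_cast (hA.add (hB i)).card_pos
  set w : Fin m → ℝ := fun i => A.card / (A + B i).card with hw
  have hwpos : ∀ i, 0 < w i := fun i => div_pos hA0 (hAB i)
  set F : Finset G → ℝ := fun Y => ∑ i, w i * ((Y + B i).card : ℝ) with hF
  have hF0 : ∀ Y, 0 ≤ F Y := fun Y =>
    Finset.sum_nonneg fun i _ => mul_nonneg (hwpos i).le (Nat.cast_nonneg _)
  obtain ⟨X, hXm, hXmin⟩ := Finset.exists_min_image (A.powerset.filter Finset.Nonempty)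
    (fun Y => F Y / Y.card) ⟨A, by simp [hA]⟩
  rw [Finset.mem_filter, Finset.mem_powerset] at hXm
  obtain ⟨hXA, hXne⟩ := hXm
  have hX0 : (0 : ℝ) < X.card := by exact_mod_cast hXne.card_pos
  set K := F X / X.card with hK
  have hK0 : 0 ≤ K := div_nonneg (hF0 _) hX0.le
  have hKm : K ≤ m := by
    have h := hXmin A (by simp [hA])
    have : F A / A.card = m := by
      have : F A = ∑ i : Fin m, (A.card : ℝ) :=
        Finset.sum_congr rfl fun i _ => by
          simp only [hw]; rw [div_mul_cancel₀ _ (hAB i).ne']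
      rw [this]; simp [hA0.ne']
    rw [this] at h
    exact h
  have hpet := petridis_weighted X B w (fun i => (hwpos i).le) K (by
    intro Y hY
    rcases Y.eq_empty_or_nonempty with rfl | hne
    · simp
    · have hY0 : (0 : ℝ) < Y.card := by exact_mod_cast hne.card_pos
      exact (le_div_iff₀ hY0).1 (hXmin Y (by simp [hne, hY.trans hXA]))) (by
    rw [hK, div_mul_cancel₀ _ hX0.ne'])
  have key : ∀ s : Finset (Fin m),
      (∏ i ∈ s, w i) * ((X + ∑ i ∈ s, B i).card : ℝ) ≤ (m : ℝ) ^ s.card * X.card := by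
    intro s
    induction s using Finset.induction_on with
    | empty => simp
    | insert a s ha ih =>
      rw [Finset.prod_insert ha, Finset.sum_insert ha, Finset.card_insert_of_notMem ha]
      have h1 : w a * ((X + (∑ i ∈ s, B i) + B a).card : ℝ) ≤
          K * ((X + ∑ i ∈ s, B i).card : ℝ) :=
        (Finset.single_le_sum (f := fun i => w i * ((X + (∑ i ∈ s, B i) + B i).card : ℝ))
          (fun i _ => mul_nonneg (hwpos i).le (Nat.cast_nonneg _)) (Finset.mem_univ a)).trans
          (hpet _)
      have h2 : X + (B a + ∑ i ∈ s, B i) = X + (∑ i ∈ s, B i) + B a := by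
        rw [add_comm (B a), add_assoc]
      rw [h2]
      have hp : 0 ≤ ∏ i ∈ s, w i := Finset.prod_nonneg fun i _ => (hwpos i).le
      calc w a * (∏ i ∈ s, w i) * ((X + (∑ i ∈ s, B i) + B a).card : ℝ)
          = (∏ i ∈ s, w i) * (w a * ((X + (∑ i ∈ s, B i) + B a).card : ℝ)) := by ring
        _ ≤ (∏ i ∈ s, w i) * (K * ((X + ∑ i ∈ s, B i).card : ℝ)) :=
            mul_le_mul_of_nonneg_left h1 hp
        _ = K * ((∏ i ∈ s, w i) * ((X + ∑ i ∈ s, B i).card : ℝ)) := by ring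
        _ ≤ m * ((m : ℝ) ^ s.card * X.card) :=
            mul_le_mul hKm ih (mul_nonneg hp (Nat.cast_nonneg _)) (Nat.cast_nonneg _)
        _ = (m : ℝ) ^ (s.card + 1) * X.card := by rw [pow_succ]; ring
  have h := key Finset.univ
  have hle : ((∑ i, B i).card : ℝ) ≤ (X + ∑ i, B i).card := by
    exact_mod_cast Finset.card_le_card_add_left hXne
  have hXAc : (X.card : ℝ) ≤ A.card := by exact_mod_cast Finset.card_le_card hXA
  have hprod : ∏ i, w i = (A.card : ℝ) ^ m / ∏ i, ((A + B i).card : ℝ) := by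
    simp [hw, Finset.prod_div_distrib]
  have hP : 0 < ∏ i, ((A + B i).card : ℝ) := Finset.prod_pos fun i _ => hAB i
  rw [hprod, Finset.card_univ, Fintype.card_fin, div_mul_eq_mul_div, div_le_iff₀ hP] at h
  calc (A.card : ℝ) ^ m * ((∑ i, B i).card : ℝ)
      ≤ (A.card : ℝ) ^ m * ((X + ∑ i, B i).card : ℝ) :=
        mul_le_mul_of_nonneg_left hle (pow_nonneg hA0.le _)
    _ ≤ (m : ℝ) ^ m * X.card * ∏ i, ((A + B i).card : ℝ) := h
    _ ≤ (m : ℝ) ^ m * A.card * ∏ i, ((A + B i).card : ℝ) :=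
        mul_le_mul_of_nonneg_right
          (mul_le_mul_of_nonneg_left hXAc (pow_nonneg (Nat.cast_nonneg _) _)) hP.le
    _ = _ := by ring

theorem piFinset_add' {G : Type*} [AddCommGroup G] [DecidableEq G] (k : ℕ) (A B : Finset G) :
    Fintype.piFinset (fun _ : Fin k => A) + Fintype.piFinset (fun _ : Fin k => B)
      = Fintype.piFinset (fun _ : Fin k => A + B) := by
  ext f
  simp only [Finset.mem_add, Fintype.mem_piFinset]
  constructor
  · rintro ⟨a, ha, b, hb, rfl⟩ j
    exact ⟨a j, ha j, b j, hb j, rfl⟩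
  · intro h
    choose a ha b hb hab using h
    exact ⟨a, ha, b, hb, funext hab⟩

theorem piFinset_sum' {G : Type*} [AddCommGroup G] [DecidableEq G] (k : ℕ) {ι : Type*}
    [DecidableEq ι] (s : Finset ι) (B : ι → Finset G) :
    ∑ i ∈ s, Fintype.piFinset (fun _ : Fin k => B i)
      = Fintype.piFinset (fun _ : Fin k => ∑ i ∈ s, B i) := by
  induction s using Finset.induction_on with
  | empty =>
    ext f
    simp [funext_iff]
  | insert a s ha ih => simp only [Finset.sum_insert ha]; rw [ih, piFinset_add']

theorem plunnecke_strong {G : Type*} [AddCommGroup G] [DecidableEq G] (m : ℕ)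
    (A : Finset G) (B : Fin m → Finset G) (hA : A.Nonempty) (hB : ∀ i, (B i).Nonempty) :
    (A.card : ℝ) ^ m * ((∑ i, B i).card : ℝ) ≤ (∏ i, ((A + B i).card : ℝ)) * A.card := by
  have hA0 : (0 : ℝ) < A.card := by exact_mod_cast hA.card_pos
  have hAB : ∀ i, (0 : ℝ) < (A + B i).card := fun i => by
    exact_mod_cast (hA.add (hB i)).card_pos
  have hR : 0 < (∏ i, ((A + B i).card : ℝ)) * A.card :=
    mul_pos (Finset.prod_pos fun i _ => hAB i) hA0
  have hk : ∀ k : ℕ, ((A.card : ℝ) ^ m * ((∑ i, B i).card : ℝ)) ^ k ≤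
      (m : ℝ) ^ m * ((∏ i, ((A + B i).card : ℝ)) * A.card) ^ k := by
    intro k
    have := plunnecke_weak m (Fintype.piFinset (fun _ : Fin k => A))
      (fun i => Fintype.piFinset (fun _ : Fin k => B i))
      (Fintype.piFinset_nonempty.2 fun _ => hA) (fun i => Fintype.piFinset_nonempty.2 fun _ => hB i)
    rw [piFinset_sum'] at this
    simp only [piFinset_add', Fintype.card_piFinset, Finset.prod_const, Finset.card_univ,
      Fintype.card_fin, Nat.cast_pow, Finset.prod_pow] at this
    rw [mul_pow, mul_pow, ← pow_mul, mul_comm m k, pow_mul]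
    exact this
  by_contra hlt
  push Not at hlt
  have h1 := (one_lt_div hR).2 hlt
  obtain ⟨k, hk'⟩ := pow_unbounded_of_one_lt ((m : ℝ) ^ m) h1
  rw [div_pow, lt_div_iff₀ (by positivity)] at hk'
  exact absurd (hk k) (not_le.2 hk')

def latt {n : ℕ} (δ r : ℝ) (S : Set (Fin n → ℝ)) : Set (Fin n → ℤ) :=
  {z | ∃ s ∈ S, ∀ j, |s j - δ * z j| ≤ r * δ}

def cub {n : ℕ} (δ : ℝ) (z : Fin n → ℤ) : Set (Fin n → ℝ) :=
  Set.pi Set.univ fun j => Set.Ico (δ * z j) (δ * z j + δ)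

theorem latt_finite {n : ℕ} {δ r : ℝ} (hδ : 0 < δ) {S : Set (Fin n → ℝ)} (hS : IsCompact S) :
    (latt δ r S).Finite := by
  obtain ⟨R, hR⟩ := hS.isBounded.exists_norm_le
  refine (Set.finite_Icc (fun _ : Fin n => -⌈R / δ + r⌉) (fun _ => ⌈R / δ + r⌉)).subset ?_
  rintro z ⟨s, hs, hz⟩
  have key : ∀ j, |(z j : ℝ)| ≤ R / δ + r := by
    intro j
    have h1 : |s j| ≤ R := (norm_le_pi_norm s j).trans (hR s hs)
    have h2 := hz j
    have h3 : |δ * (z j : ℝ)| ≤ R + r * δ := by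
      rw [abs_le] at *
      constructor <;> linarith
    rw [abs_mul, abs_of_pos hδ] at h3
    rw [div_add' _ _ _ hδ.ne', le_div_iff₀ hδ]
    linarith
  constructor
  · intro j
    have h := (abs_le.1 (key j)).1
    have h2 := Int.le_ceil (R / δ + r)
    have : (-(⌈R / δ + r⌉ : ℝ)) ≤ z j := by linarith
    exact_mod_cast this
  · intro j
    have h := (abs_le.1 (key j)).2
    have h2 := Int.le_ceil (R / δ + r)
    have : (z j : ℝ) ≤ ⌈R / δ + r⌉ := by linarith
    exact_mod_cast this

theorem floor_err {δ : ℝ} (hδ : 0 < δ) (x : ℝ) :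
    δ * ⌊x / δ⌋ ≤ x ∧ x < δ * ⌊x / δ⌋ + δ := by
  have h1 := Int.floor_le (x / δ)
  have h2 := Int.lt_floor_add_one (x / δ)
  rw [le_div_iff₀ hδ] at h1
  rw [div_lt_iff₀ hδ] at h2
  constructor <;> linarith

theorem cub_vol {n : ℕ} {δ : ℝ} (hδ : 0 < δ) (z : Fin n → ℤ) :
    volume (cub δ z) = ENNReal.ofReal (δ ^ n) := by
  unfold cub
  rw [Real.volume_pi_Ico]
  simp [ENNReal.ofReal_pow hδ.le]

/-- lower bound: any finset containing all floor points -/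
theorem vol_le_card {n : ℕ} {δ : ℝ} (hδ : 0 < δ) {S : Set (Fin n → ℝ)} (T : Finset (Fin n → ℤ))
    (hT : ∀ s ∈ S, (fun j => ⌊s j / δ⌋) ∈ T) :
    (volume S).toReal ≤ T.card * δ ^ n := by
  have h : S ⊆ ⋃ z ∈ T, cub δ z := by
    intro s hs
    refine Set.mem_biUnion (hT s hs) ?_
    intro j _
    exact floor_err hδ (s j)
  have h2 : volume S ≤ T.card * ENNReal.ofReal (δ ^ n) := by
    refine (measure_mono h).trans ((measure_biUnion_finset_le _ _).trans ?_)
    simp [cub_vol hδ]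
  have h3 := ENNReal.toReal_mono (ENNReal.mul_ne_top (by simp) (by simp)) h2
  rwa [ENNReal.toReal_mul, ENNReal.toReal_ofReal (by positivity), ENNReal.toReal_natCast] at h3

theorem card_le_vol {n : ℕ} {δ r : ℝ} (hδ : 0 < δ) (hr : 0 ≤ r) {S : Set (Fin n → ℝ)}
    (hS : IsCompact S)
    (T : Finset (Fin n → ℤ)) (hT : ∀ z ∈ T, z ∈ latt δ r S) :
    T.card * δ ^ n ≤ (volume (Metric.cthickening ((r + 1) * δ) S)).toReal := by
  have hsub : (⋃ z ∈ T, cub δ z) ⊆ Metric.cthickening ((r + 1) * δ) S := by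
    intro x hx
    simp only [Set.mem_iUnion] at hx
    obtain ⟨z, hz, hx⟩ := hx
    obtain ⟨s, hs, hsz⟩ := hT z hz
    refine Metric.mem_cthickening_of_dist_le x s _ S hs ?_
    rw [dist_pi_le_iff (by positivity)]
    intro j
    have h1 := hx j (Set.mem_univ _)
    have h2 := abs_le.1 (hsz j)
    rw [Real.dist_eq, abs_le]
    simp only [Set.mem_Ico] at h1
    constructor <;> linarith [h1.1, h1.2, h2.1, h2.2]
  have hd : Set.PairwiseDisjoint (T : Set (Fin n → ℤ)) (cub δ) := by
    intro z _ z' _ hne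
    rw [Function.onFun, Set.disjoint_left]
    intro x hx hx'
    apply hne
    funext j
    have h1 := hx j (Set.mem_univ _)
    have h2 := hx' j (Set.mem_univ _)
    simp only [Set.mem_Ico] at h1 h2
    have a : (z j : ℝ) < z' j + 1 := by
      have : δ * (z j : ℝ) < δ * (z' j + 1) := by linarith [h1.1, h2.2]
      exact lt_of_mul_lt_mul_left this hδ.le
    have b : (z' j : ℝ) < z j + 1 := by
      have : δ * (z' j : ℝ) < δ * (z j + 1) := by linarith [h2.1, h1.2]
      exact lt_of_mul_lt_mul_left this hδ.le
    have a' : z j < z' j + 1 := by exact_mod_cast a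
    have b' : z' j < z j + 1 := by exact_mod_cast b
    omega
  have hm := measure_mono (μ := volume) hsub
  rw [measure_biUnion_finset hd (fun z _ => MeasurableSet.univ_pi fun j => measurableSet_Ico)] at hm
  simp only [cub_vol hδ, Finset.sum_const, nsmul_eq_mul] at hm
  have h3 := ENNReal.toReal_mono (hS.cthickening.measure_lt_top.ne) hm
  rwa [ENNReal.toReal_mul, ENNReal.toReal_ofReal (by positivity), ENNReal.toReal_natCast] at h3

theorem discrete_bound {n m : ℕ} {δ : ℝ} (hδ : 0 < δ) (A : Set (Fin n → ℝ))
    (B : Fin (m + 1) → Set (Fin n → ℝ)) (hA : IsCompact A) (hB : ∀ i, IsCompact (B i))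
    (hAne : A.Nonempty) (hBne : ∀ i, (B i).Nonempty) :
    (volume A).toReal ^ m * (volume (∑ i, B i)).toReal ≤
      ∏ i, (volume (Metric.cthickening (((m + 1 + (m + 1) : ℝ) + 1) * δ) (A + B i))).toReal := by
  classical
  set r : ℝ := m + 1 with hr
  have hm0 : (0 : ℝ) ≤ m := Nat.cast_nonneg m
  have hr0 : 0 ≤ r := by positivity
  have hfl : ∀ (S : Set (Fin n → ℝ)), ∀ s ∈ S, (fun j => ⌊s j / δ⌋) ∈ latt δ r S := by
    intro S s hs
    refine ⟨s, hs, fun j => ?_⟩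
    have h := floor_err hδ (s j)
    have : 0 ≤ (m : ℝ) * δ := by positivity
    rw [abs_le, hr]
    constructor <;> linarith [h.1, h.2]
  set A' := (latt_finite (r := r) hδ hA).toFinset with hA'
  set B' := fun i => (latt_finite (r := r) hδ (hB i)).toFinset with hB'
  have hA'ne : A'.Nonempty := by
    obtain ⟨a, ha⟩ := hAne
    exact ⟨_, (Set.Finite.mem_toFinset _).2 (hfl A a ha)⟩
  have hB'ne : ∀ i, (B' i).Nonempty := by
    intro i
    obtain ⟨a, ha⟩ := hBne i
    exact ⟨_, (Set.Finite.mem_toFinset _).2 (hfl _ a ha)⟩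
  have hp := plunnecke_strong (m + 1) A' B' hA'ne hB'ne
  have hA0 : (0 : ℝ) < A'.card := by exact_mod_cast hA'ne.card_pos
  rw [pow_succ, mul_right_comm] at hp
  have hp' := le_of_mul_le_mul_right hp hA0
  have hvA : (volume A).toReal ≤ A'.card * δ ^ n :=
    vol_le_card hδ A' fun s hs => (Set.Finite.mem_toFinset _).2 (hfl A s hs)
  have hvB : (volume (∑ i, B i)).toReal ≤ (∑ i, B' i).card * δ ^ n := by
    refine vol_le_card hδ _ fun s hs => ?_
    rw [Set.mem_fintype_sum] at hs
    obtain ⟨b, hb, rfl⟩ := hs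
    rw [← Finset.mem_coe, Finset.coe_sum, Set.mem_fintype_sum]
    refine ⟨Fin.cons (fun j => ⌊(∑ i, b i) j / δ⌋ - ∑ i : Fin m, ⌊b i.succ j / δ⌋)
      (fun i j => ⌊b i.succ j / δ⌋), ?_, ?_⟩
    · intro i
      rw [Finset.mem_coe, Set.Finite.mem_toFinset]
      refine Fin.cases ?_ (fun i => ?_) i
      · refine ⟨b 0, hb 0, fun j => ?_⟩
        simp only [Fin.cons_zero]
        push_cast
        have h1 := floor_err hδ ((∑ i, b i) j)
        have h2 : ∑ i : Fin m, δ * (⌊b i.succ j / δ⌋ : ℝ) ≤ ∑ i : Fin m, b i.succ j :=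
          Finset.sum_le_sum fun i _ => (floor_err hδ _).1
        have h3 : ∑ i : Fin m, b i.succ j ≤ ∑ i : Fin m, (δ * (⌊b i.succ j / δ⌋ : ℝ) + δ) :=
          Finset.sum_le_sum fun i _ => (floor_err hδ _).2.le
        rw [Finset.sum_add_distrib, Finset.sum_const, Finset.card_univ, Fintype.card_fin,
          nsmul_eq_mul] at h3
        rw [← Finset.mul_sum] at h2 h3
        have h4 : (∑ i, b i) j = b 0 j + ∑ i : Fin m, b i.succ j := by
          rw [Finset.sum_apply, Fin.sum_univ_succ]
        have : 0 ≤ (m : ℝ) * δ := by positivity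
        rw [abs_le, hr]
        constructor <;> linarith [h1.1, h1.2]
      · simpa using hfl _ _ (hb i.succ)
    · rw [Fin.sum_univ_succ]
      funext j
      simp
  have hvAB : ∀ i, ((A' + B' i).card : ℝ) * δ ^ n ≤
      (volume (Metric.cthickening ((r + r + 1) * δ) (A + B i))).toReal := by
    intro i
    refine card_le_vol hδ (by positivity) (hA.add (hB i)) _ ?_
    intro z hz
    obtain ⟨x, hx, y, hy, rfl⟩ := Finset.mem_add.1 hz
    rw [Set.Finite.mem_toFinset] at hx hy
    obtain ⟨a, ha, hax⟩ := hx
    obtain ⟨b, hb, hby⟩ := hy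
    refine ⟨a + b, Set.add_mem_add ha hb, fun j => ?_⟩
    have h1 := abs_le.1 (hax j)
    have h2 := abs_le.1 (hby j)
    simp only [Pi.add_apply]
    push_cast
    rw [abs_le]
    constructor <;> linarith [h1.1, h1.2, h2.1, h2.2]
  calc (volume A).toReal ^ m * (volume (∑ i, B i)).toReal
      ≤ (A'.card * δ ^ n) ^ m * ((∑ i, B' i).card * δ ^ n) := by gcongr
    _ = (A'.card ^ m * (∑ i, B' i).card) * (δ ^ n) ^ (m + 1) := by ring
    _ ≤ (∏ i, ((A' + B' i).card : ℝ)) * (δ ^ n) ^ (m + 1) := by gcongr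
    _ = ∏ i, (((A' + B' i).card : ℝ) * δ ^ n) := by
        rw [Finset.prod_mul_distrib]; simp
    _ ≤ _ := Finset.prod_le_prod (fun i _ => by positivity) fun i _ => hvAB i

theorem ruzsa_pi {n m : ℕ} (A : Set (Fin n → ℝ))
    (B : Fin (m + 1) → Set (Fin n → ℝ)) (hA : IsCompact A) (hB : ∀ i, IsCompact (B i))
    (hAne : A.Nonempty) (hBne : ∀ i, (B i).Nonempty) :
    (volume A).toReal ^ m * (volume (∑ i, B i)).toReal ≤
      ∏ i, (volume (A + B i)).toReal := by
  have ht : Filter.Tendsto (fun δ : ℝ =>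
      ∏ i, (volume (Metric.cthickening (((m + 1 + (m + 1) : ℝ) + 1) * δ) (A + B i))).toReal)
      (nhdsWithin 0 (Set.Ioi 0)) (nhds (∏ i, (volume (A + B i)).toReal)) := by
    refine tendsto_finsetProd _ fun i _ => ?_
    refine (ENNReal.tendsto_toReal (hA.add (hB i)).measure_lt_top.ne).comp ?_
    refine (tendsto_measure_cthickening_of_isCompact (hA.add (hB i))).comp ?_
    refine Filter.Tendsto.mono_left ?_ nhdsWithin_le_nhds
    exact Continuous.tendsto' (by fun_prop) _ _ (by simp)
  refine ge_of_tendsto ht ?_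
  filter_upwards [self_mem_nhdsWithin] with δ hδ
  exact discrete_bound hδ A B hA hB hAne hBne

theorem ruzsa_type_inequality (n m : ℕ)
    (A : Set (EuclideanSpace ℝ (Fin n))) (B : Fin m → Set (EuclideanSpace ℝ (Fin n)))
    (hA : IsConvexBody A) (hB : ∀ k, IsConvexBody (B k))
    (hvol : 0 < (volume A).toReal) :
    (volume A).toReal ^ (m - 1) * (volume (∑ k, B k)).toReal ≤
      ∏ k, (volume (A + B k)).toReal := by
  cases m with
  | zero =>
    simp only [Finset.univ_eq_empty, Finset.sum_empty, Finset.prod_empty, Nat.zero_sub, pow_zero,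
      one_mul]
    rcases Nat.eq_zero_or_pos n with rfl | hn
    · rw [volume_euclideanSpace_eq_dirac]
      simp
    · have : Nonempty (Fin n) := ⟨⟨0, hn⟩⟩
      rw [← Set.singleton_zero, measure_singleton]
      simp
  | succ m =>
    let e : EuclideanSpace ℝ (Fin n) ≃L[ℝ] (Fin n → ℝ) := PiLp.continuousLinearEquiv 2 ℝ _
    have hv : ∀ S : Set (EuclideanSpace ℝ (Fin n)), volume (e '' S) = volume S := by
      intro S
      have h := (EuclideanSpace.volume_preserving_symm_measurableEquiv_toLp (Fin n)).symm
      have h2 := h.measure_preimage_equiv S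
      rw [← h2]
      congr 1
      ext x
      constructor
      · rintro ⟨s, hs, rfl⟩
        exact hs
      · intro hx
        exact ⟨_, hx, rfl⟩
    have hadd : ∀ S T : Set (EuclideanSpace ℝ (Fin n)), e '' (S + T) = e '' S + e '' T :=
      fun S T => Set.image_add e
    have hsum : ∑ k, e '' (B k) = e '' (∑ k, B k) := by
      ext x
      simp only [Set.mem_fintype_sum, Set.mem_image]
      constructor
      · rintro ⟨g, hg, rfl⟩
        choose f hf hfg using hg
        exact ⟨∑ i, f i, ⟨f, hf, rfl⟩, by rw [map_sum]; simp only [hfg]⟩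
      · rintro ⟨_, ⟨f, hf, rfl⟩, rfl⟩
        exact ⟨fun i => e (f i), fun i => ⟨f i, hf i, rfl⟩, by rw [map_sum]⟩
    have h := ruzsa_pi (e '' A) (fun k => e '' (B k)) (hA.2.1.image e.continuous)
      (fun k => (hB k).2.1.image e.continuous) ((hA.2.2.mono interior_subset).image e)
      (fun k => ((hB k).2.2.mono interior_subset).image e)
    rw [hsum] at h
    simp only [← hadd, hv] at h
    exact h
end
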